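/- There exists a constant C > 0 depending only on P and Q such that for every admissible prime p and all 1-bounded functions f0, f1, f2 : F_p^2 → ℂ, the counting operator 𝔼_{x1,x2,y} f0(x1,x2) f1(x1+P(y),x2) f2(x1,x2+Q(y)) equals 𝔼_{x1,x2} ( f0(x1,x2) · 𝔼_a f1(a,x2) · 𝔼_b f2(x1,b) ) up to an error of absolute value at most C · p^{-1/40960}. -/

import Mathlib

open scoped BigOperators ComplexOrder
open Polynomial

noncomputable section

namespace RatCorners

/-- Reduction of a rational number modulo `p` (genuine when `p` does not divide the
denominator). -/
def ratRed (p : ℕ) (q : ℚ) : ZMod p := (q.num : ZMod p) * (q.den : ZMod p)⁻¹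

/-- Coefficientwise reduction of a polynomial with rational coefficients modulo `p`. -/
def polyRed (p : ℕ) (f : Polynomial ℚ) : Polynomial (ZMod p) :=
  f.sum fun n a => Polynomial.C (ratRed p a) * Polynomial.X ^ n

/-- `p` divides no denominator of any coefficient of `P` (with numerator and denominator
of `P` in lowest terms). -/
def Admissible (p : ℕ) (P : RatFunc ℚ) : Prop :=
  (∀ n, ¬ p ∣ (P.num.coeff n).den) ∧ ∀ n, ¬ p ∣ (P.denom.coeff n).den

/-- `y` is a pole of the reduction of `P` modulo `p`. -/
def IsPole (p : ℕ) (P : RatFunc ℚ) (y : ZMod p) : Prop :=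
  (polyRed p P.denom).eval y = 0

instance (p : ℕ) (P : RatFunc ℚ) : DecidablePred (IsPole p P) := fun y =>
  inferInstanceAs (Decidable ((polyRed p P.denom).eval y = 0))

/-- Evaluation of the reduction of `P` modulo `p` at `y` (junk value `0` at poles). -/
def evalRed (p : ℕ) (P : RatFunc ℚ) (y : ZMod p) : ZMod p :=
  (polyRed p P.num).eval y * ((polyRed p P.denom).eval y)⁻¹

/-- A function is `1`-bounded if all its values have norm at most `1`. -/
def OneBounded {α : Type*} (f : α → ℂ) : Prop := ∀ x, ‖f x‖ ≤ 1

/-- The formal derivative of a rational function. -/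
def ratDeriv (P : RatFunc ℚ) : RatFunc ℚ :=
  algebraMap (Polynomial ℚ) (RatFunc ℚ)
      (Polynomial.derivative P.num * P.denom - P.num * Polynomial.derivative P.denom) /
    algebraMap (Polynomial ℚ) (RatFunc ℚ) (P.denom ^ 2)

/-- Substitution of the variable `y i` into a rational function `P ∈ ℚ(t)`, producing an
element of the rational function field `ℚ(y 0, …, y (n-1))`. -/
def substAt {n : ℕ} (P : RatFunc ℚ) (i : Fin n) : FractionRing (MvPolynomial (Fin n) ℚ) :=
  Polynomial.eval₂
      ((algebraMap (MvPolynomial (Fin n) ℚ) (FractionRing (MvPolynomial (Fin n) ℚ))).comp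
        MvPolynomial.C)
      (algebraMap (MvPolynomial (Fin n) ℚ) (FractionRing (MvPolynomial (Fin n) ℚ))
        (MvPolynomial.X i)) P.num /
    Polynomial.eval₂
      ((algebraMap (MvPolynomial (Fin n) ℚ) (FractionRing (MvPolynomial (Fin n) ℚ))).comp
        MvPolynomial.C)
      (algebraMap (MvPolynomial (Fin n) ℚ) (FractionRing (MvPolynomial (Fin n) ℚ))
        (MvPolynomial.X i)) P.denom

variable (p : ℕ) [NeZero p]

/-- The counting operator `𝔼_{x₁,x₂,y} f₀(x₁,x₂) f₁(x₁+P(y),x₂) f₂(x₁,x₂+Q(y))`,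
where the average in `y` avoids the poles of `P` and `Q` but is still normalized by `1/p`. -/
def cornerAvg (P Q : RatFunc ℚ) (f0 f1 f2 : ZMod p × ZMod p → ℂ) : ℂ :=
  (p : ℂ)⁻¹ ^ 3 * ∑ x1 : ZMod p, ∑ x2 : ZMod p, ∑ y : ZMod p,
    if ¬ IsPole p P y ∧ ¬ IsPole p Q y then
      f0 (x1, x2) * f1 (x1 + evalRed p P y, x2) * f2 (x1, x2 + evalRed p Q y)
    else 0

/-- The main term `𝔼_{x₁,x₂} f₀(x₁,x₂) · 𝔼_a f₁(a,x₂) · 𝔼_b f₂(x₁,b)`. -/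
def mainTerm (f0 f1 f2 : ZMod p × ZMod p → ℂ) : ℂ :=
  (p : ℂ)⁻¹ ^ 2 * ∑ x1 : ZMod p, ∑ x2 : ZMod p,
    f0 (x1, x2) * ((p : ℂ)⁻¹ * ∑ a : ZMod p, f1 (a, x2)) *
      ((p : ℂ)⁻¹ * ∑ b : ZMod p, f2 (x1, b))

/-- The `L^r` norm with respect to the uniform probability measure on `(ZMod p)²`. -/
def Lnorm (r : ℝ) (f : ZMod p × ZMod p → ℂ) : ℝ :=
  ((p : ℝ)⁻¹ ^ 2 * ∑ x : ZMod p × ZMod p, ‖f x‖ ^ r) ^ r⁻¹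

/-- The Gowers norm `‖f‖_{U²(0×F_p)}` along the second coordinate axis. -/
def U2vert (f : ZMod p × ZMod p → ℂ) : ℝ :=
  ((p : ℝ)⁻¹ ^ 4 * (∑ x : ZMod p × ZMod p, ∑ h : ZMod p, ∑ k : ZMod p,
      f x * (starRingEnd ℂ) (f (x + (0, h))) * (starRingEnd ℂ) (f (x + (0, k))) *
        f (x + (0, h + k))).re) ^ ((4:ℝ)⁻¹)

/-- The Gowers norm `‖f‖_{U²(F_p×0)}` along the first coordinate axis. -/
def U2horiz (f : ZMod p × ZMod p → ℂ) : ℝ :=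
  ((p : ℝ)⁻¹ ^ 4 * (∑ x : ZMod p × ZMod p, ∑ h : ZMod p, ∑ k : ZMod p,
      f x * (starRingEnd ℂ) (f (x + (h, 0))) * (starRingEnd ℂ) (f (x + (k, 0))) *
        f (x + (h + k, 0))).re) ^ ((4:ℝ)⁻¹)

/-- The additive character `e_p(x) = e^{2πix/p}` on `ZMod p`. -/
def ep (x : ZMod p) : ℂ := Complex.exp (2 * Real.pi * Complex.I * (x.val : ℂ) / (p : ℂ))

/-- `e(r) = e^{2πir}` for a real number `r`. -/
def eC (r : ℝ) : ℂ := Complex.exp (2 * Real.pi * Complex.I * (r : ℂ))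

/-- The Fourier transform `f̂(ξ) = 𝔼_x f(x) e_p(−x·ξ)` on `(ZMod p)²`. -/
def dft (f : ZMod p × ZMod p → ℂ) (ξ : ZMod p × ZMod p) : ℂ :=
  (p : ℂ)⁻¹ ^ 2 * ∑ x : ZMod p × ZMod p, f x * ep p (-(x.1 * ξ.1 + x.2 * ξ.2))

/-- `F₁(n₁,𝐡) = ∑_{n₂} Δ_{−𝐡} f̂₁(n₁,n₂)` where `Δ_h g(x) = g(x)·conj g(x+h)`. -/
def F1 (f : ZMod p × ZMod p → ℂ) (n1 : ZMod p) (h : ZMod p × ZMod p) : ℂ :=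
  ∑ n2 : ZMod p, dft p f (n1, n2) * (starRingEnd ℂ) (dft p f ((n1, n2) + -h))

/-- `F₂(m₂,𝐡) = ∑_{m₁} Δ_{𝐡} f̂₂(m₁,m₂)` where `Δ_h g(x) = g(x)·conj g(x+h)`. -/
def F2 (f : ZMod p × ZMod p → ℂ) (m2 : ZMod p) (h : ZMod p × ZMod p) : ℂ :=
  ∑ m1 : ZMod p, dft p f (m1, m2) * (starRingEnd ℂ) (dft p f ((m1, m2) + h))

/-- The `F_p`-points of the Roth variety for corners associated to `P, Q`:
tuples `(y₁,…,y₁₆)` (indexed here by `0,…,15`) avoiding all poles of `P` and `Q` and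
satisfying the ten defining equations. -/
def IsRothPoint (P Q : RatFunc ℚ) (y : Fin 16 → ZMod p) : Prop :=
  (∀ i, ¬ IsPole p P (y i)) ∧ (∀ i, ¬ IsPole p Q (y i)) ∧
  evalRed p P (y 0) - evalRed p P (y 2) - evalRed p P (y 8) + evalRed p P (y 10) = 0 ∧
  evalRed p P (y 1) - evalRed p P (y 3) - evalRed p P (y 9) + evalRed p P (y 11) = 0 ∧
  evalRed p P (y 4) - evalRed p P (y 6) - evalRed p P (y 12) + evalRed p P (y 14) = 0 ∧
  evalRed p P (y 5) - evalRed p P (y 7) - evalRed p P (y 13) + evalRed p P (y 15) = 0 ∧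
  evalRed p Q (y 0) - evalRed p Q (y 1) - evalRed p Q (y 8) + evalRed p Q (y 9) = 0 ∧
  evalRed p Q (y 2) - evalRed p Q (y 6) - evalRed p Q (y 10) + evalRed p Q (y 14) = 0 ∧
  evalRed p Q (y 3) - evalRed p Q (y 7) - evalRed p Q (y 11) + evalRed p Q (y 15) = 0 ∧
  evalRed p Q (y 4) - evalRed p Q (y 5) - evalRed p Q (y 12) + evalRed p Q (y 13) = 0 ∧
  evalRed p P (y 8) - evalRed p P (y 9) - evalRed p P (y 10) + evalRed p P (y 11) -
      evalRed p P (y 12) + evalRed p P (y 13) + evalRed p P (y 14) - evalRed p P (y 15) = 0 ∧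
  evalRed p Q (y 8) - evalRed p Q (y 9) - evalRed p Q (y 10) + evalRed p Q (y 11) -
      evalRed p Q (y 12) + evalRed p Q (y 13) + evalRed p Q (y 14) - evalRed p Q (y 15) = 0

/-- `|Y(F_p)|`, the number of `F_p`-points of the Roth variety for corners. -/
def rothCard (P Q : RatFunc ℚ) : ℕ :=
  Nat.card {y : Fin 16 → ZMod p // IsRothPoint p P Q y}

/-- `χ` is an eigenfunction with respect to the first coordinate:
`χ(x₁,x₂) = 1_E(x₂) e_p(φ(x₂)x₁) e(ψ(x₂))`. -/
def IsEigen1 (χ : ZMod p × ZMod p → ℂ) : Prop :=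
  ∃ (E : Finset (ZMod p)) (φ : ZMod p → ZMod p) (ψ : ZMod p → ℝ),
    ∀ x1 x2 : ZMod p,
      χ (x1, x2) = (if x2 ∈ E then 1 else 0) * ep p (φ x2 * x1) * eC (ψ x2)

/-- `χ` is an eigenfunction with respect to the second coordinate:
`χ(x₁,x₂) = 1_E(x₁) e_p(φ(x₁)x₂) e(ψ(x₁))`. -/
def IsEigen2 (χ : ZMod p × ZMod p → ℂ) : Prop :=
  ∃ (E : Finset (ZMod p)) (φ : ZMod p → ZMod p) (ψ : ZMod p → ℝ),
    ∀ x1 x2 : ZMod p,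
      χ (x1, x2) = (if x1 ∈ E then 1 else 0) * ep p (φ x1 * x2) * eC (ψ x1)

/-- The two-term counting operator `𝔼_{x₁,x₂,y} f₀(x₁,x₂) f₁(x₁+P(y),x₂)`. -/
def twoAvg1 (P : RatFunc ℚ) (f0 f1 : ZMod p × ZMod p → ℂ) : ℂ :=
  (p : ℂ)⁻¹ ^ 3 * ∑ x1 : ZMod p, ∑ x2 : ZMod p, ∑ y : ZMod p,
    if ¬ IsPole p P y then f0 (x1, x2) * f1 (x1 + evalRed p P y, x2) else 0

/-- The two-term counting operator `𝔼_{x₁,x₂,y} f₀(x₁,x₂) f₁(x₁,x₂+P(y))`. -/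
def twoAvg2 (P : RatFunc ℚ) (f0 f1 : ZMod p × ZMod p → ℂ) : ℂ :=
  (p : ℂ)⁻¹ ^ 3 * ∑ x1 : ZMod p, ∑ x2 : ZMod p, ∑ y : ZMod p,
    if ¬ IsPole p P y then f0 (x1, x2) * f1 (x1, x2 + evalRed p P y) else 0

section

/-- A homogeneous linear system with more unknowns than equations has a nonzero solution. -/
theorem exists_ne_zero_coeff_sum_eq_zero {F ι : Type*} [Field F] [Fintype ι]
    (g : ι → F[X]) (M : ℕ) (hg : ∀ i, (g i).natDegree < M) (hM : M < Fintype.card ι) :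
    ∃ b : ι → F, b ≠ 0 ∧ ∑ i, C (b i) * g i = 0 := by
  let L : (ι → F) →ₗ[F] (Fin M → F) :=
    { toFun := fun b m => (∑ i, C (b i) * g i).coeff m
      map_add' := by
        intro a b; ext m
        simp [add_mul, Finset.sum_add_distrib]
      map_smul' := by
        intro a b; ext m
        simp [Finset.mul_sum, mul_assoc] }
  have hL : LinearMap.ker L ≠ ⊥ := LinearMap.ker_ne_bot_of_finrank_lt (by simpa using hM)
  obtain ⟨b, hb, hb0⟩ := (Submodule.ne_bot_iff _).1 hL
  refine ⟨b, hb0, ?_⟩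
  ext m
  by_cases hm : m < M
  · have := congrFun (LinearMap.mem_ker.1 hb) ⟨m, hm⟩
    simpa [L] using this
  · rw [Polynomial.finsetSum_coeff]
    simp only [coeff_C_mul, coeff_zero]
    refine Finset.sum_eq_zero fun i _ => ?_
    rw [coeff_eq_zero_of_natDegree_lt (by have := hg i; omega), mul_zero]

/-- The polynomial `v ^ e` times the half trace of `u / v`. -/
def halfTrace {F : Type*} [Field F] (p μ : ℕ) (u v : F[X]) : F[X] :=
  ∑ i ∈ Finset.range μ, u ^ p ^ i * v ^ (p ^ (μ - 1) - p ^ i)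

theorem halfTrace_degree {F : Type*} [Field F] {p μ : ℕ} (hp : 2 ≤ p) (hμ : 1 ≤ μ) {u v : F[X]}
    (hv : v ≠ 0) (huv : v.natDegree < u.natDegree) :
    halfTrace p μ u v ≠ 0 ∧ (halfTrace p μ u v).natDegree = p ^ (μ - 1) * u.natDegree := by
  obtain ⟨ν, rfl⟩ : ∃ ν, μ = ν + 1 := ⟨μ - 1, by omega⟩
  have hu : u ≠ 0 := by rintro rfl; simp at huv
  have h1 : (halfTrace p (ν + 1) u v).degree = (u ^ p ^ ν).degree := by
    rw [halfTrace, Finset.sum_range_succ]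
    simp only [Nat.add_sub_cancel, Nat.sub_self, pow_zero, mul_one]
    refine Polynomial.degree_add_eq_right_of_degree_lt ?_
    refine lt_of_le_of_lt (Polynomial.degree_sum_le _ _) ?_
    rw [Finset.sup_lt_iff (bot_lt_iff_ne_bot.2 fun h =>
      pow_ne_zero _ hu (degree_eq_bot.1 h))]
    intro i hi
    have hi' := Finset.mem_range.1 hi
    have hpi : p ^ i < p ^ ν := Nat.pow_lt_pow_right (by omega) hi'
    refine Polynomial.degree_lt_degree ?_
    rw [natDegree_mul (pow_ne_zero _ hu) (pow_ne_zero _ hv), natDegree_pow, natDegree_pow,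
      natDegree_pow]
    obtain ⟨m, hm⟩ := Nat.exists_eq_add_of_lt hpi
    rw [hm, show p ^ i + m + 1 - p ^ i = m + 1 by omega]
    nlinarith
  have h0 : halfTrace p (ν + 1) u v ≠ 0 := by
    intro h
    rw [h, degree_zero] at h1
    exact (pow_ne_zero (p ^ ν) hu) (degree_eq_bot.1 h1.symm)
  refine ⟨h0, ?_⟩
  rw [natDegree_eq_of_degree_eq h1, natDegree_pow]
  simp

theorem halfTrace_eval {F : Type*} [Field F] {p μ : ℕ} (hp : 2 ≤ p) (u v : F[X]) (x : F)
    (hx : v.eval x ≠ 0) :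
    (halfTrace p μ u v).eval x =
      (∑ i ∈ Finset.range μ, (u.eval x / v.eval x) ^ p ^ i) * (v.eval x) ^ p ^ (μ - 1) := by
  rw [halfTrace, eval_finsetSum, Finset.sum_mul]
  refine Finset.sum_congr rfl fun i hi => ?_
  have hi' := Finset.mem_range.1 hi
  have : p ^ i ≤ p ^ (μ - 1) := Nat.pow_le_pow_right (by omega) (by omega)
  rw [eval_mul, eval_pow, eval_pow, div_pow, ← Nat.add_sub_of_le this, pow_add,
    Nat.add_sub_cancel_left]
  field_simp

/-- Stepanov's bound for the points at which `u / v` has a given trace. -/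
theorem stepanov_bound {F : Type*} [Field F] [Fintype F] {p μ : ℕ} [hp : Fact p.Prime] [CharP F p]
    (hμ : 1 ≤ μ) (hcard : Fintype.card F = p ^ (2 * μ)) {u v : F[X]} (hv : v ≠ 0)
    (huv : v.natDegree < u.natDegree) (hk : u.natDegree - v.natDegree < p) (c : F)
    (T : Finset F) (hT : ∀ x ∈ T, v.eval x ≠ 0 ∧
      ∑ i ∈ Finset.range (2 * μ), (u.eval x / v.eval x) ^ p ^ i = c) :
    T.card ≤ p ^ μ * (p ^ (μ - 1) + 2 * u.natDegree + 1) := by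
  classical
  have hp2 := hp.out.two_le
  set e := p ^ (μ - 1) with he
  have he1 : 1 ≤ e := Nat.one_le_pow _ _ (by omega)
  have hP : p ^ μ = p * e := by
    rw [he, ← pow_succ']; congr 1; omega
  set du := u.natDegree with hdu
  set dv := v.natDegree with hdv
  set J := e + du + 1 with hJ
  set t := halfTrace p μ u v with ht
  have ht0 : t ≠ 0 := (halfTrace_degree hp2 hμ hv huv).1
  have htd : t.natDegree = e * du := (halfTrace_degree hp2 hμ hv huv).2
  let ι := Fin J × Fin p × Fin e
  have hsD : (C c * v ^ e - t).natDegree ≤ e * du := by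
    refine (natDegree_sub_le_of_le ?_ htd.le).trans (max_self _).le
    refine (natDegree_C_mul_le _ _).trans ?_
    rw [natDegree_pow]
    exact Nat.mul_le_mul_left _ huv.le
  let g : ι → F[X] := fun i => X ^ (p ^ μ * (i.2.2 : ℕ) + i.1) *
    ((C c * v ^ e - t) ^ (i.2.1 : ℕ) * v ^ (e * (p - 1 - i.2.1)))
  have hprod : ∀ (s : F[X]), s.natDegree ≤ e * du → ∀ κ : Fin p,
      (s ^ (κ : ℕ) * v ^ (e * (p - 1 - κ))).natDegree ≤ (p - 1) * (e * du) := by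
    intro s hs κ
    refine natDegree_mul_le.trans ?_
    rw [natDegree_pow, natDegree_pow]
    have hκ := κ.2
    obtain ⟨m, hm⟩ : ∃ m, p - 1 = κ + m := ⟨p - 1 - κ, by omega⟩
    rw [hm, Nat.add_sub_cancel_left]
    have h1 : (κ : ℕ) * s.natDegree ≤ κ * (e * du) := Nat.mul_le_mul_left _ hs
    have h2 : e * m * dv ≤ m * (e * du) := by
      have := Nat.mul_le_mul_left (e * m) huv.le
      nlinarith
    nlinarith
  have hgd : ∀ i, (g i).natDegree < p ^ μ * (e - 1) + J + (p - 1) * (e * du) := by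
    intro i
    refine lt_of_le_of_lt natDegree_mul_le ?_
    rw [natDegree_X_pow]
    have h1 := hprod _ hsD i.2.1
    have h2 : p ^ μ * (i.2.2 : ℕ) ≤ p ^ μ * (e - 1) :=
      Nat.mul_le_mul_left _ (by have := i.2.2.2; omega)
    have h3 := i.1.2
    omega
  obtain ⟨b, hb0, hb⟩ := exists_ne_zero_coeff_sum_eq_zero g _ hgd (by
    simp only [ι, Fintype.card_prod, Fintype.card_fin]
    rw [hP, hJ]
    obtain ⟨e', he'⟩ : ∃ e', e = e' + 1 := ⟨e - 1, by omega⟩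
    obtain ⟨p', hp'⟩ : ∃ p', p = p' + 2 := ⟨p - 2, by omega⟩
    rw [he', hp', show p' + 2 - 1 = p' + 1 by omega, Nat.add_sub_cancel]
    ring_nf
    nlinarith [Nat.zero_le (e' * p'), Nat.zero_le (e' * du), Nat.zero_le (e' * e'),
      Nat.zero_le (e' * p' * du)])
  let h : ι → F[X] := fun i => C (b i ^ p ^ μ) * (X ^ ((i.2.2 : ℕ) + p ^ μ * i.1) *
    (t ^ (i.2.1 : ℕ) * v ^ (e * (p - 1 - i.2.1))))
  have hhd : ∀ i, h i ≠ 0 → (h i).natDegree =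
      i.2.2 + e * (p * i.1 + i.2.1 * (du - dv) + (p - 1) * dv) := by
    intro i hi
    have hbi : b i ^ p ^ μ ≠ 0 := by
      intro h0; apply hi; simp only [h, h0, map_zero, zero_mul]
    rw [natDegree_C_mul hbi, natDegree_mul (pow_ne_zero _ X_ne_zero)
      (mul_ne_zero (pow_ne_zero _ ht0) (pow_ne_zero _ hv)), natDegree_mul
      (pow_ne_zero _ ht0) (pow_ne_zero _ hv), natDegree_X_pow, natDegree_pow, natDegree_pow, htd,
      hP, ← hdv]
    have hκ := i.2.1.2
    obtain ⟨m, hm⟩ : ∃ m, p - 1 = i.2.1 + m := ⟨p - 1 - i.2.1, by omega⟩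
    obtain ⟨k, hk'⟩ : ∃ k, du = dv + k := ⟨du - dv, by omega⟩
    rw [hm, Nat.add_sub_cancel_left, hk', Nat.add_sub_cancel_left]
    ring
  have hinj : ∀ i j : ι, h i ≠ 0 → h j ≠ 0 → (h i).natDegree = (h j).natDegree → i = j := by
    intro i j hi hj hij
    rw [hhd i hi, hhd j hj] at hij
    have ha : (i.2.2 : ℕ) = j.2.2 := by
      have := congrArg (· % e) hij
      simpa [Nat.add_mul_mod_self_left, Nat.mod_eq_of_lt i.2.2.2, Nat.mod_eq_of_lt j.2.2.2]
        using this
    have hq : p * (i.1 : ℕ) + i.2.1 * (du - dv) = p * j.1 + j.2.1 * (du - dv) := by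
      rw [ha] at hij
      have := Nat.eq_of_mul_eq_mul_left he1 (Nat.add_left_cancel hij)
      omega
    have hκ : (i.2.1 : ℕ) = j.2.1 := by
      have h1 : (i.2.1 : ℕ) * (du - dv) ≡ j.2.1 * (du - dv) [MOD p] := by
        have := congrArg (· % p) hq
        simpa [Nat.ModEq, Nat.mul_add_mod] using this
      have hcop : Nat.gcd p (du - dv) = 1 :=
        (hp.out.coprime_iff_not_dvd).2 fun hd => by
          have := Nat.le_of_dvd (by omega) hd
          omega
      have h2 := Nat.ModEq.cancel_right_of_coprime hcop h1
      rwa [Nat.ModEq, Nat.mod_eq_of_lt i.2.1.2, Nat.mod_eq_of_lt j.2.1.2] at h2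
    have hj' : (i.1 : ℕ) = j.1 := by
      rw [hκ] at hq
      exact Nat.eq_of_mul_eq_mul_left (by omega : 0 < p) (Nat.add_right_cancel hq)
    exact Prod.ext (Fin.ext hj') (Prod.ext (Fin.ext hκ) (Fin.ext ha))
  set H := ∑ i, h i with hH
  have hH0 : H ≠ 0 := by
    obtain ⟨i₀, hi₀⟩ := Function.ne_iff.1 hb0
    have hhi : h i₀ ≠ 0 := by
      simp only [h]
      exact mul_ne_zero (C_ne_zero.2 (pow_ne_zero _ hi₀)) (mul_ne_zero (pow_ne_zero _ X_ne_zero)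
        (mul_ne_zero (pow_ne_zero _ ht0) (pow_ne_zero _ hv)))
    intro h0
    have hdeg := Polynomial.degree_sum_eq_of_disjoint h Finset.univ (by
      intro i hi j hj hij hd
      exact hij (hinj i j hi.2 hj.2 (natDegree_eq_of_degree_eq hd)))
    rw [← hH, h0, degree_zero] at hdeg
    have := Finset.le_sup (f := fun i => (h i).degree) (Finset.mem_univ i₀)
    rw [← hdeg, le_bot_iff] at this
    exact hhi (degree_eq_bot.1 this)
  have hroot : ∀ x ∈ T, H.eval x = 0 := by
    intro x hx
    obtain ⟨hvx, hsum⟩ := hT x hx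
    have htx := halfTrace_eval (μ := μ) hp2 u v x hvx
    rw [← ht, ← he] at htx
    set f := u.eval x / v.eval x with hf
    set Tx := ∑ i ∈ Finset.range μ, f ^ p ^ i with hTx
    have hTP : Tx ^ p ^ μ = c - Tx := by
      rw [← hsum, two_mul, Finset.sum_range_add, hTx, sum_pow_char_pow]
      rw [add_sub_cancel_left]
      refine Finset.sum_congr rfl fun i _ => ?_
      rw [← pow_mul, ← pow_add, add_comm]
    have hq : ∀ y : F, (y ^ p ^ μ) ^ p ^ μ = y := by
      intro y
      rw [← pow_mul, ← pow_add, ← two_mul, ← hcard, FiniteField.pow_card]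
    have hpow : H.eval x ^ p ^ μ = 0 := by
      rw [hH, eval_finsetSum, sum_pow_char_pow]
      have hb' := congrArg (fun f => f.eval x * v.eval x ^ (e * (p ^ μ - 1) * (p - 1))) hb
      simp only [eval_finsetSum, eval_zero, zero_mul, Finset.sum_mul] at hb'
      rw [← hb']
      refine Finset.sum_congr rfl fun i _ => ?_
      simp only [h, g, eval_mul, eval_C, eval_pow, eval_X, eval_sub, mul_pow, hq, htx]
      have e1 : ∀ n : ℕ, (Tx ^ n) ^ p ^ μ = (c - Tx) ^ n := by
        intro n; rw [← hTP, ← pow_mul, ← pow_mul, mul_comm]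
      have e2 : (x ^ ((i.2.2 : ℕ) + p ^ μ * i.1)) ^ p ^ μ = x ^ (p ^ μ * (i.2.2 : ℕ) + i.1) := by
        rw [pow_add, mul_pow, ← pow_mul x (_ * _), mul_right_comm, pow_mul, pow_mul x (p ^ μ), hq,
          ← pow_mul, pow_add, mul_comm (i.2.2 : ℕ)]
      rw [e1, e2, show c * eval x v ^ e - Tx * eval x v ^ e = (c - Tx) * eval x v ^ e by ring,
        mul_pow]
      have e3 : ((eval x v ^ e) ^ (i.2.1 : ℕ)) ^ p ^ μ * (eval x v ^ (e * (p - 1 - i.2.1))) ^ p ^ μ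
          = (eval x v ^ e) ^ (i.2.1 : ℕ) * eval x v ^ (e * (p - 1 - i.2.1)) *
            eval x v ^ (e * (p ^ μ - 1) * (p - 1)) := by
        simp only [← pow_mul, ← pow_add]
        congr 1
        have hκ := i.2.1.2
        obtain ⟨m, hm⟩ : ∃ m, p - 1 = i.2.1 + m := ⟨p - 1 - i.2.1, by omega⟩
        obtain ⟨w, hw⟩ : ∃ w, p ^ μ = w + 1 := ⟨p ^ μ - 1, by
          have : 1 ≤ p ^ μ := Nat.one_le_pow _ _ (by omega)
          omega⟩
        rw [hm, hw, Nat.add_sub_cancel_left, Nat.add_sub_cancel]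
        ring
      linear_combination (b i * x ^ (p ^ μ * (i.2.2 : ℕ) + i.1) * (c - Tx) ^ (i.2.1 : ℕ)) * e3
    exact pow_eq_zero_iff (pow_ne_zero _ (by omega)) |>.1 hpow
  have hHd : H.natDegree ≤ p ^ μ * (e + 2 * du + 1) := by
    refine natDegree_sum_le_of_forall_le _ _ fun i _ => ?_
    by_cases hi : h i = 0
    · rw [hi, natDegree_zero]; exact Nat.zero_le _
    rw [hhd i hi, hP]
    have h1 := i.1.2
    have h2 := i.2.1.2
    have h3 := i.2.2.2
    have h4 : (i.1 : ℕ) ≤ e + du := by omega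
    have h5 : (i.2.1 : ℕ) * (du - dv) + (p - 1) * dv ≤ (p - 1) * du := by
      obtain ⟨k, hk'⟩ : ∃ k, du = dv + k := ⟨du - dv, by omega⟩
      have : (i.2.1 : ℕ) ≤ p - 1 := by omega
      rw [hk', Nat.add_sub_cancel_left]
      nlinarith [Nat.mul_le_mul_right k this]
    have h6 : (p - 1) * du ≤ p * du := Nat.mul_le_mul_right _ (by omega)
    have h7 : p * (i.1 : ℕ) ≤ p * (e + du) := Nat.mul_le_mul_left _ h4
    calc (i.2.2 : ℕ) + e * (p * i.1 + i.2.1 * (du - dv) + (p - 1) * dv)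
        ≤ p * e + e * (p * (e + du) + p * du) :=
          Nat.add_le_add (by nlinarith) (Nat.mul_le_mul_left _ (by omega))
      _ = p * e * (e + 2 * du + 1) := by ring
  calc T.card ≤ H.roots.toFinset.card := Finset.card_le_card fun x hx => by
        rw [Multiset.mem_toFinset, mem_roots hH0]; exact hroot x hx
    _ ≤ H.roots.card := Multiset.toFinset_card_le _
    _ ≤ H.natDegree := card_roots' _
    _ ≤ _ := hHd

end

section

/-- The numerator polynomial of degree `D` obtained from `u` by the substitution
`x = α + 1 / z`. -/
def moebiusPoly {F : Type*} [Field F] (D : ℕ) (α : F) (u : F[X]) : F[X] :=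
  reflect D (taylor α u)

theorem moebiusPoly_eval {F : Type*} [Field F] {D : ℕ} {α x : F} {u : F[X]} (hu : u.natDegree ≤ D)
    (hx : x ≠ α) :
    (moebiusPoly D α u).eval (x - α)⁻¹ = u.eval x * ((x - α)⁻¹) ^ D := by
  have h0 : x - α ≠ 0 := sub_ne_zero.2 hx
  let _ := invertibleOfNonzero h0
  have h := eval₂_reflect_mul_pow (RingHom.id F) (x - α) D (taylor α u)
    (by rwa [natDegree_taylor])
  rw [invOf_eq_inv] at h
  change (moebiusPoly D α u).eval (x - α)⁻¹ * (x - α) ^ D = (taylor α u).eval (x - α) at h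
  rw [taylor_eval, sub_add_cancel] at h
  rw [← h, mul_assoc, ← mul_pow, mul_inv_cancel₀ h0, one_pow, mul_one]

theorem moebiusPoly_coeff {F : Type*} [Field F] (D : ℕ) (α : F) (u : F[X]) :
    (moebiusPoly D α u).coeff D = u.eval α := by
  rw [moebiusPoly, coeff_reflect, revAt_le le_rfl, Nat.sub_self, taylor_coeff_zero]

theorem moebiusPoly_natDegree_le {F : Type*} [Field F] {D : ℕ} {u : F[X]} (α : F)
    (hu : u.natDegree ≤ D) : (moebiusPoly D α u).natDegree ≤ D := by
  rw [natDegree_le_iff_coeff_eq_zero]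
  intro N hN
  rw [moebiusPoly, coeff_reflect, revAt_eq_self_of_lt hN]
  exact coeff_eq_zero_of_natDegree_lt (by rw [natDegree_taylor]; omega)

theorem moebiusPoly_ne_zero {F : Type*} [Field F] {D : ℕ} {u : F[X]} (α : F) (hu : u ≠ 0) :
    moebiusPoly D α u ≠ 0 := by
  intro h
  rw [moebiusPoly, reflect_eq_zero_iff] at h
  exact hu ((taylor_injective α) (by simpa using h))

theorem card_trace_eq_le {p : ℕ} [Fact p.Prime] {F : Type*} [Field F] [Fintype F]
    [Algebra (ZMod p) F] {μ : ℕ} (hμ : 1 ≤ μ) (hcard : Fintype.card F = p ^ (2 * μ))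
    {u v : F[X]} (huv : IsCoprime u v) (hdeg : u.natDegree < v.natDegree)
    (hvp : v.natDegree < p) {α : F} (hα : v.eval α = 0) (c : ZMod p) (T : Finset F)
    (hT : ∀ x ∈ T, v.eval x ≠ 0 ∧ Algebra.trace (ZMod p) F (u.eval x / v.eval x) = c) :
    T.card ≤ p ^ μ * (p ^ (μ - 1) + 2 * v.natDegree + 1) := by
  classical
  have : CharP F p := charP_of_injective_algebraMap (algebraMap (ZMod p) F).injective p
  have hv0 : v ≠ 0 := by rintro rfl; simp at hdeg
  have huα : u.eval α ≠ 0 := by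
    intro h
    obtain ⟨a, b, hab⟩ := huv
    have := congrArg (eval α) hab
    simp [h, hα] at this
  have hrank : Module.finrank (ZMod p) F = 2 * μ := by
    have h := Module.card_eq_pow_finrank (K := ZMod p) (V := F)
    rw [ZMod.card, hcard] at h
    exact (Nat.pow_right_injective (Fact.out : p.Prime).two_le h).symm
  set D := v.natDegree with hD
  set u' := moebiusPoly D α u with hu'
  set v' := moebiusPoly D α v with hv'
  have hu'd : u'.natDegree = D :=
    le_antisymm (moebiusPoly_natDegree_le α hdeg.le)
      (le_natDegree_of_ne_zero (by rwa [hu', moebiusPoly_coeff]))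
  have hv'0 : v' ≠ 0 := moebiusPoly_ne_zero α hv0
  have hv'd : v'.natDegree < D := by
    refine lt_of_le_of_ne (moebiusPoly_natDegree_le α le_rfl) fun h => ?_
    have : v'.leadingCoeff = 0 := by rw [leadingCoeff, h, hv', moebiusPoly_coeff, hα]
    exact hv'0 (leadingCoeff_eq_zero.1 this)
  have hinj : Set.InjOn (fun x : F => (x - α)⁻¹) T := by
    intro x _ y _ h
    simpa using h
  rw [← Finset.card_image_of_injOn hinj]
  have := stepanov_bound hμ hcard hv'0 (by rwa [hu'd]) (by rw [hu'd]; omega)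
    (algebraMap (ZMod p) F c) (T.image fun x : F => (x - α)⁻¹) (by
      intro z hz
      obtain ⟨x, hx, rfl⟩ := Finset.mem_image.1 hz
      obtain ⟨h1, h2⟩ := hT x hx
      have hxα : x ≠ α := by rintro rfl; exact h1 hα
      have h0 : ((x - α)⁻¹) ^ D ≠ 0 := pow_ne_zero _ (inv_ne_zero (sub_ne_zero.2 hxα))
      rw [hu', hv', moebiusPoly_eval hdeg.le hxα, moebiusPoly_eval hD.ge hxα]
      refine ⟨mul_ne_zero h1 h0, ?_⟩
      rw [mul_div_mul_right _ _ h0, ← h2, FiniteField.algebraMap_trace_eq_sum_pow, hrank,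
        Nat.card_zmod])
  rwa [hu'd] at this

/-- Additive character sum of `u / v` over the non-roots of `v` in an extension of `ZMod p`. -/
def charSum {p : ℕ} (ψ : AddChar (ZMod p) ℂ) (F : Type*) [Field F] [Fintype F] [Algebra (ZMod p) F]
    (u v : (ZMod p)[X]) : ℂ :=
  open Classical in
  ∑ x : F, if aeval x v = 0 then 0 else ψ (Algebra.trace (ZMod p) F (aeval x u / aeval x v))

theorem norm_charSum_le_of_root {p : ℕ} [Fact p.Prime] {ψ : AddChar (ZMod p) ℂ} (hψ : ψ ≠ 1)
    {F : Type*} [Field F] [Fintype F]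
    [Algebra (ZMod p) F] {μ : ℕ} (hμ : 1 ≤ μ) (hcard : Fintype.card F = p ^ (2 * μ))
    {u v : (ZMod p)[X]} (huv : IsCoprime u v) (hdeg : u.natDegree < v.natDegree)
    (hvp : v.natDegree < p) {α : F} (hα : aeval α v = 0) :
    ‖charSum ψ F u v‖ ≤ p * (v.natDegree + p * (2 * v.natDegree + 1)) * (p : ℝ) ^ μ := by
  classical
  set D := v.natDegree with hD
  have hp0 : 0 < p := (Fact.out : p.Prime).pos
  let T : ZMod p → Finset F := fun c => Finset.univ.filter fun x =>
    aeval x v ≠ 0 ∧ Algebra.trace (ZMod p) F (aeval x u / aeval x v) = c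
  have hNle : ∀ c, (T c).card ≤ p ^ μ * (p ^ (μ - 1) + 2 * D + 1) := by
    intro c
    have := card_trace_eq_le (p := p) (F := F) (u := u.map (algebraMap (ZMod p) F))
      (v := v.map (algebraMap (ZMod p) F)) (α := α) hμ hcard ((isCoprime_map _).2 huv)
      (by simpa using hdeg) (by simpa using hvp) (by rwa [eval_map_algebraMap]) c (T c) (by
        intro x hx
        simpa [T, eval_map_algebraMap] using hx)
    simpa using this
  have hsum : ∑ c, (T c).card + D ≥ p ^ (2 * μ) := by
    have h1 : ∑ c, (T c).card = (Finset.univ.filter fun x : F => aeval x v ≠ 0).card := by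
      rw [Finset.card_eq_sum_card_fiberwise (t := Finset.univ)
        (f := fun x => Algebra.trace (ZMod p) F (aeval x u / aeval x v))
        (fun _ _ => Finset.mem_coe.2 (Finset.mem_univ _))]
      refine Finset.sum_congr rfl fun c _ => ?_
      rw [Finset.filter_filter]
    have hv0 : v.map (algebraMap (ZMod p) F) ≠ 0 := by
      rw [Polynomial.map_ne_zero_iff (algebraMap (ZMod p) F).injective]
      rintro rfl; simp [hD] at hdeg
    have h2 : (Finset.univ.filter fun x : F => ¬ aeval x v ≠ 0).card ≤ D := by
      calc _ ≤ (v.map (algebraMap (ZMod p) F)).roots.toFinset.card :=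
            Finset.card_le_card fun x hx => by
              rw [Multiset.mem_toFinset, mem_roots hv0, IsRoot, eval_map_algebraMap]
              simpa using hx
        _ ≤ _ := Multiset.toFinset_card_le _
        _ ≤ _ := card_roots' _
        _ = D := natDegree_map _
    rw [h1, ← hcard, ← Finset.card_univ, ← Finset.card_filter_add_card_filter_not
      (s := Finset.univ) (fun x : F => aeval x v ≠ 0)]
    omega
  have hS : charSum ψ F u v = ∑ c, (((T c).card : ℂ) - (p : ℂ) ^ (2 * μ - 1)) * ψ c := by
    have h1 : charSum ψ F u v = ∑ c, ((T c).card : ℂ) * ψ c := by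
      rw [charSum, ← Finset.sum_fiberwise Finset.univ
        (fun x : F => Algebra.trace (ZMod p) F (aeval x u / aeval x v))]
      refine Finset.sum_congr rfl fun c _ => ?_
      rw [← nsmul_eq_mul, ← Finset.sum_const]
      simp only [T]
      rw [Finset.sum_filter, Finset.sum_filter]
      refine Finset.sum_congr rfl fun x _ => ?_
      by_cases h1 : aeval x v = 0
      · simp [h1]
      · by_cases h2 : Algebra.trace (ZMod p) F (aeval x u / aeval x v) = c
        · simp [h1, h2]
        · simp [h1, h2]
    rw [h1]
    simp only [sub_mul, Finset.sum_sub_distrib]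
    rw [← Finset.mul_sum, AddChar.sum_eq_zero_of_ne_one hψ, mul_zero, sub_zero]
  have hpow : (p : ℝ) ^ (2 * μ) = p * (p : ℝ) ^ (2 * μ - 1) := by
    rw [← pow_succ']; congr 1; omega
  have hNle' : ∀ c, ((T c).card : ℝ) - (p : ℝ) ^ (2 * μ - 1) ≤ (2 * D + 1) * (p : ℝ) ^ μ := by
    intro c
    have h1 : ((T c).card : ℝ) ≤ (p : ℝ) ^ μ * ((p : ℝ) ^ (μ - 1) + 2 * D + 1) := by
      exact_mod_cast hNle c
    have h2 : (p : ℝ) ^ (2 * μ - 1) = (p : ℝ) ^ μ * (p : ℝ) ^ (μ - 1) := by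
      rw [← pow_add]; congr 1; omega
    rw [h2]; linarith
  set B : ℝ := (2 * D + 1) * (p : ℝ) ^ μ with hB
  have hB0 : 0 ≤ B := by positivity
  have hpR : (1 : ℝ) ≤ p := by exact_mod_cast hp0
  have hNge : ∀ c, -(D + p * B) ≤ ((T c).card : ℝ) - (p : ℝ) ^ (2 * μ - 1) := by
    intro c
    have h1 : ((p : ℝ) ^ (2 * μ)) ≤ ∑ c, ((T c).card : ℝ) + D := by exact_mod_cast hsum
    rw [← Finset.add_sum_erase _ _ (Finset.mem_univ c)] at h1
    have h2 : ∑ c ∈ Finset.univ.erase c, ((T c).card : ℝ) ≤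
        (p - 1) * ((p : ℝ) ^ (2 * μ - 1) + B) := by
      refine (Finset.sum_le_card_nsmul _ _ ((p : ℝ) ^ (2 * μ - 1) + B) fun c _ => by
        linarith [hNle' c]).trans ?_
      rw [Finset.card_erase_of_mem (Finset.mem_univ c), Finset.card_univ, ZMod.card, nsmul_eq_mul,
        Nat.cast_sub hp0, Nat.cast_one]
    rw [hpow] at h1
    nlinarith
  have hbd : ∀ c, ‖(((T c).card : ℂ) - (p : ℂ) ^ (2 * μ - 1)) * ψ c‖ ≤ D + p * B := by
    intro c
    rw [norm_mul, AddChar.norm_apply, mul_one]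
    have : (((T c).card : ℂ) - (p : ℂ) ^ (2 * μ - 1)) =
        ((((T c).card : ℝ) - (p : ℝ) ^ (2 * μ - 1) : ℝ) : ℂ) := by push_cast; rfl
    rw [this, Complex.norm_real, Real.norm_eq_abs, abs_le]
    refine ⟨hNge c, (hNle' c).trans ?_⟩
    have : (0 : ℝ) ≤ D := by positivity
    nlinarith
  rw [hS]
  refine (norm_sum_le_of_le _ fun c _ => hbd c).trans ?_
  rw [Finset.sum_const, Finset.card_univ, ZMod.card, nsmul_eq_mul, hB]
  have h1 : (1 : ℝ) ≤ (p : ℝ) ^ μ := one_le_pow₀ hpR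
  have h2 : (D : ℝ) ≤ D * (p : ℝ) ^ μ := le_mul_of_one_le_right (by positivity) h1
  calc (p : ℝ) * (D + p * ((2 * D + 1) * (p : ℝ) ^ μ))
      ≤ p * (D * (p : ℝ) ^ μ + p * ((2 * D + 1) * (p : ℝ) ^ μ)) := by gcongr
    _ = _ := by ring

end

section

section LogDer
variable {F : Type*} [Field F]

/-- The coefficient of `X ^ (deg v - 1)` in the remainder of `h` modulo `v`. -/
def topCoeff (v h : F[X]) : F := (h %ₘ v).coeff (v.natDegree - 1)

theorem topCoeff_add (v h₁ h₂ : F[X]) : topCoeff v (h₁ + h₂) = topCoeff v h₁ + topCoeff v h₂ := by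
  rw [topCoeff, add_modByMonic, coeff_add]; rfl

theorem topCoeff_C_mul (v h : F[X]) (c : F) : topCoeff v (C c * h) = c * topCoeff v h := by
  rw [topCoeff, ← smul_eq_C_mul, smul_modByMonic, coeff_smul]; rfl

theorem topCoeff_congr {v h₁ h₂ : F[X]} (hv : v.Monic) (h : v ∣ h₁ - h₂) :
    topCoeff v h₁ = topCoeff v h₂ := by
  have h1 : topCoeff v (h₁ - h₂) = 0 := by
    rw [topCoeff, (modByMonic_eq_zero_iff_dvd hv).2 h, coeff_zero]
  have h2 := topCoeff_add v (h₁ - h₂) h₂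
  rw [sub_add_cancel, h1, zero_add] at h2
  exact h2

theorem topCoeff_map {E : Type*} [Field E] (f : F →+* E) {v : F[X]} (hv : v.Monic) (h : F[X]) :
    topCoeff (v.map f) (h.map f) = f (topCoeff v h) := by
  rw [topCoeff, ← map_modByMonic f hv, coeff_map, natDegree_map]; rfl

theorem topCoeff_of_natDegree_lt {v h : F[X]} (hv : v.Monic) (h1 : h.degree < v.degree) :
    topCoeff v h = h.coeff (v.natDegree - 1) := by
  rw [topCoeff, (modByMonic_eq_self_iff hv).2 h1]

/-- An inverse of `g` modulo `v`. -/
def modInv (v g : F[X]) : F[X] :=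
  open Classical in if h : IsCoprime g v then h.choose else 0

theorem modInv_spec {v g : F[X]} (h : IsCoprime g v) : v ∣ modInv v g * g - 1 := by
  rw [modInv, dif_pos h]
  obtain ⟨b, hb⟩ := h.choose_spec
  exact ⟨-b, by linear_combination hb⟩

/-- The functional `topCoeff v` applied to `u g' / g`. -/
def logDer (v u g : F[X]) : F := topCoeff v (u * derivative g * modInv v g)

theorem logDer_eq {v u g b : F[X]} (hv : v.Monic) (hg : IsCoprime g v) (hb : v ∣ b * g - 1) :
    logDer v u g = topCoeff v (u * derivative g * b) := by
  refine topCoeff_congr hv ?_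
  obtain ⟨c, hc⟩ := modInv_spec hg
  obtain ⟨d, hd⟩ := hb
  refine ⟨u * derivative g * (b * c - modInv v g * d), ?_⟩
  linear_combination u * derivative g * (b * hc - modInv v g * hd)

theorem logDer_mul {v u g h : F[X]} (hv : v.Monic) (hg : IsCoprime g v) (hh : IsCoprime h v) :
    logDer v u (g * h) = logDer v u g + logDer v u h := by
  obtain ⟨c, hc⟩ := modInv_spec hg
  obtain ⟨d, hd⟩ := modInv_spec hh
  rw [logDer_eq hv (hg.mul_left hh) (b := modInv v g * modInv v h)
    ⟨c * (modInv v h * h) + d, by linear_combination (modInv v h * h) * hc + hd⟩, logDer, logDer,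
    ← topCoeff_add, derivative_mul]
  refine topCoeff_congr hv ⟨u * derivative g * modInv v g * d + u * derivative h * modInv v h * c,
    ?_⟩
  linear_combination u * derivative g * modInv v g * hd + u * derivative h * modInv v h * hc

theorem logDer_prod {ι : Type*} {v u : F[X]} (hv : v.Monic) (s : Finset ι) (g : ι → F[X])
    (hg : ∀ i ∈ s, IsCoprime (g i) v) :
    logDer v u (∏ i ∈ s, g i) = ∑ i ∈ s, logDer v u (g i) := by
  classical
  induction s using Finset.induction_on with
  | empty => simp [logDer, topCoeff]
  | insert a s ha ih =>
    rw [Finset.prod_insert ha, Finset.sum_insert ha, logDer_mul hv (hg a (by simp))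
      (IsCoprime.prod_left fun i hi => hg i (by simp [hi])), ih fun i hi => hg i (by simp [hi])]

theorem logDer_map {E : Type*} [Field E] (f : F →+* E) {v u g : F[X]} (hv : v.Monic)
    (hg : IsCoprime g v) : logDer (v.map f) (u.map f) (g.map f) = f (logDer v u g) := by
  obtain ⟨c, hc⟩ := modInv_spec hg
  rw [logDer_eq (hv.map f) ((isCoprime_map f).2 hg) (b := (modInv v g).map f)
    ⟨c.map f, by rw [← Polynomial.map_mul, ← Polynomial.map_mul, ← hc]; simp⟩, logDer,
    ← topCoeff_map f hv]
  simp [derivative_map]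

theorem isCoprime_X_sub_C {v : F[X]} {θ : F} (h : v.eval θ ≠ 0) : IsCoprime (X - C θ) v := by
  refine ((irreducible_X_sub_C θ).coprime_iff_not_dvd).2 ?_
  rwa [dvd_iff_isRoot]

theorem logDer_X_sub_C {v u : F[X]} {θ : F} (hv : v.Monic) (hu : u.natDegree < v.natDegree)
    (h : v.eval θ ≠ 0) : logDer v u (X - C θ) = -(u.eval θ / v.eval θ) := by
  set w := v /ₘ (X - C θ) with hw
  set s := u /ₘ (X - C θ) with hs
  have hvw : C (v.eval θ) + (X - C θ) * w = v := by
    have := modByMonic_add_div v (X - C θ)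
    rwa [modByMonic_X_sub_C_eq_C_eval] at this
  have hus : C (u.eval θ) + (X - C θ) * s = u := by
    have := modByMonic_add_div u (X - C θ)
    rwa [modByMonic_X_sub_C_eq_C_eval] at this
  have hinv : C (v.eval θ)⁻¹ * C (v.eval θ) = 1 := by
    rw [← C_mul, inv_mul_cancel₀ h, C_1]
  rw [logDer_eq hv (isCoprime_X_sub_C h) (b := C (-(v.eval θ)⁻¹) * w) ⟨-C (v.eval θ)⁻¹, by
    rw [C_neg]
    linear_combination (-C (v.eval θ)⁻¹) * hvw + hinv⟩]
  have h1 : topCoeff v (u * derivative (X - C θ) * (C (-(v.eval θ)⁻¹) * w)) =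
      -(v.eval θ)⁻¹ * topCoeff v (u * w) := by
    rw [← topCoeff_C_mul]; congr 1; simp; ring
  have h2 : topCoeff v (u * w) = topCoeff v (C (u.eval θ) * w - C (v.eval θ) * s) :=
    topCoeff_congr hv ⟨s, by linear_combination (-w) * hus + s * hvw⟩
  have hwd : w.natDegree = v.natDegree - 1 := by
    rw [hw, natDegree_divByMonic v (monic_X_sub_C θ), natDegree_X_sub_C]
  have hwc : w.coeff (v.natDegree - 1) = 1 := by
    rw [← hwd]
    refine (leadingCoeff_divByMonic_of_monic (monic_X_sub_C θ) ?_).trans hv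
    rw [degree_X_sub_C]
    rw [degree_eq_natDegree hv.ne_zero]
    exact_mod_cast (by omega : 1 ≤ v.natDegree)
  have hsc : s.coeff (v.natDegree - 1) = 0 := by
    rcases Nat.eq_zero_or_pos u.natDegree with h0 | h0
    · have : s = 0 := by
        rw [hs, divByMonic_eq_zero_iff (monic_X_sub_C θ), degree_X_sub_C]
        exact lt_of_le_of_lt degree_le_natDegree (by rw [h0]; norm_num)
      rw [this, coeff_zero]
    · refine coeff_eq_zero_of_natDegree_lt ?_
      rw [hs, natDegree_divByMonic u (monic_X_sub_C θ), natDegree_X_sub_C]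
      omega
  have hdeg : (C (u.eval θ) * w - C (v.eval θ) * s).degree < v.degree := by
    refine degree_lt_degree (lt_of_le_of_lt (natDegree_sub_le_of_le (n := v.natDegree - 1)
      ((natDegree_C_mul_le _ _).trans hwd.le) ((natDegree_C_mul_le _ _).trans ?_))
      (by rw [max_self]; omega))
    rw [hs, natDegree_divByMonic u (monic_X_sub_C θ), natDegree_X_sub_C]
    omega
  rw [h1, h2, topCoeff_of_natDegree_lt hv hdeg, coeff_sub, coeff_C_mul, coeff_C_mul, hwc, hsc]
  field_simp
  ring

end LogDer

end

section

/-- The multiplicative character on polynomials attached to `ψ` and `u / v`. -/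
def polyChar {p : ℕ} [Fact p.Prime] (ψ : AddChar (ZMod p) ℂ) (u v g : (ZMod p)[X]) : ℂ :=
  open Classical in if IsCoprime g v then ψ (-logDer v u g) else 0

theorem polyChar_of_not {p : ℕ} [Fact p.Prime] (ψ : AddChar (ZMod p) ℂ) (u : (ZMod p)[X])
    {v g : (ZMod p)[X]} (h : ¬ IsCoprime g v) : polyChar ψ u v g = 0 := if_neg h

theorem polyChar_mul {p : ℕ} [Fact p.Prime] (ψ : AddChar (ZMod p) ℂ) {u v : (ZMod p)[X]}
    (hv : v.Monic) (g h : (ZMod p)[X]) :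
    polyChar ψ u v (g * h) = polyChar ψ u v g * polyChar ψ u v h := by
  by_cases hg : IsCoprime g v
  · by_cases hh : IsCoprime h v
    · rw [polyChar, if_pos (hg.mul_left hh), polyChar, if_pos hg, polyChar, if_pos hh,
        logDer_mul hv hg hh, neg_add, AddChar.map_add_eq_mul]
    · have : ¬ IsCoprime (g * h) v := fun H => hh H.of_mul_left_right
      rw [polyChar_of_not ψ u this, polyChar_of_not ψ u hh, mul_zero]
  · have : ¬ IsCoprime (g * h) v := fun H => hg H.of_mul_left_left
    rw [polyChar_of_not ψ u this, polyChar_of_not ψ u hg, zero_mul]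

theorem finite_monics (K : Type*) [Field K] [Finite K] (n : ℕ) :
    {g : K[X] | g.Monic ∧ g.natDegree = n}.Finite := by
  have : {g : K[X] | g.Monic ∧ g.natDegree = n} ⊆ (degreeLT K (n + 1) : Set K[X]) := by
    rintro g ⟨_, hg⟩
    rw [SetLike.mem_coe, mem_degreeLT]
    refine lt_of_le_of_lt degree_le_natDegree ?_
    rw [hg]; exact_mod_cast Nat.lt_succ_self n
  refine Set.Finite.subset ?_ this
  have : Finite (degreeLT K (n + 1)) := Finite.of_equiv _ (degreeLTEquiv K (n + 1)).symm.toEquiv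
  exact Set.toFinite _

/-- The monic polynomials of degree `n` over a finite field. -/
def monics (K : Type*) [Field K] [Finite K] (n : ℕ) : Finset K[X] := (finite_monics K n).toFinset

theorem mem_monics {K : Type*} [Field K] [Finite K] {n : ℕ} {g : K[X]} :
    g ∈ monics K n ↔ g.Monic ∧ g.natDegree = n := by simp [monics]

theorem monics_zero (K : Type*) [Field K] [Finite K] : monics K 0 = {1} := by
  ext g
  rw [mem_monics, Finset.mem_singleton]
  constructor
  · rintro ⟨h1, h2⟩; exact h1.natDegree_eq_zero.1 h2
  · rintro rfl; exact ⟨monic_one, natDegree_one⟩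

/-- Coefficients of the `L`-function of `polyChar`. -/
def charCoeff {p : ℕ} [Fact p.Prime] (ψ : AddChar (ZMod p) ℂ) (u v : (ZMod p)[X]) (n : ℕ) : ℂ :=
  ∑ g ∈ monics (ZMod p) n, polyChar ψ u v g

theorem polyChar_one {p : ℕ} [Fact p.Prime] (ψ : AddChar (ZMod p) ℂ) (u v : (ZMod p)[X]) :
    polyChar ψ u v 1 = 1 := by
  rw [polyChar, if_pos isCoprime_one_left, logDer]
  simp [topCoeff]

theorem charCoeff_zero {p : ℕ} [Fact p.Prime] (ψ : AddChar (ZMod p) ℂ) (u v : (ZMod p)[X]) :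
    charCoeff ψ u v 0 = 1 := by
  rw [charCoeff, monics_zero, Finset.sum_singleton, polyChar_one]

theorem derivative_ne_zero_of_lt {p : ℕ} [Fact p.Prime] {v : (ZMod p)[X]} (h0 : 0 < v.natDegree)
    (hp : v.natDegree < p) : derivative v ≠ 0 := by
  intro h
  have h1 := congrArg (fun f => f.coeff (v.natDegree - 1)) h
  simp only [coeff_derivative, coeff_zero] at h1
  rw [Nat.sub_add_cancel h0, mul_eq_zero, coeff_natDegree, leadingCoeff_eq_zero] at h1
  rcases h1 with h1 | h1
  · rw [h1] at h0; simp at h0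
  · have h2 : ((v.natDegree : ℕ) : ZMod p) = 0 := by
      rw [← h1, ← Nat.cast_one (R := ZMod p), ← Nat.cast_add, Nat.sub_add_cancel h0]
    rw [ZMod.natCast_eq_zero_iff] at h2
    exact absurd (Nat.le_of_dvd h0 h2) (by omega)

/-- `topCoeff v` is a nondegenerate functional on residues modulo `v`. -/
theorem exists_topCoeff_ne_zero {F : Type*} [Field F] {v h : F[X]} (hv : v.Monic)
    (hh : ¬ v ∣ h) : ∃ j < v.natDegree, topCoeff v (h * X ^ j) ≠ 0 := by
  have hr : h %ₘ v ≠ 0 := fun H => hh ((modByMonic_eq_zero_iff_dvd hv).1 H)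
  have hv1 : v ≠ 1 := by rintro rfl; exact hh (one_dvd _)
  have hd := natDegree_modByMonic_lt h hv hv1
  refine ⟨v.natDegree - 1 - (h %ₘ v).natDegree, by omega, ?_⟩
  have h1 : topCoeff v (h * X ^ (v.natDegree - 1 - (h %ₘ v).natDegree)) =
      topCoeff v (h %ₘ v * X ^ (v.natDegree - 1 - (h %ₘ v).natDegree)) := by
    refine topCoeff_congr hv ⟨h /ₘ v * X ^ (v.natDegree - 1 - (h %ₘ v).natDegree), ?_⟩
    linear_combination (-X ^ (v.natDegree - 1 - (h %ₘ v).natDegree)) * modByMonic_add_div h v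
  rw [h1, topCoeff_of_natDegree_lt hv]
  · conv_lhs => rw [show v.natDegree - 1 = (h %ₘ v).natDegree +
      (v.natDegree - 1 - (h %ₘ v).natDegree) by omega]
    rw [add_tsub_cancel_left, coeff_mul_X_pow, coeff_natDegree]
    exact leadingCoeff_ne_zero.2 hr
  · refine degree_lt_degree ?_
    rw [natDegree_mul_X_pow _ hr]
    omega

theorem polyChar_add_mul {p : ℕ} [Fact p.Prime] (ψ : AddChar (ZMod p) ℂ) {u v : (ZMod p)[X]}
    (hv : v.Monic) (g m : (ZMod p)[X]) :
    polyChar ψ u v (g + v * m) =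
      polyChar ψ u v g * ψ (-topCoeff v (u * derivative v * modInv v g * m)) := by
  by_cases hg : IsCoprime g v
  · have hg' : IsCoprime (g + v * m) v := hg.add_mul_left_left m
    rw [polyChar, if_pos hg', polyChar, if_pos hg, ← AddChar.map_add_eq_mul, ← neg_add]
    obtain ⟨c, hc⟩ := modInv_spec hg
    rw [logDer_eq hv hg' (b := modInv v g)
      ⟨c + modInv v g * m, by linear_combination hc⟩, logDer, ← topCoeff_add]
    congr 2
    refine topCoeff_congr hv ⟨u * modInv v g * derivative m, ?_⟩
    rw [derivative_add, derivative_mul]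
    ring
  · have hg' : ¬ IsCoprime (g + v * m) v := fun H => hg (by
      simpa using H.add_mul_left_left (-m))
    rw [polyChar, if_neg hg', polyChar, if_neg hg, zero_mul]

theorem sum_shift_eq_zero {p : ℕ} [Fact p.Prime] {ψ : AddChar (ZMod p) ℂ} (hψ : ψ ≠ 1)
    {v h : (ZMod p)[X]} (hv : v.Monic) (hh : ¬ v ∣ h) :
    ∑ c : Fin v.natDegree → ZMod p,
      ψ (-topCoeff v (h * ∑ i : Fin v.natDegree, C (c i) * X ^ (i : ℕ))) = 0 := by
  classical
  let φ : AddChar (Fin v.natDegree → ZMod p) ℂ :=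
    { toFun := fun c => ψ (-topCoeff v (h * ∑ i : Fin v.natDegree, C (c i) * X ^ (i : ℕ)))
      map_zero_eq_one' := by simp [topCoeff]
      map_add_eq_mul' := by
        intro a b
        rw [← AddChar.map_add_eq_mul, ← neg_add, ← topCoeff_add]
        simp [add_mul, Finset.sum_add_distrib, mul_add] }
  refine AddChar.sum_eq_zero_of_ne_one (ψ := φ) fun hφ => ?_
  obtain ⟨j, hj, hne⟩ := exists_topCoeff_ne_zero hv hh
  obtain ⟨a, ha⟩ := DFunLike.ne_iff.1 hψ
  apply ha
  have := DFunLike.congr_fun hφ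
    (Pi.single ⟨j, hj⟩ (-(topCoeff v (h * X ^ j))⁻¹ * a))
  rw [AddChar.one_apply] at this
  rw [AddChar.one_apply, ← this]
  change _ = ψ _
  congr 1
  rw [Finset.sum_eq_single ⟨j, hj⟩ (fun i _ hi => by rw [Pi.single_eq_of_ne hi]; simp) (by simp),
    Pi.single_eq_same, ← mul_assoc, mul_comm h, mul_assoc, topCoeff_C_mul]
  field_simp

theorem charCoeff_eq_zero {p : ℕ} [Fact p.Prime] {ψ : AddChar (ZMod p) ℂ} (hψ : ψ ≠ 1)
    {u v : (ZMod p)[X]} (hv : v.Monic) (huv : IsCoprime u v) (h0 : 0 < v.natDegree)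
    (hp : v.natDegree < p) {n : ℕ} (hn : 2 * v.natDegree ≤ n) : charCoeff ψ u v n = 0 := by
  classical
  let M : (Fin v.natDegree → ZMod p) → (ZMod p)[X] := fun c =>
    ∑ i : Fin v.natDegree, C (c i) * X ^ (i : ℕ)
  have hM : ∀ c, (M c).degree < v.natDegree := by
    intro c
    refine (degree_sum_le _ _).trans_lt ?_
    rw [Finset.sup_lt_iff (by exact_mod_cast WithBot.bot_lt_coe _)]
    intro i _
    refine (degree_C_mul_X_pow_le _ _).trans_lt ?_
    exact_mod_cast i.2
  have hshift : ∀ c, ∀ g ∈ monics (ZMod p) n, g + v * M c ∈ monics (ZMod p) n := by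
    intro c g hg
    obtain ⟨h1, h2⟩ := mem_monics.1 hg
    have hlt : (v * M c).degree < g.degree := by
      rw [degree_eq_natDegree h1.ne_zero, h2, degree_mul, degree_eq_natDegree hv.ne_zero]
      refine (WithBot.add_lt_add_left (WithBot.coe_ne_bot) (hM c)).trans_le ?_
      change ((v.natDegree + v.natDegree : ℕ) : WithBot ℕ) ≤ (n : WithBot ℕ)
      exact_mod_cast (by omega : v.natDegree + v.natDegree ≤ n)
    rw [mem_monics]
    exact ⟨h1.add_of_left hlt, by rw [natDegree_add_eq_left_of_degree_lt hlt, h2]⟩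
  have hshift' : ∀ c, ∀ g ∈ monics (ZMod p) n, g - v * M c ∈ monics (ZMod p) n := by
    intro c g hg
    have h1 : M (-c) = - M c := by simp [M]
    have := hshift (-c) g hg
    rwa [h1, mul_neg, ← sub_eq_add_neg] at this
  have hinv : ∀ c, charCoeff ψ u v n =
      ∑ g ∈ monics (ZMod p) n, polyChar ψ u v (g + v * M c) := by
    intro c
    exact (Finset.sum_bij' (fun g _ => g + v * M c) (fun g _ => g - v * M c) (hshift c)
      (hshift' c) (by simp) (by simp) (by simp)).symm
  have hcard : (Fintype.card (Fin v.natDegree → ZMod p) : ℂ) * charCoeff ψ u v n = 0 := by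
    rw [← nsmul_eq_mul, ← Finset.card_univ, ← Finset.sum_const, Finset.sum_congr rfl
      fun c _ => hinv c, Finset.sum_comm]
    refine Finset.sum_eq_zero fun g _ => ?_
    simp only [polyChar_add_mul ψ hv, ← Finset.mul_sum]
    by_cases hg : IsCoprime g v
    · rw [sum_shift_eq_zero hψ hv, mul_zero]
      intro hdvd
      obtain ⟨c, hc⟩ := modInv_spec hg
      have hi : IsCoprime v (modInv v g) := ⟨-c, g, by linear_combination hc⟩
      have h2 := huv.symm.dvd_of_dvd_mul_left (hi.dvd_of_dvd_mul_right hdvd)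
      have h3 := natDegree_le_of_dvd h2 (derivative_ne_zero_of_lt h0 hp)
      have := natDegree_derivative_lt (p := v) (by omega)
      omega
    · rw [polyChar, if_neg hg, zero_mul]
  exact (mul_eq_zero.1 hcard).resolve_left (by exact_mod_cast Fintype.card_ne_zero)

end

section

theorem exists_eq_pow_of_irreducible_factors {K : Type*} [Field K] {P : K[X]} (hP : P.Monic)
    (hP0 : 0 < P.natDegree) (n : ℕ) (h : K[X]) (hn : h.natDegree = n) (hh : h.Monic)
    (hf : ∀ q, Irreducible q → q ∣ h → P ∣ q) : ∃ j, h = P ^ j := by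
  induction n using Nat.strong_induction_on generalizing h with
  | _ n ih =>
    rcases Nat.eq_zero_or_pos n with h0 | h0
    · exact ⟨0, by rw [pow_zero, ← hh.natDegree_eq_zero, hn, h0]⟩
    · have hu : ¬ IsUnit h := fun hu => by
        have := natDegree_eq_zero_of_isUnit hu; omega
      obtain ⟨q, hq, hqh⟩ := WfDvdMonoid.exists_irreducible_factor hu hh.ne_zero
      obtain ⟨g, hg⟩ := (hf q hq hqh).trans hqh
      have hgm : g.Monic := hP.of_mul_monic_left (by rwa [← hg])
      have hdeg : h.natDegree = P.natDegree + g.natDegree := by rw [hg, hP.natDegree_mul hgm]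
      obtain ⟨j, hj⟩ := ih g.natDegree (by omega) g rfl hgm
        (fun q hq hqg => hf q hq (hg ▸ hqg.mul_left P))
      exact ⟨j + 1, by rw [hg, hj, pow_succ']⟩

section Orbit
variable {p : ℕ} [Fact p.Prime] {F : Type*} [Field F] [Fintype F] [Algebra (ZMod p) F]

/-- The product of `X - σ x` over the Galois group, as a polynomial over the prime field. -/
def orbitPoly (p : ℕ) [Fact p.Prime] {F : Type*} [Field F] [Fintype F] [Algebra (ZMod p) F]
    (x : F) : (ZMod p)[X] :=
  minpoly (ZMod p) x ^ (Module.finrank (ZMod p) F / (minpoly (ZMod p) x).natDegree)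

theorem minpoly_natDegree_pos (x : F) : 0 < (minpoly (ZMod p) x).natDegree :=
  minpoly.natDegree_pos (Algebra.IsIntegral.isIntegral x)

theorem minpoly_natDegree_dvd (x : F) :
    (minpoly (ZMod p) x).natDegree ∣ Module.finrank (ZMod p) F :=
  minpoly.degree_dvd (Algebra.IsIntegral.isIntegral x)

theorem orbitPoly_monic (x : F) : (orbitPoly p x).Monic :=
  (minpoly.monic (Algebra.IsIntegral.isIntegral x)).pow _

theorem orbitPoly_natDegree (x : F) : (orbitPoly p x).natDegree = Module.finrank (ZMod p) F := by
  rw [orbitPoly, (minpoly.monic (Algebra.IsIntegral.isIntegral x)).natDegree_pow,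
    Nat.div_mul_cancel (minpoly_natDegree_dvd x)]

theorem orbitPoly_map (x : F) : (orbitPoly p x).map (algebraMap (ZMod p) F) =
    ∏ σ : Gal(F/ZMod p), (X - C (σ x)) := by
  obtain ⟨h, hh⟩ := Algebra.IsInvariant.charpoly_mem_lifts (ZMod p) F Gal(F/ZMod p) x
  change h.map (algebraMap (ZMod p) F) = ∏ σ : Gal(F/ZMod p), (X - C (σ • x)) at hh
  simp only [AlgEquiv.smul_def] at hh
  have hinj := (algebraMap (ZMod p) F).injective
  have hm : h.Monic := by
    refine monic_of_injective hinj ?_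
    rw [hh]; exact monic_prod_of_monic _ _ fun σ _ => monic_X_sub_C _
  have hd : h.natDegree = Module.finrank (ZMod p) F := by
    rw [← natDegree_map_eq_of_injective hinj, hh, natDegree_prod_of_monic _ _
      fun σ _ => monic_X_sub_C _]
    simp only [natDegree_X_sub_C, Finset.sum_const, smul_eq_mul, mul_one, Finset.card_univ]
    rw [← Nat.card_eq_fintype_card, IsGalois.card_aut_eq_finrank]
  have hPm := minpoly.monic (A := ZMod p) (Algebra.IsIntegral.isIntegral x)
  obtain ⟨j, hj⟩ := exists_eq_pow_of_irreducible_factors hPm (minpoly_natDegree_pos x) _ h rfl hm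
    (by
      intro q hq hqh
      have h1 : q.map (algebraMap (ZMod p) F) ∣ ∏ σ : Gal(F/ZMod p), (X - C (σ x)) := by
        rw [← hh]; exact Polynomial.map_dvd (algebraMap (ZMod p) F) hqh
      obtain ⟨σ, hσ⟩ : ∃ σ : Gal(F/ZMod p), aeval (σ x) q = 0 := by
        by_contra hcon
        push Not at hcon
        have h2 : IsCoprime (q.map (algebraMap (ZMod p) F)) (∏ σ : Gal(F/ZMod p), (X - C (σ x))) :=
          IsCoprime.prod_right fun σ _ => (isCoprime_X_sub_C (by
            rw [eval_map_algebraMap]; exact hcon σ)).symm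
        have h3 := h2.isUnit_of_dvd' dvd_rfl h1
        have h4 := natDegree_eq_zero_of_isUnit h3
        rw [natDegree_map] at h4
        have := hq.natDegree_pos
        omega
      refine minpoly.dvd _ _ ?_
      have h5 : σ (aeval x q) = 0 := by rw [← hσ, aeval_algHom_apply σ x q]
      simpa using h5)
  rw [← hh, orbitPoly]
  congr 1
  rw [hj]
  congr 1
  rw [← hd, hj, hPm.natDegree_pow, Nat.mul_div_cancel _ (minpoly_natDegree_pos x)]

theorem polyChar_orbitPoly (ψ : AddChar (ZMod p) ℂ) {u v : (ZMod p)[X]} (hv : v.Monic)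
    (huv : u.natDegree < v.natDegree) (x : F) :
    polyChar ψ u v (orbitPoly p x) =
      open Classical in if aeval x v = 0 then 0 else
        ψ (Algebra.trace (ZMod p) F (aeval x u / aeval x v)) := by
  classical
  have hirr := minpoly.irreducible (A := ZMod p) (Algebra.IsIntegral.isIntegral x)
  have hpos : 0 < Module.finrank (ZMod p) F / (minpoly (ZMod p) x).natDegree :=
    Nat.div_pos (Nat.le_of_dvd Module.finrank_pos (minpoly_natDegree_dvd x))
      (minpoly_natDegree_pos x)
  by_cases hx : aeval x v = 0
  · rw [if_pos hx, polyChar_of_not]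
    rw [orbitPoly, IsCoprime.pow_left_iff hpos, hirr.coprime_iff_not_dvd, not_not]
    exact minpoly.dvd _ _ hx
  · have hcop : IsCoprime (orbitPoly p x) v := by
      rw [orbitPoly, IsCoprime.pow_left_iff hpos, hirr.coprime_iff_not_dvd]
      rintro ⟨c, hc⟩
      exact hx (by rw [hc]; simp)
    rw [if_neg hx, polyChar, if_pos hcop]
    congr 1
    apply (algebraMap (ZMod p) F).injective
    have hne : ∀ σ : Gal(F/ZMod p), (v.map (algebraMap (ZMod p) F)).eval (σ x) = σ (aeval x v) := by
      intro σ; rw [eval_map_algebraMap, aeval_algHom_apply σ x v]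
    have hne' : ∀ σ : Gal(F/ZMod p), (u.map (algebraMap (ZMod p) F)).eval (σ x) = σ (aeval x u) := by
      intro σ; rw [eval_map_algebraMap, aeval_algHom_apply σ x u]
    have hne0 : ∀ σ : Gal(F/ZMod p), (v.map (algebraMap (ZMod p) F)).eval (σ x) ≠ 0 := by
      intro σ; rw [hne]; simpa using hx
    rw [map_neg, ← logDer_map _ hv hcop, orbitPoly_map, logDer_prod (hv.map _) _ _
      (fun σ _ => isCoprime_X_sub_C (hne0 σ)), trace_eq_sum_automorphisms, ← Finset.sum_neg_distrib]
    refine Finset.sum_congr rfl fun σ _ => ?_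
    rw [logDer_X_sub_C (hv.map _) (by simpa using huv) (hne0 σ), neg_neg, hne, hne', map_div₀]

end Orbit

instance galoisFieldFintype (p k : ℕ) [Fact p.Prime] : Fintype (GaloisField p k) :=
  Fintype.ofFinite _

theorem card_roots_galoisField {p : ℕ} [Fact p.Prime] {q : (ZMod p)[X]} (hq : Irreducible q)
    {k : ℕ} (hk : k ≠ 0) (hdvd : q.natDegree ∣ k) :
    (open Classical in Finset.univ.filter fun x : GaloisField p k => aeval x q = 0).card =
      q.natDegree := by
  classical
  have hcard : Fintype.card (GaloisField p k) = p ^ k := by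
    rw [← Nat.card_eq_fintype_card, GaloisField.card p k hk]
  have h1 : q ∣ X ^ p ^ k - X := by
    have := hq.natDegree_dvd_iff_dvd_X_pow_card_pow_sub_X.1 hdvd
    rwa [Nat.card_zmod] at this
  have h2 : q.map (algebraMap (ZMod p) (GaloisField p k)) ∣ X ^ p ^ k - X := by
    have := map_dvd (mapRingHom (algebraMap (ZMod p) (GaloisField p k))) h1
    simpa using this
  have h0 : (X ^ p ^ k - X : (GaloisField p k)[X]) ≠ 0 :=
    FiniteField.X_pow_card_pow_sub_X_ne_zero _ hk (Fact.out : p.Prime).one_lt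
  have hroots := FiniteField.roots_X_pow_card_sub_X (GaloisField p k)
  rw [hcard] at hroots
  have hsplit : (X ^ p ^ k - X : (GaloisField p k)[X]).Splits := by
    rw [splits_iff_card_roots, hroots, Finset.card_val, Finset.card_univ, hcard,
      FiniteField.X_pow_card_pow_sub_X_natDegree_eq _ hk (Fact.out : p.Prime).one_lt]
  have h3 := Splits.of_dvd hsplit h0 h2
  have hnd : (q.map (algebraMap (ZMod p) (GaloisField p k))).roots.Nodup :=
    Multiset.nodup_of_le (roots.le_of_dvd h0 h2) (by rw [hroots]; exact Finset.nodup _)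
  rw [← natDegree_map (algebraMap (ZMod p) (GaloisField p k)), h3.natDegree_eq_card_roots,
    ← Multiset.toFinset_card_of_nodup hnd]
  congr 1
  ext x
  have hq0 : q.map (algebraMap (ZMod p) (GaloisField p k)) ≠ 0 :=
    ne_zero_of_dvd_ne_zero h0 h2
  rw [Multiset.mem_toFinset, mem_roots hq0, IsRoot, eval_map_algebraMap]
  simp

theorem orbitPoly_dvd_pow_iff {p : ℕ} [Fact p.Prime] {q : (ZMod p)[X]} (hq : Irreducible q)
    {k m : ℕ} (hk : k ≠ 0) (x : GaloisField p k) :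
    orbitPoly p x ∣ q ^ m ↔ aeval x q = 0 ∧ q.natDegree ∣ k ∧ k / q.natDegree ≤ m := by
  have hint : IsIntegral (ZMod p) x := Algebra.IsIntegral.isIntegral x
  have hirr := minpoly.irreducible hint
  have hdk : (minpoly (ZMod p) x).natDegree ∣ k := by
    have := minpoly_natDegree_dvd (p := p) x
    rwa [GaloisField.finrank p hk] at this
  have hpos : 0 < k / (minpoly (ZMod p) x).natDegree :=
    Nat.div_pos (Nat.le_of_dvd (by omega) hdk) (minpoly_natDegree_pos x)
  have key : aeval x q = 0 → (orbitPoly p x ∣ q ^ m ↔ q.natDegree ∣ k ∧ k / q.natDegree ≤ m) := by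
    intro hx
    have hass : Associated (minpoly (ZMod p) x) q :=
      hirr.associated_of_dvd hq (minpoly.dvd _ _ hx)
    have hdeg : q.natDegree = (minpoly (ZMod p) x).natDegree :=
      (natDegree_eq_of_degree_eq (degree_eq_degree_of_associated hass)).symm
    rw [hdeg, orbitPoly, GaloisField.finrank p hk, ← (hass.pow_pow (n := m)).dvd_iff_dvd_right,
      pow_dvd_pow_iff hirr.ne_zero hirr.not_isUnit]
    simp [hdk]
  constructor
  · intro h
    have h1 : minpoly (ZMod p) x ∣ q ^ m := by
      refine (dvd_pow_self _ ?_).trans h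
      rw [GaloisField.finrank p hk]; omega
    have h2 := hirr.prime.dvd_of_dvd_pow h1
    obtain ⟨c, hc⟩ := h2
    have hx : aeval x q = 0 := by rw [hc]; simp
    exact ⟨hx, (key hx).1 h⟩
  · rintro ⟨hx, h⟩
    exact (key hx).2 h

theorem orbitPoly_dvd_mul_iff {p : ℕ} [Fact p.Prime] {k : ℕ} (hk : k ≠ 0) (x : GaloisField p k)
    {g h : (ZMod p)[X]} (hgh : IsCoprime g h) :
    (orbitPoly p x ∣ g * h ↔ orbitPoly p x ∣ g ∨ orbitPoly p x ∣ h) ∧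
      ¬ (orbitPoly p x ∣ g ∧ orbitPoly p x ∣ h) := by
  have hint : IsIntegral (ZMod p) x := Algebra.IsIntegral.isIntegral x
  have hirr := minpoly.irreducible hint
  have hdk : (minpoly (ZMod p) x).natDegree ∣ k := by
    have := minpoly_natDegree_dvd (p := p) x
    rwa [GaloisField.finrank p hk] at this
  have hpos : 0 < k / (minpoly (ZMod p) x).natDegree :=
    Nat.div_pos (Nat.le_of_dvd (by omega) hdk) (minpoly_natDegree_pos x)
  have hcop : ∀ f : (ZMod p)[X], ¬ minpoly (ZMod p) x ∣ f → IsCoprime (orbitPoly p x) f := by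
    intro f hf
    exact ((hirr.coprime_iff_not_dvd).2 hf).pow_left
  have hboth : ¬ (minpoly (ZMod p) x ∣ g ∧ minpoly (ZMod p) x ∣ h) := fun H =>
    hirr.not_isUnit (hgh.isUnit_of_dvd' H.1 H.2)
  have hmo : minpoly (ZMod p) x ∣ orbitPoly p x := by
    refine dvd_pow_self _ ?_
    rw [GaloisField.finrank p hk]; omega
  refine ⟨⟨fun H => ?_, fun H => H.elim (fun H => H.mul_right _) fun H => H.mul_left _⟩,
    fun H => hboth ⟨hmo.trans H.1, hmo.trans H.2⟩⟩
  by_cases hg : minpoly (ZMod p) x ∣ g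
  · have hh : ¬ minpoly (ZMod p) x ∣ h := fun hh => hboth ⟨hg, hh⟩
    exact Or.inl ((hcop h hh).dvd_of_dvd_mul_right H)
  · exact Or.inr ((hcop g hg).dvd_of_dvd_mul_left H)

open Classical in
/-- Every polynomial of degree at most `N` is the product of its orbit polynomials, counted by
degree. -/
theorem sum_card_orbitPoly_dvd {p : ℕ} [Fact p.Prime] (N : ℕ) (g : (ZMod p)[X]) (hg : g ≠ 0)
    (hN : g.natDegree ≤ N) :
    ∑ k ∈ Finset.Icc 1 N,
      (Finset.univ.filter fun x : GaloisField p k => orbitPoly p x ∣ g).card = g.natDegree := by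
  induction g using UniqueFactorizationMonoid.induction_on_coprime with
  | h0 => exact absurd rfl hg
  | h1 hx =>
    rw [natDegree_eq_zero_of_isUnit hx]
    refine Finset.sum_eq_zero fun k hk => ?_
    rw [Finset.mem_Icc] at hk
    rw [Finset.card_eq_zero, Finset.filter_eq_empty_iff]
    intro x _ hd
    have h1 := isUnit_of_dvd_unit hd hx
    have h2 := natDegree_eq_zero_of_isUnit h1
    rw [orbitPoly_natDegree, GaloisField.finrank p (by omega)] at h2
    omega
  | @hpr q m hq =>
    have hq := hq.irreducible
    have hd := hq.natDegree_pos
    rw [natDegree_pow] at hN ⊢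
    have h1 : ∀ k ∈ Finset.Icc 1 N,
        (Finset.univ.filter fun x : GaloisField p k => orbitPoly p x ∣ q ^ m).card =
        if q.natDegree ∣ k ∧ k / q.natDegree ≤ m then q.natDegree else 0 := by
      intro k hk
      rw [Finset.mem_Icc] at hk
      have hk0 : k ≠ 0 := by omega
      simp only [orbitPoly_dvd_pow_iff hq hk0]
      split_ifs with h
      · simp only [h, and_true]
        rw [← card_roots_galoisField hq hk0 h.1]
      · simp only [h, and_false, Finset.filter_false, Finset.card_empty]
    rw [Finset.sum_congr rfl h1, ← Finset.sum_filter, Finset.sum_const, smul_eq_mul]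
    congr 1
    have h2 : (Finset.Icc 1 N).filter (fun k => q.natDegree ∣ k ∧ k / q.natDegree ≤ m) =
        (Finset.Icc 1 m).image fun j => q.natDegree * j := by
      ext k
      simp only [Finset.mem_filter, Finset.mem_Icc, Finset.mem_image]
      constructor
      · rintro ⟨⟨h3, h4⟩, ⟨j, rfl⟩, h5⟩
        rw [Nat.mul_div_cancel_left _ hd] at h5
        exact ⟨j, ⟨Nat.pos_of_mul_pos_left h3, h5⟩, rfl⟩
      · rintro ⟨j, ⟨h3, h4⟩, rfl⟩
        refine ⟨⟨Nat.mul_pos hd h3, ?_⟩, dvd_mul_right _ _, by rwa [Nat.mul_div_cancel_left _ hd]⟩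
        refine le_trans ?_ hN
        rw [mul_comm]; exact Nat.mul_le_mul_right _ h4
    rw [h2, Finset.card_image_of_injective _ (fun a b h => Nat.eq_of_mul_eq_mul_left hd h),
      Nat.card_Icc, Nat.add_sub_cancel]
  | @hcp g h hgh ihg ihh =>
    obtain ⟨hg0, hh0⟩ := mul_ne_zero_iff.1 hg
    rw [natDegree_mul hg0 hh0] at hN ⊢
    rw [← ihg hg0 (by omega), ← ihh hh0 (by omega), ← Finset.sum_add_distrib]
    refine Finset.sum_congr rfl fun k hk => ?_
    rw [Finset.mem_Icc] at hk
    have hc := fun x : GaloisField p k =>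
      orbitPoly_dvd_mul_iff (by omega : k ≠ 0) x hgh.isCoprime
    rw [← Finset.card_union_of_disjoint, ← Finset.filter_or]
    · congr 1
      ext x
      simp only [Finset.mem_filter, Finset.mem_univ, true_and]
      exact (hc x).1
    · rw [Finset.disjoint_filter]
      intro x _ h1 h2
      exact (hc x).2 ⟨h1, h2⟩

/-- Newton's identities for the `L`-function of `polyChar`. -/
theorem charCoeff_newton {p : ℕ} [Fact p.Prime] (ψ : AddChar (ZMod p) ℂ) {u v : (ZMod p)[X]}
    (hv : v.Monic) (huv : u.natDegree < v.natDegree) (n : ℕ) :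
    (n : ℂ) * charCoeff ψ u v n =
      ∑ k ∈ Finset.Icc 1 n, charSum ψ (GaloisField p k) u v * charCoeff ψ u v (n - k) := by
  classical
  have h1 : ∀ g ∈ monics (ZMod p) n, (n : ℂ) * polyChar ψ u v g =
      ∑ k ∈ Finset.Icc 1 n, ∑ x : GaloisField p k,
        if orbitPoly p x ∣ g then polyChar ψ u v g else 0 := by
    intro g hg
    obtain ⟨hm, hd⟩ := mem_monics.1 hg
    have := sum_card_orbitPoly_dvd n g hm.ne_zero hd.le
    rw [hd] at this
    conv_lhs => rw [← this]
    rw [Nat.cast_sum, Finset.sum_mul]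
    refine Finset.sum_congr rfl fun k _ => ?_
    rw [← Finset.sum_filter, Finset.sum_const, nsmul_eq_mul]
  rw [charCoeff, Finset.mul_sum, Finset.sum_congr rfl h1, Finset.sum_comm]
  refine Finset.sum_congr rfl fun k hk => ?_
  rw [Finset.mem_Icc] at hk
  rw [Finset.sum_comm, charSum, Finset.sum_mul]
  refine Finset.sum_congr rfl fun x _ => ?_
  rw [← polyChar_orbitPoly ψ hv huv x, charCoeff, Finset.mul_sum, ← Finset.sum_filter]
  have hod : (orbitPoly p x).natDegree = k := by
    rw [orbitPoly_natDegree, GaloisField.finrank p (by omega)]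
  have hom := orbitPoly_monic (p := p) x
  symm
  refine Finset.sum_bij (fun g _ => orbitPoly p x * g) ?_ ?_ ?_ ?_
  · intro g hg
    obtain ⟨h2, h3⟩ := mem_monics.1 hg
    rw [Finset.mem_filter, mem_monics]
    exact ⟨⟨hom.mul h2, by rw [hom.natDegree_mul h2, hod, h3]; omega⟩, dvd_mul_right _ _⟩
  · intro a _ b _ hab
    exact mul_left_cancel₀ hom.ne_zero hab
  · intro g hg
    obtain ⟨h2, c, rfl⟩ := Finset.mem_filter.1 hg
    obtain ⟨h3, h4⟩ := mem_monics.1 h2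
    have h5 := hom.of_mul_monic_left h3
    refine ⟨c, ?_, rfl⟩
    rw [mem_monics]
    rw [hom.natDegree_mul h5, hod] at h4
    exact ⟨h5, by omega⟩
  · intro g _
    rw [polyChar_mul ψ hv]

end

section

theorem exists_eq_prod_one_sub_C_mul_X {A : ℂ[X]} (h : A.coeff 0 = 1) :
    ∃ s : Multiset ℂ, s.card = A.natDegree ∧ A = (s.map fun w => 1 - C w * X).prod := by
  have hA : A ≠ 0 := by rintro rfl; simp at h
  have hsp : A.Splits := IsAlgClosed.splits A
  have hr : ∀ r ∈ A.roots, r ≠ 0 := by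
    rintro r hr rfl
    rw [mem_roots hA, IsRoot, ← coeff_zero_eq_eval_zero, h] at hr
    exact one_ne_zero hr
  refine ⟨A.roots.map (fun r => r⁻¹), ?_, ?_⟩
  · rw [Multiset.card_map]; exact hsp.natDegree_eq_card_roots.symm
  · have h1 : A = C A.leadingCoeff * (A.roots.map fun r => X - C r).prod := hsp.eq_prod_roots
    have h2 : (A.roots.map fun r => X - C r).prod =
        (A.roots.map fun r => C (-r)).prod * (A.roots.map fun r => 1 - C r⁻¹ * X).prod := by
      rw [← Multiset.prod_map_mul]
      congr 1
      refine Multiset.map_congr rfl fun r hr' => ?_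
      have : C r * C r⁻¹ = (1 : ℂ[X]) := by
        rw [← C_mul, mul_inv_cancel₀ (hr r hr'), C_1]
      rw [C_neg]
      linear_combination -X * this
    have h3 : (A.roots.map fun r => C (-r)).prod = C (A.roots.map fun r => -r).prod := by
      rw [← Multiset.prod_hom, Multiset.map_map]; rfl
    rw [Multiset.map_map]
    have h4 : (A.roots.map ((fun w => 1 - C w * X) ∘ fun r => r⁻¹)).prod =
        (A.roots.map fun r => 1 - C r⁻¹ * X).prod := rfl
    rw [h4]
    set B := (A.roots.map fun r => 1 - C r⁻¹ * X).prod with hB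
    rw [h2, h3, ← mul_assoc, ← C_mul] at h1
    have hB0 : B.coeff 0 = 1 := by
      rw [coeff_zero_eq_eval_zero, hB, eval_multiset_prod, Multiset.map_map]
      refine Multiset.prod_eq_one fun x hx => ?_
      obtain ⟨r, -, rfl⟩ := Multiset.mem_map.1 hx
      simp
    have h5 := congrArg (fun q => coeff q 0) h1
    simp only [coeff_C_mul, hB0, h, mul_one] at h5
    rw [← h5, C_1, one_mul] at h1
    exact h1

theorem X_mul_derivative_prod_one_sub (s : Multiset ℂ) :
    (PowerSeries.X : PowerSeries ℂ) *
      (((derivative (s.map fun w => 1 - C w * X).prod : ℂ[X])) : PowerSeries ℂ) =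
      -((((s.map fun w => 1 - C w * X).prod : ℂ[X]) : PowerSeries ℂ) *
        PowerSeries.mk fun k => if k = 0 then 0 else (s.map fun w => w ^ k).sum) := by
  induction s using Multiset.induction_on with
  | empty =>
    simp only [Multiset.map_zero, Multiset.prod_zero, Multiset.sum_zero, derivative_one]
    have : (PowerSeries.mk fun k => if k = 0 then (0:ℂ) else 0) = 0 := by ext; simp
    rw [this]; simp
  | cons w s ih =>
    simp only [Multiset.map_cons, Multiset.prod_cons, Multiset.sum_cons, derivative_mul,
      derivative_sub, derivative_one, derivative_C, derivative_X, zero_mul, zero_add]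
    set P := (s.map fun w => 1 - C w * X).prod
    have h1 : (PowerSeries.mk fun k => if k = 0 then (0:ℂ) else w ^ k + (s.map fun w => w ^ k).sum)
        = (PowerSeries.mk fun k => if k = 0 then (0:ℂ) else w ^ k) +
          PowerSeries.mk fun k => if k = 0 then 0 else (s.map fun w => w ^ k).sum := by
      ext k; by_cases hk : k = 0 <;> simp [hk]
    have h2 : (1 - PowerSeries.C w * PowerSeries.X) *
        (PowerSeries.mk fun k => if k = 0 then (0:ℂ) else w ^ k) = PowerSeries.C w * PowerSeries.X := by
      ext k
      rw [sub_mul, one_mul, map_sub, mul_assoc, PowerSeries.coeff_C_mul, PowerSeries.coeff_mk,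
        PowerSeries.coeff_C_mul]
      rcases k with _ | k
      · simp
      · rw [PowerSeries.coeff_succ_X_mul, PowerSeries.coeff_mk, PowerSeries.coeff_X]
        rcases k with _ | k
        · simp
        · simp [pow_succ]; ring
    rw [h1]
    push_cast [Polynomial.coe_add, Polynomial.coe_mul, Polynomial.coe_sub, Polynomial.coe_C, Polynomial.coe_X, Polynomial.coe_one]
    simp only [zero_sub, mul_one]
    linear_combination (1 - PowerSeries.C w * PowerSeries.X) * ih + (P : PowerSeries ℂ) * h2

/-- Newton's identities determine the power sums. -/
theorem exists_powerSums_of_newton {a S : ℕ → ℂ} {m : ℕ} (h0 : a 0 = 1)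
    (hm : ∀ n, m ≤ n → a n = 0)
    (hN : ∀ n : ℕ, (n : ℂ) * a n = ∑ k ∈ Finset.Icc 1 n, S k * a (n - k)) :
    ∃ s : Multiset ℂ, s.card ≤ m ∧ ∀ k, k ≠ 0 → S k = -(s.map fun w => w ^ k).sum := by
  set A : ℂ[X] := ∑ i ∈ Finset.range m, C (a i) * X ^ i with hA
  have hcoeff : ∀ n, A.coeff n = a n := by
    intro n
    simp only [hA, finsetSum_coeff, coeff_C_mul_X_pow]
    rw [Finset.sum_ite_eq]
    split_ifs with h
    · rfl
    · rw [hm n (by simpa using h)]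
  have hdeg : A.natDegree ≤ m := by
    rw [natDegree_le_iff_coeff_eq_zero]
    intro n hn
    rw [hcoeff, hm n hn.le]
  obtain ⟨s, hs, hAs⟩ := exists_eq_prod_one_sub_C_mul_X (by rw [hcoeff, h0] : A.coeff 0 = 1)
  refine ⟨s, hs.trans_le hdeg, ?_⟩
  have h1 := X_mul_derivative_prod_one_sub s
  rw [← hAs] at h1
  have h2 : (PowerSeries.X : PowerSeries ℂ) * ((derivative A : ℂ[X]) : PowerSeries ℂ) =
      (PowerSeries.mk fun k => if k = 0 then 0 else S k) * (A : PowerSeries ℂ) := by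
    ext n
    rw [PowerSeries.coeff_mul n (PowerSeries.mk _), Finset.Nat.sum_antidiagonal_eq_sum_range_succ
      (fun i j => PowerSeries.coeff i (PowerSeries.mk fun k => if k = 0 then 0 else S k) *
        PowerSeries.coeff j (A : PowerSeries ℂ))]
    simp only [PowerSeries.coeff_mk, Polynomial.coeff_coe, hcoeff]
    rcases n with _ | n
    · simp
    · rw [PowerSeries.coeff_succ_X_mul, Polynomial.coeff_coe, coeff_derivative, hcoeff,
        mul_comm]
      have := hN (n+1)
      push_cast at this
      rw [this, Finset.range_eq_Ico, Finset.sum_eq_sum_Ico_succ_bot (by omega)]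
      simp only [if_true, zero_mul, zero_add]
      refine Finset.sum_congr rfl fun k hk => ?_
      rw [if_neg (by simp at hk; omega)]
  have hA0 : (A : PowerSeries ℂ) ≠ 0 := by
    intro h
    have := congrArg (PowerSeries.coeff 0) h
    rw [Polynomial.coeff_coe, hcoeff, h0] at this
    simp at this
  have h3 : (PowerSeries.mk fun k => if k = 0 then 0 else S k) =
      -PowerSeries.mk fun k => if k = 0 then 0 else (s.map fun w => w ^ k).sum := by
    apply mul_right_cancel₀ hA0
    rw [← h2, h1]; ring
  intro k hk
  have := congrArg (PowerSeries.coeff k) h3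
  simpa [hk] using this

theorem norm_le_one_of_bounded_powerSums {s : Multiset ℂ} {B : ℝ}
    (h : ∀ n : ℕ, n ≠ 0 → ‖(s.map fun w => w ^ n).sum‖ ≤ B) {z : ℂ} (hz : z ∈ s) : ‖z‖ ≤ 1 := by
  classical
  set Q : ℂ[X] := ∏ w ∈ s.toFinset.erase z, (X - C w) with hQ
  have hQz : Q.eval z ≠ 0 := by
    rw [hQ, eval_prod, Finset.prod_ne_zero_iff]
    intro w hw
    simpa [sub_eq_zero] using (Finset.ne_of_mem_erase hw).symm
  have hQw : ∀ w ∈ s, w ≠ z → Q.eval w = 0 := by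
    intro w hw hwz
    rw [hQ, eval_prod]
    exact Finset.prod_eq_zero (Finset.mem_erase.2 ⟨hwz, Multiset.mem_toFinset.2 hw⟩) (by simp)
  have key : ∀ n : ℕ, ∑ k ∈ Finset.range (Q.natDegree + 1),
      Q.coeff k * (s.map fun w => w ^ (n + k)).sum = s.count z * (Q.eval z * z ^ n) := by
    intro n
    have h1 : ∑ k ∈ Finset.range (Q.natDegree + 1),
        Q.coeff k * (s.map fun w => w ^ (n + k)).sum = (s.map fun w => Q.eval w * w ^ n).sum := by
      simp_rw [← Multiset.sum_map_mul_left]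
      have hswap : ∀ t : Multiset ℂ, ∑ k ∈ Finset.range (Q.natDegree + 1),
          (t.map fun w => Q.coeff k * w ^ (n + k)).sum =
          (t.map fun w => ∑ k ∈ Finset.range (Q.natDegree + 1), Q.coeff k * w ^ (n + k)).sum := by
        intro t
        induction t using Multiset.induction_on with
        | empty => simp
        | cons w t ih => simp [Finset.sum_add_distrib, ih]
      rw [hswap]
      congr 1
      refine Multiset.map_congr rfl fun w _ => ?_
      rw [eval_eq_sum_range, Finset.sum_mul]
      refine Finset.sum_congr rfl fun k _ => ?_
      rw [pow_add]; ring
    rw [h1, Finset.sum_multiset_map_count, Finset.sum_eq_single z]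
    · rw [nsmul_eq_mul]
    · intro w hw hwz
      rw [hQw w (Multiset.mem_toFinset.1 hw) hwz]; simp
    · intro h; exact absurd (Multiset.mem_toFinset.2 hz) h
  set c := ‖(s.count z : ℂ) * Q.eval z‖ with hc
  have hcpos : 0 < c := by
    rw [hc, norm_pos_iff]
    refine mul_ne_zero ?_ hQz
    exact_mod_cast (Multiset.count_pos.2 hz).ne'
  set B' := ∑ k ∈ Finset.range (Q.natDegree + 1), ‖Q.coeff k‖ * B with hB'
  have hb : ∀ n : ℕ, n ≠ 0 → c * ‖z‖ ^ n ≤ B' := by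
    intro n hn
    rw [← norm_pow, hc, ← norm_mul, mul_assoc, ← key]
    refine (norm_sum_le _ _).trans (Finset.sum_le_sum fun k _ => ?_)
    rw [norm_mul]
    exact mul_le_mul_of_nonneg_left (h _ (by omega)) (norm_nonneg _)
  by_contra hlt
  push Not at hlt
  obtain ⟨n, hn⟩ := pow_unbounded_of_one_lt (B' / c) hlt
  have h1 : B' / c < ‖z‖ ^ (n + 1) := hn.trans_le (pow_le_pow_right₀ hlt.le (Nat.le_succ n))
  rw [div_lt_iff₀ hcpos] at h1
  have := hb (n+1) (by omega)
  linarith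

/-- Weil's bound for complete sums of a reduced proper fraction. -/
theorem norm_charSum_zmod_le {p : ℕ} [Fact p.Prime] {ψ : AddChar (ZMod p) ℂ} (hψ : ψ ≠ 1)
    {u v : (ZMod p)[X]} (hv : v.Monic) (huv : IsCoprime u v) (hdeg : u.natDegree < v.natDegree)
    (hp : v.natDegree < p) :
    ‖∑ x : ZMod p, if v.eval x = 0 then 0 else ψ (u.eval x / v.eval x)‖ ≤
      2 * v.natDegree * √p := by
  have hp0 : (0:ℝ) < p := by exact_mod_cast (Fact.out : p.Prime).pos
  have hsq : (0:ℝ) < √p := Real.sqrt_pos.2 hp0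
  obtain ⟨s, hs, hS⟩ := exists_powerSums_of_newton (charCoeff_zero ψ u v)
    (fun n hn => charCoeff_eq_zero hψ hv huv (by omega) hp hn)
    (charCoeff_newton ψ hv hdeg)
  -- the eigenvalue bound
  have hroot : ∀ w ∈ s, ‖w‖ ≤ √p := by
    obtain ⟨q, hq, hqv⟩ := exists_irreducible_of_natDegree_pos (f := v) (by omega)
    set R := 2 * q.natDegree with hR
    have hqd : 0 < q.natDegree := hq.natDegree_pos
    set B : ℝ := p * (v.natDegree + p * (2 * v.natDegree + 1)) with hB
    have hbound : ∀ j : ℕ, j ≠ 0 → ‖(s.map fun w => w ^ (R * j)).sum‖ ≤ B * √p ^ (R * j) := by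
      intro j hj
      have hk : R * j ≠ 0 := by positivity
      have h1 := hS (R * j) hk
      have hcard := card_roots_galoisField hq hk ⟨2 * j, by rw [hR]; ring⟩
      obtain ⟨α, hα⟩ := Finset.card_pos.1 (hqd.trans_eq hcard.symm)
      have hα' : aeval α v = 0 := by
        obtain ⟨t, rfl⟩ := hqv
        have hαq : aeval α q = 0 := by simpa using hα
        rw [map_mul, hαq, zero_mul]
      have h2 := norm_charSum_le_of_root (F := GaloisField p (R*j)) (μ := q.natDegree * j) hψ
        (Nat.mul_pos hqd (Nat.pos_of_ne_zero hj)) (by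
          rw [← Nat.card_eq_fintype_card, GaloisField.card p _ hk]; rw [hR]; congr 1; ring)
        huv hdeg hp hα'
      rw [h1, norm_neg] at h2
      refine h2.trans_eq ?_
      rw [hB]
      congr 1
      rw [hR, mul_assoc 2, pow_mul √(p:ℝ) 2, Real.sq_sqrt hp0.le]
    intro w hw
    have hbd : ‖(w / √p) ^ R‖ ≤ 1 := by
      refine norm_le_one_of_bounded_powerSums (s := s.map fun w => (w / (√p : ℂ)) ^ R) (B := B) ?_
        (Multiset.mem_map_of_mem _ hw)
      intro n hn
      rw [Multiset.map_map]
      have : (s.map ((fun w => w ^ n) ∘ fun w => (w / (√p : ℂ)) ^ R)) =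
          s.map fun w => w ^ (R * n) * ((√p : ℂ) ^ (R * n))⁻¹ := by
        refine Multiset.map_congr rfl fun w _ => ?_
        simp only [Function.comp]
        rw [← pow_mul, div_pow, div_eq_mul_inv]
      rw [this, Multiset.sum_map_mul_right, norm_mul, norm_inv, norm_pow, Complex.norm_real,
        Real.norm_of_nonneg hsq.le, ← div_eq_mul_inv, div_le_iff₀ (by positivity)]
      exact hbound n hn
    rw [norm_pow] at hbd
    have h3 := (pow_le_one_iff_of_nonneg (norm_nonneg _) (by omega)).1 hbd
    rwa [norm_div, Complex.norm_real, Real.norm_of_nonneg hsq.le, div_le_one hsq] at h3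
  -- transfer to the prime field
  have h1 := hS 1 one_ne_zero
  simp only [pow_one, Multiset.map_id'] at h1
  have h2 : charSum ψ (GaloisField p 1) u v =
      ∑ x : ZMod p, if v.eval x = 0 then 0 else ψ (u.eval x / v.eval x) := by
    unfold charSum
    have E : GaloisField p 1 ≃ₐ[ZMod p] ZMod p := GaloisField.equivZmodP p
    refine Fintype.sum_equiv E.toEquiv _ _ fun x => ?_
    have e1 : ∀ w : (ZMod p)[X], w.eval (E x) = E (aeval x w) := fun w => by
      rw [← aeval_algHom_apply, ← coe_aeval_eq_eval]
    have e2 : (aeval x v = 0) ↔ v.eval (E x) = 0 := by rw [e1, map_eq_zero_iff _ E.injective]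
    have e3 : Algebra.trace (ZMod p) (GaloisField p 1) (aeval x u / aeval x v) =
        u.eval (E x) / v.eval (E x) := by
      rw [← Algebra.trace_eq_of_algEquiv E, Algebra.trace_self_apply, map_div₀, e1, e1]
    change _ = if v.eval (E x) = 0 then 0 else ψ (u.eval (E x) / v.eval (E x))
    simp only [e2, e3]
  rw [← h2, h1, norm_neg]
  have h4 : ∀ t : Multiset ℂ, (∀ w ∈ t, ‖w‖ ≤ √p) → ‖t.sum‖ ≤ t.card * √p := by
    intro t
    induction t using Multiset.induction_on with
    | empty => intro; simp
    | cons w t ih =>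
      intro h
      rw [Multiset.sum_cons, Multiset.card_cons]
      have := ih fun w hw => h w (Multiset.mem_cons_of_mem hw)
      have := h w (Multiset.mem_cons_self _ _)
      have := norm_add_le w t.sum
      push_cast
      linarith
  refine (h4 s hroot).trans ?_
  have : (s.card : ℝ) ≤ 2 * v.natDegree := by exact_mod_cast hs
  gcongr

end

section

theorem norm_sum_sub_sum_le_of_subset {ι : Type*} [Fintype ι] [DecidableEq ι] {f g : ι → ℂ}
    {S : Finset ι} {b : ℝ}
    (h : ∀ x ∉ S, f x = g x) (hb : ∀ x ∈ S, ‖f x - g x‖ ≤ b) :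
    ‖∑ x, f x - ∑ x, g x‖ ≤ S.card * b := by
  rw [← Finset.sum_sub_distrib, ← Finset.sum_subset (Finset.subset_univ S)
    (fun x _ hx => by rw [h x hx, sub_self])]
  refine (norm_sum_le _ _).trans ((Finset.sum_le_sum hb).trans_eq ?_)
  simp

theorem norm_weil_proper_le {p : ℕ} [Fact p.Prime] {ψ : AddChar (ZMod p) ℂ} (hψ : ψ ≠ 1)
    {u v : (ZMod p)[X]} (hu : u ≠ 0) (hdeg : u.natDegree < v.natDegree)
    (hp : v.natDegree < p) :
    ‖∑ x : ZMod p, if v.eval x = 0 then 0 else ψ (u.eval x / v.eval x)‖ ≤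
      2 * v.natDegree * √p + v.natDegree := by
  classical
  have hv : v ≠ 0 := by rintro rfl; simp at hdeg
  obtain ⟨g, u1, v1, hgu, hgv, hcop⟩ : ∃ g u1 v1, u = g * u1 ∧ v = g * v1 ∧ IsCoprime u1 v1 :=
    ⟨gcd u v, u / gcd u v, v / gcd u v,
      (EuclideanDomain.mul_div_cancel' (gcd_ne_zero_of_right hv) (gcd_dvd_left u v)).symm,
      (EuclideanDomain.mul_div_cancel' (gcd_ne_zero_of_right hv) (gcd_dvd_right u v)).symm,
      isCoprime_div_gcd_div_gcd hv⟩
  have hg : g ≠ 0 := by rintro rfl; simp at hgv; exact hv hgv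
  have hu1 : u1 ≠ 0 := by rintro rfl; simp at hgu; exact hu hgu
  have hv1 : v1 ≠ 0 := by rintro rfl; simp at hgv; exact hv hgv
  have hdu : u.natDegree = g.natDegree + u1.natDegree := by rw [hgu, natDegree_mul hg hu1]
  have hdv : v.natDegree = g.natDegree + v1.natDegree := by rw [hgv, natDegree_mul hg hv1]
  set l := v1.leadingCoeff⁻¹ with hl
  have hl0 : l ≠ 0 := inv_ne_zero (leadingCoeff_ne_zero.2 hv1)
  have hv2 : (C l * v1).Monic := by
    rw [Monic, leadingCoeff_mul, leadingCoeff_C, hl, inv_mul_cancel₀ (leadingCoeff_ne_zero.2 hv1)]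
  have hdl : (C l * v1).natDegree = v1.natDegree := natDegree_C_mul hl0
  have hcop2 : IsCoprime (C l * u1) (C l * v1) := by
    have hunit : IsUnit (C l) := isUnit_C.2 hl0.isUnit
    rwa [isCoprime_mul_unit_left hunit]
  have h1 := norm_charSum_zmod_le hψ hv2 hcop2 (by
    rw [hdl, natDegree_C_mul hl0]; omega) (by rw [hdl]; omega)
  have h2 := norm_sum_sub_sum_le_of_subset (S := g.roots.toFinset) (b := 1)
    (f := fun x : ZMod p => if v.eval x = 0 then 0 else ψ (u.eval x / v.eval x))
    (g := fun x : ZMod p => if (C l * v1).eval x = 0 then 0 else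
      ψ ((C l * u1).eval x / (C l * v1).eval x)) (by
      intro x hx
      have hgx : g.eval x ≠ 0 := by simpa [hg] using hx
      simp only [hgu, hgv, eval_mul, eval_C, mul_eq_zero, hgx, hl0, false_or]
      rw [mul_div_mul_left _ _ hgx, mul_div_mul_left _ _ hl0]) (by
      intro x hx
      have hgx : g.eval x = 0 := by simpa [hg] using hx
      have hvx : v.eval x = 0 := by rw [hgv, eval_mul, hgx, zero_mul]
      simp only [hvx, if_true, zero_sub, norm_neg]
      split_ifs
      · simp
      · rw [AddChar.norm_apply])
  have h3 : (g.roots.toFinset.card : ℝ) ≤ g.natDegree := by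
    exact_mod_cast (Multiset.toFinset_card_le _).trans (card_roots' _)
  rw [hdl] at h1
  have h4 := norm_le_norm_add_norm_sub' (∑ x : ZMod p, if v.eval x = 0 then 0 else
    ψ (u.eval x / v.eval x)) (∑ x : ZMod p, if (C l * v1).eval x = 0 then 0 else
      ψ ((C l * u1).eval x / (C l * v1).eval x))
  have h5 : (v.natDegree : ℝ) = g.natDegree + v1.natDegree := by exact_mod_cast hdv
  have h6 := Real.sqrt_nonneg p
  rw [h5]
  nlinarith [(Nat.cast_nonneg g.natDegree : (0:ℝ) ≤ _), (Nat.cast_nonneg v1.natDegree : (0:ℝ) ≤ _),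
    mul_nonneg (Nat.cast_nonneg g.natDegree : (0:ℝ) ≤ _) h6]

/-- Weil's bound for character sums of rational functions of bounded degree. -/
theorem norm_weil_le {p : ℕ} [Fact p.Prime] {ψ : AddChar (ZMod p) ℂ} (hψ : ψ ≠ 1)
    {u v : (ZMod p)[X]} {D : ℕ} (hu : u.natDegree ≤ D) (hv : v.natDegree ≤ D) (hD : D < p)
    (hv0 : v ≠ 0) (h : ∀ c, u ≠ C c * v) :
    ‖∑ x : ZMod p, if v.eval x = 0 then 0 else ψ (u.eval x / v.eval x)‖ ≤
      2 * D * √p + D + 2 := by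
  classical
  have hDpos : 0 < D := by
    by_contra hD0
    have hu' := eq_C_of_natDegree_eq_zero (p := u) (by omega)
    have hv' := eq_C_of_natDegree_eq_zero (p := v) (by omega)
    have hvc : v.coeff 0 ≠ 0 := by intro h0; rw [h0, C_0] at hv'; exact hv0 hv'
    apply h (u.coeff 0 / v.coeff 0)
    rw [hv', ← C_mul, coeff_C_zero, div_mul_cancel₀ _ hvc, ← hu']
  obtain ⟨x0, hx0⟩ : ∃ x0, v.eval x0 ≠ 0 := by
    by_contra hne
    push Not at hne
    refine hv0 (eq_zero_of_natDegree_lt_card_of_eval_eq_zero' v Finset.univ (fun x _ => hne x) ?_)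
    rw [Finset.card_univ, ZMod.card]; omega
  set c := u.eval x0 / v.eval x0 with hc
  set u' := u - C c * v with hu'
  have hu'0 : u' ≠ 0 := sub_ne_zero.2 (h c)
  have hu'd : u'.natDegree ≤ D :=
    (natDegree_sub_le _ _).trans (max_le hu ((natDegree_C_mul_le _ _).trans hv))
  have hu'x : u'.eval x0 = 0 := by
    rw [hu', eval_sub, eval_mul, eval_C, hc, div_mul_cancel₀ _ hx0, sub_self]
  set us := moebiusPoly D x0 u'
  set vs := moebiusPoly D x0 v
  have hvs : vs.natDegree = D := by
    refine natDegree_eq_of_le_of_coeff_ne_zero (moebiusPoly_natDegree_le x0 hv) ?_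
    rw [moebiusPoly_coeff]; exact hx0
  have hus0 : us ≠ 0 := moebiusPoly_ne_zero x0 hu'0
  have hus : us.natDegree < D := by
    refine lt_of_le_of_ne (moebiusPoly_natDegree_le x0 hu'd) fun he => ?_
    have : us.coeff us.natDegree = 0 := by rw [he, moebiusPoly_coeff, hu'x]
    exact hus0 (leadingCoeff_eq_zero.1 this)
  have h1 := norm_weil_proper_le hψ hus0 (hus.trans_eq hvs.symm) (hvs.trans_lt hD)
  rw [hvs] at h1
  set G : ZMod p → ℂ := fun t => if vs.eval t = 0 then 0 else ψ (us.eval t / vs.eval t) with hG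
  have hGsum : ∑ x : ZMod p, G (x - x0)⁻¹ = ∑ t, G t :=
    Fintype.sum_equiv ((Equiv.subRight x0).trans (Equiv.inv (ZMod p))) _ _ fun x => rfl
  have hnorm : ∀ (a b : (ZMod p)[X]) x, ‖(if b.eval x = 0 then 0 else ψ (a.eval x / b.eval x) : ℂ)‖ ≤ 1 := by
    intro a b x
    split_ifs
    · simp
    · rw [AddChar.norm_apply]
  have h2 := norm_sum_sub_sum_le_of_subset (S := {x0}) (b := 2)
    (f := fun x : ZMod p => if v.eval x = 0 then 0 else ψ (u'.eval x / v.eval x))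
    (g := fun x : ZMod p => G (x - x0)⁻¹) (by
      intro x hx
      have hxx : x ≠ x0 := by simpa using hx
      have hne : ((x - x0)⁻¹) ^ D ≠ 0 := pow_ne_zero _ (inv_ne_zero (sub_ne_zero.2 hxx))
      simp only [hG, us, vs, moebiusPoly_eval hu'd hxx, moebiusPoly_eval hv hxx, mul_eq_zero, hne,
        or_false]
      rw [mul_div_mul_right _ _ hne]) (by
      intro x _
      have := norm_sub_le (if v.eval x = 0 then 0 else ψ (u'.eval x / v.eval x)) (G (x - x0)⁻¹)
      have := hnorm u' v x
      have := hnorm us vs (x - x0)⁻¹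
      simp only [hG] at *
      linarith)
  have h3 : ∑ x : ZMod p, (if v.eval x = 0 then 0 else ψ (u.eval x / v.eval x)) =
      ψ c * ∑ x : ZMod p, (if v.eval x = 0 then 0 else ψ (u'.eval x / v.eval x)) := by
    rw [Finset.mul_sum]
    refine Finset.sum_congr rfl fun x _ => ?_
    split_ifs with hx
    · simp
    · rw [← AddChar.map_add_eq_mul]
      congr 1
      rw [hu', eval_sub, eval_mul, eval_C]
      field_simp
      ring
  rw [h3, norm_mul, AddChar.norm_apply, one_mul]
  rw [hGsum] at h2
  have h4 := norm_le_norm_add_norm_sub' (∑ x : ZMod p, (if v.eval x = 0 then 0 else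
    ψ (u'.eval x / v.eval x))) (∑ t, G t)
  simp only [Finset.card_singleton, Nat.cast_one, one_mul] at h2
  linarith

theorem norm_weil_finset_le {p : ℕ} [Fact p.Prime] {ψ : AddChar (ZMod p) ℂ} (hψ : ψ ≠ 1)
    {u v : (ZMod p)[X]} {D E : ℕ} (hu : u.natDegree ≤ D) (hv : v.natDegree ≤ D) (hD : D < p)
    (hv0 : v ≠ 0) (h : ∀ c, u ≠ C c * v) (U : Finset (ZMod p)) (hU : ∀ x ∈ U, v.eval x ≠ 0)
    (hE : Uᶜ.card ≤ E) :
    ‖∑ x ∈ U, ψ (u.eval x / v.eval x)‖ ≤ 2 * D * √p + D + 2 + E := by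
  classical
  have h1 := norm_weil_le hψ hu hv hD hv0 h
  have h2 := norm_sum_sub_sum_le_of_subset (S := Uᶜ) (b := 1)
    (f := fun x : ZMod p => if x ∈ U then ψ (u.eval x / v.eval x) else 0)
    (g := fun x : ZMod p => if v.eval x = 0 then 0 else ψ (u.eval x / v.eval x)) (by
      intro x hx
      have hxU : x ∈ U := by simpa using hx
      simp [hxU, hU x hxU]) (by
      intro x hx
      have hxU : x ∉ U := by simpa using hx
      simp only [hxU, if_false, zero_sub, norm_neg]
      split_ifs
      · simp
      · rw [AddChar.norm_apply])
  rw [Finset.sum_ite_mem, Finset.univ_inter, mul_one] at h2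
  have h3 : (Uᶜ.card : ℝ) ≤ E := by exact_mod_cast hE
  have h4 := norm_le_norm_add_norm_sub' (∑ x ∈ U, ψ (u.eval x / v.eval x))
    (∑ x : ZMod p, (if v.eval x = 0 then 0 else ψ (u.eval x / v.eval x)))
  linarith

end

section

/-- Multivariate version: a homogeneous linear relation between many polynomials of bounded
partial degrees. -/
theorem exists_ne_zero_mvPolynomial_sum_eq_zero {F ι : Type*} [Field F] [Fintype ι] {n : ℕ}
    (g : ι → MvPolynomial (Fin n) F) (M : ℕ) (hg : ∀ i k, (g i).degreeOf k < M)
    (hM : M ^ n < Fintype.card ι) :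
    ∃ b : ι → F, b ≠ 0 ∧ ∑ i, MvPolynomial.C (b i) * g i = 0 := by
  let L : (ι → F) →ₗ[F] ((Fin n → Fin M) → F) :=
    { toFun := fun b m => (∑ i, MvPolynomial.C (b i) * g i).coeff
        (Finsupp.equivFunOnFinite.symm fun k => (m k : ℕ))
      map_add' := by
        intro a b; ext m
        simp [add_mul, Finset.sum_add_distrib]
      map_smul' := by
        intro a b; ext m
        simp [mul_assoc, ← Finset.mul_sum] }
  have hL : LinearMap.ker L ≠ ⊥ := LinearMap.ker_ne_bot_of_finrank_lt (by simpa using hM)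
  obtain ⟨b, hb, hb0⟩ := (Submodule.ne_bot_iff _).1 hL
  refine ⟨b, hb0, ?_⟩
  ext m
  by_cases hm : ∀ k, m k < M
  · have h1 := congrFun (LinearMap.mem_ker.1 hb) (fun k => ⟨m k, hm k⟩)
    have h2 : (Finsupp.equivFunOnFinite.symm fun k => m k) = m := by ext; simp
    simpa [L, h2] using h1
  · push Not at hm
    obtain ⟨k, hk⟩ := hm
    rw [MvPolynomial.coeff_sum, MvPolynomial.coeff_zero]
    refine Finset.sum_eq_zero fun i _ => ?_
    rw [MvPolynomial.coeff_C_mul]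
    by_contra hne
    have hmem : m ∈ (g i).support := by
      rw [MvPolynomial.mem_support_iff]; exact right_ne_zero_of_mul hne
    have := MvPolynomial.monomial_le_degreeOf k hmem
    have := hg i k
    omega

theorem eq_zero_of_forall_sum_prod_pow_eq_zero {F : Type*} [Field F] [Fintype F] {n E : ℕ}
    (hE : E ≤ Fintype.card F) (r : (Fin n → Fin E) → F)
    (h : ∀ τ : Fin n → F, ∑ β, r β * ∏ k, τ k ^ (β k : ℕ) = 0) : r = 0 := by
  classical
  set m : (Fin n → Fin E) → (Fin n →₀ ℕ) := fun β => Finsupp.equivFunOnFinite.symm fun k => (β k : ℕ)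
    with hm
  have hmi : Function.Injective m := by
    intro β β' hb
    have := Finsupp.equivFunOnFinite.symm.injective hb
    funext k
    exact Fin.ext (congrFun this k)
  set G : MvPolynomial (Fin n) F := ∑ β, MvPolynomial.monomial (m β) (r β) with hG
  have hcoeff : ∀ β, G.coeff (m β) = r β := by
    intro β
    rw [hG, MvPolynomial.coeff_sum, Finset.sum_eq_single β]
    · simp
    · intro b _ hb
      rw [MvPolynomial.coeff_monomial, if_neg (fun h => hb (hmi h))]
    · simp
  have hG0 : G = 0 := by
    rcases Nat.eq_zero_or_pos E with rfl | hEpos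
    · rcases n with _ | n
      · have hτ := h (fun k => k.elim0)
        have he : ∀ β : Fin 0 → Fin 0, m β = 0 := fun β => by ext k; exact k.elim0
        simp only [Finset.univ_eq_empty, Finset.prod_empty, mul_one] at hτ
        rw [hG]
        simp only [he]
        rw [← map_sum, hτ, map_zero]
      · rw [hG]
        have : IsEmpty (Fin (n+1) → Fin 0) := ⟨fun f => (f 0).elim0⟩
        simp
    refine MvPolynomial.eq_zero_of_eval_zero_at_prod_finset G (fun _ => Finset.univ) ?_ ?_
    · intro i
      rw [Finset.card_univ]
      refine lt_of_lt_of_le ?_ hE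
      rw [MvPolynomial.degreeOf_lt_iff hEpos]
      intro d hd
      rw [MvPolynomial.mem_support_iff, hG, MvPolynomial.coeff_sum] at hd
      obtain ⟨β, -, hβ⟩ := Finset.exists_ne_zero_of_sum_ne_zero hd
      rw [MvPolynomial.coeff_monomial] at hβ
      have : m β = d := by by_contra hne; rw [if_neg hne] at hβ; exact hβ rfl
      rw [← this]
      simp [hm]
    · intro τ _
      rw [hG, map_sum, ← h τ]
      refine Finset.sum_congr rfl fun β _ => ?_
      rw [MvPolynomial.eval_monomial, Finsupp.prod_fintype _ _ (by simp)]
      simp [hm]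
  funext β
  rw [← hcoeff, hG0]; rfl

/-- The bound for each coordinate of the nonsingular solutions of a square system. -/
def nonsingBound (n δ : ℕ) : ℕ := (1 + n * δ) ^ n + 1

theorem degreeOf_prod_pow_le {F : Type*} [Field F] {n m δ : ℕ} (f : Fin m → MvPolynomial (Fin n) F)
    (k : Fin n) (hf : ∀ i, (f i).degreeOf k ≤ δ) {E : ℕ} (β : Fin m → ℕ) (hβ : ∀ i, β i ≤ E) :
    (∏ i, f i ^ β i).degreeOf k ≤ m * (E * δ) := by
  refine (MvPolynomial.degreeOf_prod_le _ _ _).trans ?_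
  refine (Finset.sum_le_card_nsmul _ _ (E * δ) fun i _ => ?_).trans_eq (by simp)
  exact (MvPolynomial.degreeOf_pow_le _ _ _).trans (Nat.mul_le_mul (hβ i) (hf i))

/-- The coordinates of the points where a square polynomial system vanishes to exactly first order
are roots of a fixed polynomial of bounded degree. -/
theorem exists_poly_of_nonsingular {F : Type*} [Field F] [Fintype F] {n δ : ℕ}
    (f : Fin n → MvPolynomial (Fin n) F) (hf : ∀ i k, (f i).degreeOf k ≤ δ)
    (hcard : nonsingBound n δ ≤ Fintype.card F) (j : Fin n) :
    ∃ ρ : F[X], ρ ≠ 0 ∧ ρ.natDegree < nonsingBound n δ ∧ ∀ ζ : Fin n → F,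
      (∀ τ : Fin n → F, ∃ γ : Fin n → F[X], (∀ k, (γ k).eval 0 = ζ k) ∧
        ∀ i, ∃ g : F[X], MvPolynomial.aeval γ (f i) = X * g ∧ g.eval 0 = τ i) →
      ρ.eval (ζ j) = 0 := by
  classical
  set E := nonsingBound n δ with hE
  have hEpos : 0 < E := by simp [hE, nonsingBound]
  set G : Fin E × (Fin n → Fin E) → MvPolynomial (Fin n) F := fun q =>
    MvPolynomial.X j ^ (q.1 : ℕ) * ∏ i, f i ^ (q.2 i : ℕ) with hG
  have hGdeg : ∀ q k, (G q).degreeOf k < E * (1 + n * δ) := by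
    intro q k
    have h1 : (MvPolynomial.X j ^ (q.1 : ℕ) : MvPolynomial (Fin n) F).degreeOf k ≤ E - 1 := by
      refine (MvPolynomial.degreeOf_pow_le _ _ _).trans ?_
      rw [MvPolynomial.degreeOf_X]
      have := q.1.2
      split_ifs <;> omega
    have h2 := degreeOf_prod_pow_le f k (fun i => hf i k) (E := E) (fun i => (q.2 i : ℕ))
      (fun i => (q.2 i).2.le)
    have h3 := MvPolynomial.degreeOf_mul_le k (MvPolynomial.X j ^ (q.1 : ℕ) : MvPolynomial (Fin n) F)
      (∏ i, f i ^ (q.2 i : ℕ))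
    have h4 : E * (1 + n * δ) = E + n * (E * δ) := by ring
    change MvPolynomial.degreeOf k _ < _
    simp only [hG]
    omega
  obtain ⟨r, hr0, hr⟩ := exists_ne_zero_mvPolynomial_sum_eq_zero G (E * (1 + n * δ)) hGdeg (by
    rw [Fintype.card_prod, Fintype.card_fun, Fintype.card_fin, Fintype.card_fin, mul_pow, mul_comm]
    refine Nat.mul_lt_mul_of_pos_right ?_ (by positivity)
    rw [hE, nonsingBound]; omega)
  -- lowest order part
  have hex : ∃ s, ∃ q, r q ≠ 0 ∧ ∑ k, (q.2 k : ℕ) = s := by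
    obtain ⟨q, hq⟩ := Function.ne_iff.1 hr0
    exact ⟨_, q, hq, rfl⟩
  set s := Nat.find hex with hs
  obtain ⟨q0, hq0, hq0s⟩ := Nat.find_spec hex
  have hmin : ∀ q, r q ≠ 0 → s ≤ ∑ k, (q.2 k : ℕ) := fun q hq => Nat.find_min' hex ⟨q, hq, rfl⟩
  set ρ : F[X] := ∑ i : Fin E, C (r (i, q0.2)) * X ^ (i : ℕ) with hρ
  refine ⟨ρ, ?_, ?_, ?_⟩
  · intro h0
    apply hq0
    have := congrArg (fun P => coeff P (q0.1 : ℕ)) h0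
    simp only [hρ, finsetSum_coeff, coeff_C_mul_X_pow, coeff_zero] at this
    rw [Finset.sum_eq_single q0.1] at this
    · simpa using this
    · intro b _ hb
      rw [if_neg (fun h => hb (Fin.ext h.symm))]
    · simp
  · have hle : ρ.natDegree ≤ E - 1 := by
      refine natDegree_sum_le_of_forall_le _ _ fun i _ => ?_
      refine (natDegree_C_mul_X_pow_le _ _).trans ?_
      have := i.2
      omega
    omega
  · intro ζ hζ
    have hpart : (fun β : Fin n → Fin E => if ∑ k, (β k : ℕ) = s then
        ∑ i : Fin E, r (i, β) * ζ j ^ (i : ℕ) else 0) = 0 := by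
      refine eq_zero_of_forall_sum_prod_pow_eq_zero hcard _ fun τ => ?_
      obtain ⟨γ, hγ, hγf⟩ := hζ τ
      choose g hg hg0 using hγf
      have h1 := congrArg (MvPolynomial.aeval γ) hr
      rw [map_sum, map_zero] at h1
      have h2 : ∀ q, MvPolynomial.aeval γ (MvPolynomial.C (r q) * G q) =
          X ^ s * (C (r q) * X ^ (∑ k, (q.2 k : ℕ) - s) * (γ j ^ (q.1 : ℕ) * ∏ i, g i ^ (q.2 i : ℕ))) := by
        intro q
        by_cases hq : r q = 0
        · simp [hq]
        · simp only [hG, map_mul, map_pow, map_prod, hg, MvPolynomial.aeval_X, mul_pow,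
            Finset.prod_mul_distrib, Finset.prod_pow_eq_pow_sum, MvPolynomial.aeval_C]
          rw [← Nat.add_sub_of_le (hmin q hq), pow_add, Nat.add_sub_cancel_left]
          change C (r q) * _ = _
          ring
      simp_rw [h2] at h1
      rw [← Finset.mul_sum, mul_eq_zero] at h1
      replace h1 := h1.resolve_left (pow_ne_zero _ X_ne_zero)
      have h3 := congrArg (eval 0) h1
      simp only [eval_finsetSum, eval_mul, eval_C, eval_pow, eval_X, hγ, eval_prod, hg0,
        eval_zero] at h3
      rw [Fintype.sum_prod_type_right] at h3
      refine Eq.trans ?_ h3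
      refine Finset.sum_congr rfl fun β _ => ?_
      split_ifs with hβ
      · rw [Finset.sum_mul]
        refine Finset.sum_congr rfl fun i _ => ?_
        rw [hβ, Nat.sub_self, pow_zero]; ring
      · rw [zero_mul]
        symm
        refine Finset.sum_eq_zero fun i _ => ?_
        by_cases hri : r (i, β) = 0
        · rw [hri]; ring
        · have h6 : s ≤ ∑ k, (β k : ℕ) := hmin _ hri
          have h7 : ∑ k, (β k : ℕ) - s ≠ 0 := by omega
          rw [zero_pow h7]; ring
    have h4 := congrFun hpart q0.2
    simp only [Pi.zero_apply] at h4
    rw [if_pos hq0s] at h4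
    rw [hρ, eval_finsetSum, ← h4]
    refine Finset.sum_congr rfl fun i _ => ?_
    simp

/-- A square system of polynomial equations has boundedly many nonsingular solutions. -/
theorem card_nonsingular_le {F : Type*} [Field F] [Fintype F] {n δ : ℕ}
    (f : Fin n → MvPolynomial (Fin n) F) (hf : ∀ i k, (f i).degreeOf k ≤ δ)
    (S : Finset (Fin n → F))
    (hS : ∀ ζ ∈ S, ∀ τ : Fin n → F, ∃ γ : Fin n → F[X], (∀ k, (γ k).eval 0 = ζ k) ∧
        ∀ i, ∃ g : F[X], MvPolynomial.aeval γ (f i) = X * g ∧ g.eval 0 = τ i) :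
    S.card ≤ nonsingBound n δ ^ n := by
  classical
  rcases le_or_gt (nonsingBound n δ) (Fintype.card F) with hcard | hcard
  · choose ρ hρ0 hρd hρ using exists_poly_of_nonsingular f hf hcard
    have hsub : S ⊆ Fintype.piFinset fun j => (ρ j).roots.toFinset := by
      intro ζ hζ
      rw [Fintype.mem_piFinset]
      intro j
      rw [Multiset.mem_toFinset, mem_roots (hρ0 j)]
      exact hρ j ζ (hS ζ hζ)
    refine (Finset.card_le_card hsub).trans ?_
    rw [Fintype.card_piFinset]
    refine (Finset.prod_le_pow_card _ _ (nonsingBound n δ) fun j _ => ?_).trans_eq (by simp)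
    exact ((Multiset.toFinset_card_le _).trans (card_roots' _)).trans (hρd j).le
  · refine (Finset.card_le_univ S).trans ?_
    rw [Fintype.card_fun, Fintype.card_fin]
    exact Nat.pow_le_pow_left hcard.le n

end

section

section Wronskian
variable {p : ℕ} [Fact p.Prime]

theorem natDegree_eq_of_derivative_mul_eq {u v : (ZMod p)[X]} (hu : u ≠ 0) (hv : v ≠ 0)
    (hup : u.natDegree < p) (hvp : v.natDegree < p) (h : derivative u * v = u * derivative v) :
    u.natDegree = v.natDegree := by
  have h1 : (X * derivative u) * v = u * (X * derivative v) := by linear_combination X * h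
  have hX : ∀ w : (ZMod p)[X], ∀ n, (X * derivative w).coeff n = n * w.coeff n := by
    intro w n
    rcases n with _ | n
    · simp
    · rw [coeff_X_mul, coeff_derivative]; push_cast; ring
  have hXd : ∀ w : (ZMod p)[X], (X * derivative w).natDegree ≤ w.natDegree := by
    intro w
    rw [natDegree_le_iff_coeff_eq_zero]
    intro n hn
    rw [hX, coeff_eq_zero_of_natDegree_lt hn, mul_zero]
  have h2 := congrArg (fun w => coeff w (u.natDegree + v.natDegree)) h1
  rw [coeff_mul_add_eq_of_natDegree_le (hXd u) le_rfl, coeff_mul_add_eq_of_natDegree_le le_rfl (hXd v), hX, hX] at h2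
  have h3 : ((u.natDegree : ZMod p) - v.natDegree) * (u.leadingCoeff * v.leadingCoeff) = 0 := by
    simp only [leadingCoeff]; linear_combination h2
  have h4 := (mul_eq_zero.1 h3).resolve_right
    (mul_ne_zero (leadingCoeff_ne_zero.2 hu) (leadingCoeff_ne_zero.2 hv))
  rw [sub_eq_zero, ZMod.natCast_eq_natCast_iff] at h4
  exact Nat.ModEq.eq_of_lt_of_lt h4 hup hvp

theorem exists_eq_C_mul_of_derivative_mul_eq {u v : (ZMod p)[X]} (hv : v ≠ 0)
    (hup : u.natDegree < p) (hvp : v.natDegree < p) (h : derivative u * v = u * derivative v) :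
    ∃ c, u = C c * v := by
  by_cases hu : u = 0
  · exact ⟨0, by simp [hu]⟩
  have hd := natDegree_eq_of_derivative_mul_eq hu hv hup hvp h
  have hlv := leadingCoeff_ne_zero.2 hv
  set c := u.leadingCoeff / v.leadingCoeff with hc
  refine ⟨c, ?_⟩
  by_contra hne
  set w := u - C c * v with hw
  have hw0 : w ≠ 0 := sub_ne_zero.2 hne
  have hc0 : c ≠ 0 := div_ne_zero (leadingCoeff_ne_zero.2 hu) hlv
  have hwd : w.degree < u.degree := by
    refine degree_sub_lt_left ?_ hu ?_
    · rw [degree_C_mul hc0, degree_eq_natDegree hu, degree_eq_natDegree hv, hd]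
    · rw [leadingCoeff_mul, leadingCoeff_C, hc, div_mul_cancel₀ _ hlv]
  have hwd' : w.natDegree < u.natDegree := (natDegree_lt_natDegree_iff hw0).2 hwd
  have := natDegree_eq_of_derivative_mul_eq hw0 hv (hwd'.trans hup) hvp (by
    rw [hw, derivative_sub, derivative_C_mul]; linear_combination h)
  omega

theorem not_dvd_derivative_of_irreducible {q : (ZMod p)[X]} (hq : Irreducible q)
    (hqp : q.natDegree < p) : ¬ q ∣ derivative q := by
  intro h
  refine absurd (eq_zero_of_dvd_of_natDegree_lt h (natDegree_derivative_lt hq.natDegree_pos.ne')) ?_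
  exact derivative_ne_zero_of_lt hq.natDegree_pos hqp

/-- If `(u/v)'` is a constant multiple of the logarithmic derivative of `M/N`, then both vanish. -/
theorem wronskian_eq_zero_of_logDeriv {u v M N : (ZMod p)[X]} {c : ZMod p} (hv : v ≠ 0)
    (hvp : v.natDegree < p) (hM : M ≠ 0) (hN : N ≠ 0)
    (h : M * N * (derivative u * v - u * derivative v) =
      C c * (derivative M * N - M * derivative N) * v ^ 2) :
    C c * (derivative M * N - M * derivative N) = 0 := by
  obtain ⟨g, u1, v1, hgu, hgv, hcop⟩ : ∃ g u1 v1, u = g * u1 ∧ v = g * v1 ∧ IsCoprime u1 v1 :=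
    ⟨gcd u v, u / gcd u v, v / gcd u v,
      (EuclideanDomain.mul_div_cancel' (gcd_ne_zero_of_right hv) (gcd_dvd_left u v)).symm,
      (EuclideanDomain.mul_div_cancel' (gcd_ne_zero_of_right hv) (gcd_dvd_right u v)).symm,
      isCoprime_div_gcd_div_gcd hv⟩
  have hg : g ≠ 0 := by rintro rfl; simp at hgv; exact hv hgv
  have hv1 : v1 ≠ 0 := by rintro rfl; simp at hgv; exact hv hgv
  have hdv : v.natDegree = g.natDegree + v1.natDegree := by rw [hgv, natDegree_mul hg hv1]
  have h1 : M * N * (derivative u1 * v1 - u1 * derivative v1) =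
      C c * (derivative M * N - M * derivative N) * v1 ^ 2 := by
    apply mul_left_cancel₀ (pow_ne_zero 2 hg)
    rw [hgu, hgv, derivative_mul, derivative_mul] at h
    linear_combination h
  have hunit : v1.natDegree = 0 := by
    by_contra hne
    obtain ⟨q, hq, hqv⟩ := exists_irreducible_of_natDegree_pos (Nat.pos_of_ne_zero hne)
    have hqp : Prime q := hq.prime
    have hqdeg : q.natDegree < p := by
      have := natDegree_le_of_dvd hqv hv1
      omega
    obtain ⟨k, w, hw, hvw⟩ := WfDvdMonoid.max_power_factor hv1 hq
    obtain ⟨m, M1, hM1, hMM⟩ := WfDvdMonoid.max_power_factor hM hq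
    obtain ⟨n, N1, hN1, hNN⟩ := WfDvdMonoid.max_power_factor hN hq
    have hkp : k * q.natDegree ≤ v1.natDegree := by
      have hw0 : w ≠ 0 := by rintro rfl; exact hw (dvd_zero _)
      rw [hvw, natDegree_mul (pow_ne_zero _ hq.ne_zero) hw0, natDegree_pow]; omega
    have hqpos := hq.natDegree_pos
    obtain ⟨j, rfl⟩ : ∃ j, k = j + 1 := by
      refine ⟨k - 1, ?_⟩
      have : k ≠ 0 := by
        rintro rfl
        rw [pow_zero, one_mul] at hvw
        exact hw (hvw ▸ hqv)
      omega
    have hu1 : ¬ q ∣ u1 := fun hd => hq.not_isUnit (hcop.isUnit_of_dvd' hd hqv)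
    have hXd : ∀ (t : ℕ) (f : (ZMod p)[X]), q * derivative (q ^ t * f) =
        q ^ t * (C (t : ZMod p) * derivative q * f + q * derivative f) := by
      intro t f
      rcases t with _ | t
      · simp
      · rw [derivative_mul, derivative_pow_succ]; push_cast; simp only [map_add, map_natCast, map_one]; ring
    have e1 : q * (derivative u1 * v1 - u1 * derivative v1) =
        q ^ (j + 1) * (q * (derivative u1 * w - u1 * derivative w) -
          u1 * C ((j + 1 : ℕ) : ZMod p) * derivative q * w) := by
      have := hXd (j+1) w
      rw [← hvw] at this
      rw [mul_sub, mul_left_comm q u1, this]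
      conv_lhs => rw [hvw]
      ring
    have e2 : q * (derivative M * N - M * derivative N) =
        q ^ (m + n) * ((C (m : ZMod p) * derivative q * M1 + q * derivative M1) * N1 -
          M1 * (C (n : ZMod p) * derivative q * N1 + q * derivative N1)) := by
      have h2 := hXd m M1
      have h3 := hXd n N1
      rw [← hMM] at h2
      rw [← hNN] at h3
      rw [mul_sub, mul_left_comm q M, h3, ← mul_assoc, h2]
      conv_lhs => rw [hMM, hNN]
      ring
    set T := (C (m : ZMod p) * derivative q * M1 + q * derivative M1) * N1 -
          M1 * (C (n : ZMod p) * derivative q * N1 + q * derivative N1)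
    have e3 : q ^ (m + n + (j + 1)) * (M1 * N1 * (q * (derivative u1 * w - u1 * derivative w) -
          u1 * C ((j + 1 : ℕ) : ZMod p) * derivative q * w)) =
        q ^ (m + n + (j + 1)) * (q ^ (j + 1) * (C c * T * w ^ 2)) := by
      have h4 : M * N * (q * (derivative u1 * v1 - u1 * derivative v1)) =
        C c * (q * (derivative M * N - M * derivative N)) * v1 ^ 2 := by linear_combination q * h1
      rw [e1, e2, hMM, hNN, hvw] at h4
      linear_combination h4
    have e4 := mul_left_cancel₀ (pow_ne_zero _ hq.ne_zero) e3
    have e5 : q ∣ M1 * N1 * (u1 * C ((j + 1 : ℕ) : ZMod p) * derivative q * w) := by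
      refine ⟨M1 * N1 * (derivative u1 * w - u1 * derivative w) - q ^ j * (C c * T * w ^ 2), ?_⟩
      linear_combination -e4
    have hj : ¬ q ∣ C ((j + 1 : ℕ) : ZMod p) := by
      intro hd
      have hne : ((j + 1 : ℕ) : ZMod p) ≠ 0 := by
        rw [Ne, ZMod.natCast_eq_zero_iff]
        intro hd'
        have := Nat.le_of_dvd (by omega) hd'
        nlinarith
      exact hq.not_isUnit (isUnit_of_dvd_unit hd (isUnit_C.2 hne.isUnit))
    rcases hqp.dvd_or_dvd e5 with h5 | h5
    · rcases hqp.dvd_or_dvd h5 with h5 | h5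
      exacts [hM1 h5, hN1 h5]
    rcases hqp.dvd_or_dvd h5 with h5 | h5
    · rcases hqp.dvd_or_dvd h5 with h5 | h5
      · rcases hqp.dvd_or_dvd h5 with h5 | h5
        exacts [hu1 h5, hj h5]
      · exact not_dvd_derivative_of_irreducible hq hqdeg h5
    · exact hw h5
  obtain ⟨l, rfl⟩ := natDegree_eq_zero.1 hunit
  have hl : l ≠ 0 := by rintro rfl; simp at hv1
  have hCl : (C l : (ZMod p)[X]) ≠ 0 := C_ne_zero.2 hl
  have h2 : M * N * derivative u1 = C c * (derivative M * N - M * derivative N) * C l := by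
    apply mul_right_cancel₀ hCl
    rw [derivative_C] at h1
    linear_combination h1
  by_contra hne
  have hne' : derivative M * N - M * derivative N ≠ 0 := right_ne_zero_of_mul hne
  have hu' : derivative u1 ≠ 0 := by
    rintro h0
    rw [h0, mul_zero] at h2
    exact mul_ne_zero hne hCl h2.symm
  have hc : c ≠ 0 := by rintro rfl; simp at hne
  have hdeg : (M * N).degree ≤ (derivative M * N - M * derivative N).degree := by
    have h3 : M * N ∣ derivative M * N - M * derivative N := by
      refine (Dvd.intro _ rfl : M * N ∣ M * N * (derivative u1 * C (c * l)⁻¹)).trans ?_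
      have : C c * C l * C (c * l)⁻¹ = (1 : (ZMod p)[X]) := by
        rw [← C_mul, ← C_mul, mul_inv_cancel₀ (mul_ne_zero hc hl), C_1]
      refine dvd_of_eq ?_
      linear_combination C (c * l)⁻¹ * h2 + (derivative M * N - M * derivative N) * this
    exact degree_le_of_dvd h3 hne'
  have hlt : (derivative M * N - M * derivative N).degree < (M * N).degree := by
    refine (degree_sub_le _ _).trans_lt (max_lt ?_ ?_)
    · rw [degree_mul, degree_mul]
      exact WithBot.add_lt_add_right (degree_ne_bot.2 hN) (degree_derivative_lt hM)
    · rw [degree_mul, degree_mul]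
      exact WithBot.add_lt_add_left (degree_ne_bot.2 hM) (degree_derivative_lt hN)
  exact absurd hdeg (not_le.2 hlt)

end Wronskian

/-- Reductions `P = a / b` and `Q = r / s` modulo `p` of two rational functions, linearly
independent modulo constants. -/
structure RedData (p d : ℕ) [Fact p.Prime] where
  a : (ZMod p)[X]
  b : (ZMod p)[X]
  r : (ZMod p)[X]
  s : (ZMod p)[X]
  ha : a.natDegree ≤ d
  hb : b.natDegree ≤ d
  hr : r.natDegree ≤ d
  hs : s.natDegree ≤ d
  hb0 : b ≠ 0
  hs0 : s ≠ 0
  indep : ∀ x y z : ZMod p, C x * (a * s) + C y * (r * b) + C z * (b * s) = 0 → x = 0 ∧ y = 0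
  large : 20 * (d + 1) ≤ p

namespace RedData
variable {p d : ℕ} [Fact p.Prime] (G : RedData p d)

def M : (ZMod p)[X] := (derivative G.a * G.b - G.a * derivative G.b) * G.s ^ 2
def N : (ZMod p)[X] := (derivative G.r * G.s - G.r * derivative G.s) * G.b ^ 2

theorem natDegree_derivative_le' {f : (ZMod p)[X]} {n : ℕ} (h : f.natDegree ≤ n) :
    (derivative f).natDegree ≤ n :=
  ((natDegree_derivative_le f).trans (Nat.sub_le _ _)).trans h

theorem natDegree_mul_le_add {f g : (ZMod p)[X]} {m n : ℕ} (hf : f.natDegree ≤ m)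
    (hg : g.natDegree ≤ n) : (f * g).natDegree ≤ m + n :=
  natDegree_mul_le.trans (add_le_add hf hg)

theorem natDegree_wronskian_le {f g : (ZMod p)[X]} {m n : ℕ} (hf : f.natDegree ≤ m)
    (hg : g.natDegree ≤ n) : (derivative f * g - f * derivative g).natDegree ≤ m + n :=
  (natDegree_sub_le _ _).trans (max_le (natDegree_mul_le_add (natDegree_derivative_le' hf) hg)
    (natDegree_mul_le_add hf (natDegree_derivative_le' hg)))

theorem natDegree_pow_le_mul {f : (ZMod p)[X]} {m : ℕ} (hf : f.natDegree ≤ m) (k : ℕ) :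
    (f ^ k).natDegree ≤ k * m := natDegree_pow_le.trans (Nat.mul_le_mul_left _ hf)

theorem natDegree_M_le : G.M.natDegree ≤ 4 * d :=
  (natDegree_mul_le_add (natDegree_wronskian_le G.ha G.hb)
    (natDegree_pow_le_mul G.hs 2)).trans (by omega)

theorem natDegree_N_le : G.N.natDegree ≤ 4 * d :=
  (natDegree_mul_le_add (natDegree_wronskian_le G.hr G.hs)
    (natDegree_pow_le_mul G.hb 2)).trans (by omega)

theorem natDegree_bs_le : (G.b * G.s).natDegree ≤ 2 * d :=
  (natDegree_mul_le_add G.hb G.hs).trans (by omega)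

theorem natDegree_comb_le (x y : ZMod p) :
    (C x * (G.a * G.s) + C y * (G.r * G.b)).natDegree ≤ 2 * d := by
  refine (natDegree_add_le _ _).trans (max_le ?_ ?_)
  · exact (natDegree_C_mul_le _ _).trans ((natDegree_mul_le_add G.ha G.hs).trans (by omega))
  · exact (natDegree_C_mul_le _ _).trans ((natDegree_mul_le_add G.hr G.hb).trans (by omega))

theorem bs_ne_zero : G.b * G.s ≠ 0 := mul_ne_zero G.hb0 G.hs0

theorem comb_ne (x y : ZMod p) (h : x ≠ 0 ∨ y ≠ 0) (c : ZMod p) :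
    C x * (G.a * G.s) + C y * (G.r * G.b) ≠ C c * (G.b * G.s) := by
  intro he
  have := G.indep x y (-c) (by rw [C_neg]; linear_combination he)
  rcases h with h | h
  exacts [h this.1, h this.2]

theorem wronskian_comb (x y : ZMod p) :
    derivative (C x * (G.a * G.s) + C y * (G.r * G.b)) * (G.b * G.s) -
      (C x * (G.a * G.s) + C y * (G.r * G.b)) * derivative (G.b * G.s) =
    C x * G.M + C y * G.N := by
  simp only [M, N, derivative_add, derivative_mul, derivative_C]
  ring

theorem M_N_indep (x y : ZMod p) (h : C x * G.M + C y * G.N = 0) : x = 0 ∧ y = 0 := by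
  have hl := G.large
  rw [← wronskian_comb, sub_eq_zero] at h
  obtain ⟨c, hc⟩ := exists_eq_C_mul_of_derivative_mul_eq G.bs_ne_zero
    (lt_of_le_of_lt (G.natDegree_comb_le x y) (by omega))
    (lt_of_le_of_lt G.natDegree_bs_le (by omega)) h
  by_contra hne
  exact G.comb_ne x y (by tauto) c hc

theorem M_ne_zero : G.M ≠ 0 := by
  intro h
  have := G.M_N_indep 1 0 (by simp [h])
  exact one_ne_zero this.1

theorem N_ne_zero : G.N ≠ 0 := by
  intro h
  have := G.M_N_indep 0 1 (by simp [h])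
  exact one_ne_zero this.2

/-- The polynomial vector proportional to `(P', Q', M'/M - N'/N)`. -/
def vec : Fin 3 → (ZMod p)[X] :=
  ![G.M ^ 2 * G.N, G.M * G.N ^ 2,
    (derivative G.M * G.N - G.M * derivative G.N) * (G.b * G.s) ^ 2]

theorem natDegree_vec_le (i : Fin 3) : (G.vec i).natDegree ≤ 12 * d := by
  have hM := G.natDegree_M_le
  have hN := G.natDegree_N_le
  fin_cases i
  · exact (natDegree_mul_le_add (natDegree_pow_le_mul hM 2) hN).trans (by omega)
  · exact (natDegree_mul_le_add hM (natDegree_pow_le_mul hN 2)).trans (by omega)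
  · exact (natDegree_mul_le_add (natDegree_wronskian_le hM hN)
      (natDegree_pow_le_mul G.natDegree_bs_le 2)).trans (by omega)

theorem vec_indep (w : Fin 3 → ZMod p) (h : ∑ i, C (w i) * G.vec i = 0) : w = 0 := by
  have hl := G.large
  have hM0 := G.M_ne_zero
  have hN0 := G.N_ne_zero
  simp only [Fin.sum_univ_three, vec, Matrix.cons_val_zero, Matrix.cons_val_one,
    Matrix.cons_val] at h
  have hcomb := G.wronskian_comb (w 0) (w 1)
  have h1 := wronskian_eq_zero_of_logDeriv (c := -w 2)
    (u := C (w 0) * (G.a * G.s) + C (w 1) * (G.r * G.b)) G.bs_ne_zero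
    (lt_of_le_of_lt G.natDegree_bs_le (by omega)) hM0 hN0 (by
      rw [hcomb, C_neg]; linear_combination h)
  have h2 : w 2 = 0 := by
    by_contra hne
    have h3 := (mul_eq_zero.1 h1).resolve_left (C_ne_zero.2 (neg_ne_zero.2 hne))
    obtain ⟨c, hc⟩ := exists_eq_C_mul_of_derivative_mul_eq hN0
      (lt_of_le_of_lt G.natDegree_M_le (by omega))
      (lt_of_le_of_lt G.natDegree_N_le (by omega)) (sub_eq_zero.1 h3)
    have := G.M_N_indep 1 (-c) (by rw [C_neg, C_1]; linear_combination hc)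
    exact one_ne_zero this.1
  have h3 : C (w 0) * G.M + C (w 1) * G.N = 0 := by
    apply mul_left_cancel₀ (mul_ne_zero hM0 hN0)
    rw [h2, C_0] at h
    linear_combination h
  have h4 := G.M_N_indep _ _ h3
  funext i
  fin_cases i
  exacts [h4.1, h4.2, h2]

end RedData

end

section

section Nonsingular
variable {F : Type*} [Field F]

/-- A univariate polynomial in the `i`-th variable. -/
def inVar {n : ℕ} (i : Fin n) (f : F[X]) : MvPolynomial (Fin n) F :=
  Polynomial.aeval (MvPolynomial.X i) f

theorem aeval_inVar {n : ℕ} (γ : Fin n → F[X]) (i : Fin n) (f : F[X]) :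
    MvPolynomial.aeval γ (inVar i f) = f.comp (γ i) := by
  rw [inVar, ← Polynomial.aeval_algHom_apply, MvPolynomial.aeval_X, comp_eq_aeval]

theorem degreeOf_inVar_le {n : ℕ} (i k : Fin n) {f : F[X]} {m : ℕ} (hf : f.natDegree ≤ m) :
    (inVar i f).degreeOf k ≤ m := by
  rw [inVar, Polynomial.aeval_eq_sum_range]
  refine (MvPolynomial.degreeOf_sum_le _ _ _).trans (Finset.sup_le fun j hj => ?_)
  rw [MvPolynomial.smul_eq_C_mul]
  refine (MvPolynomial.degreeOf_C_mul_le _ _ _).trans ((MvPolynomial.degreeOf_pow_le _ _ _).trans ?_)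
  classical
  rw [MvPolynomial.degreeOf_X]
  have := Finset.mem_range.1 hj
  split_ifs <;> omega

theorem degreeOf_mul_le_add {n : ℕ} {k : Fin n} {f g : MvPolynomial (Fin n) F} {x y : ℕ}
    (hf : f.degreeOf k ≤ x) (hg : g.degreeOf k ≤ y) : (f * g).degreeOf k ≤ x + y :=
  (MvPolynomial.degreeOf_mul_le _ _ _).trans (add_le_add hf hg)

theorem degreeOf_add_le_of_le {n : ℕ} {k : Fin n} {f g : MvPolynomial (Fin n) F} {x : ℕ}
    (hf : f.degreeOf k ≤ x) (hg : g.degreeOf k ≤ x) : (f + g).degreeOf k ≤ x :=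
  (MvPolynomial.degreeOf_add_le _ _ _).trans (max_le hf hg)

theorem degreeOf_sub_le_of_le {n : ℕ} {k : Fin n} {f g : MvPolynomial (Fin n) F} {x : ℕ}
    (hf : f.degreeOf k ≤ x) (hg : g.degreeOf k ≤ x) : (f - g).degreeOf k ≤ x :=
  (MvPolynomial.degreeOf_sub_le _ _ _).trans (max_le hf hg)

theorem degreeOf_C_mul_le_of_le {n : ℕ} {k : Fin n} {f : MvPolynomial (Fin n) F} {x : ℕ} (c : F)
    (hf : f.degreeOf k ≤ x) : (MvPolynomial.C c * f).degreeOf k ≤ x :=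
  (MvPolynomial.degreeOf_C_mul_le _ _ _).trans hf

theorem exists_eq_X_mul_of_eval_zero {f : F[X]} (h : f.eval 0 = 0) :
    ∃ g, f = X * g ∧ g.eval 0 = (derivative f).eval 0 := by
  obtain ⟨g, rfl⟩ := X_dvd_iff.2 ((coeff_zero_eq_eval_zero f).trans h)
  exact ⟨g, rfl, by simp⟩

/-- The line through `ζ` with direction `η`. -/
def line {n : ℕ} (ζ η : Fin n → F) (k : Fin n) : F[X] := C (ζ k) + X * C (η k)

theorem eval_comp_line {n : ℕ} (ζ η : Fin n → F) (k : Fin n) (f : F[X]) :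
    (f.comp (line ζ η k)).eval 0 = f.eval (ζ k) := by
  simp [line]

theorem eval_derivative_comp_line {n : ℕ} (ζ η : Fin n → F) (k : Fin n) (f : F[X]) :
    (derivative (f.comp (line ζ η k))).eval 0 = (derivative f).eval (ζ k) * η k := by
  have h : (derivative (line ζ η k)).eval 0 = η k := by simp [line]
  rw [derivative_comp, eval_mul, eval_comp_line, h, mul_comm]

theorem nonsingular_of_line {n : ℕ} (f : Fin n → MvPolynomial (Fin n) F) (ζ : Fin n → F)
    (h0 : ∀ η i, (MvPolynomial.aeval (line ζ η) (f i)).eval 0 = 0)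
    (h1 : ∀ τ : Fin n → F, ∃ η, ∀ i,
      (derivative (MvPolynomial.aeval (line ζ η) (f i))).eval 0 = τ i) (τ : Fin n → F) :
    ∃ γ : Fin n → F[X], (∀ k, (γ k).eval 0 = ζ k) ∧
        ∀ i, ∃ g : F[X], MvPolynomial.aeval γ (f i) = X * g ∧ g.eval 0 = τ i := by
  obtain ⟨η, hη⟩ := h1 τ
  refine ⟨line ζ η, fun k => by simp [line], fun i => ?_⟩
  obtain ⟨g, hg, hg0⟩ := exists_eq_X_mul_of_eval_zero (h0 η i)
  exact ⟨g, hg, hg0.trans (hη i)⟩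

theorem exists_cyclic_solution {a₁ a₂ a₃ a₄ b₁ b₂ b₃ b₄ : F}
    (h : a₁ * b₂ * a₃ * b₄ - b₁ * a₂ * b₃ * a₄ ≠ 0) (t₁ t₂ t₃ t₄ : F) :
    ∃ x₁ x₂ x₃ x₄, a₁ * x₁ - a₂ * x₂ = t₁ ∧ b₂ * x₂ - b₃ * x₃ = t₂ ∧ a₃ * x₃ - a₄ * x₄ = t₃ ∧
      b₄ * x₄ - b₁ * x₁ = t₄ := by
  set D := a₁ * b₂ * a₃ * b₄ - b₁ * a₂ * b₃ * a₄ with hD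
  refine ⟨(t₁ * b₂ * a₃ * b₄ + t₂ * a₂ * a₃ * b₄ + t₃ * a₂ * b₃ * b₄ + t₄ * a₂ * b₃ * a₄) / D,
    (t₂ * a₃ * b₄ * a₁ + t₃ * b₃ * b₄ * a₁ + t₄ * b₃ * a₄ * a₁ + t₁ * b₃ * a₄ * b₁) / D,
    (t₃ * b₄ * a₁ * b₂ + t₄ * a₄ * a₁ * b₂ + t₁ * a₄ * b₁ * b₂ + t₂ * a₄ * b₁ * a₂) / D,
    (t₄ * a₁ * b₂ * a₃ + t₁ * b₁ * b₂ * a₃ + t₂ * b₁ * a₂ * a₃ + t₃ * b₁ * a₂ * b₃) / D,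
    ?_, ?_, ?_, ?_⟩ <;> field_simp <;> rw [hD] <;> ring

end Nonsingular

namespace RedData
variable {p d : ℕ} [Fact p.Prime] (G : RedData p d)

def P (y : ZMod p) : ZMod p := G.a.eval y / G.b.eval y
def Q (y : ZMod p) : ZMod p := G.r.eval y / G.s.eval y

/-- The good points: no poles of `P`, `Q`, no zeros of `P'`, `Q'`. -/
def U : Finset (ZMod p) :=
  Finset.univ.filter fun y => G.b.eval y ≠ 0 ∧ G.s.eval y ≠ 0 ∧ G.M.eval y ≠ 0 ∧ G.N.eval y ≠ 0

theorem mem_U {y : ZMod p} : y ∈ G.U ↔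
    G.b.eval y ≠ 0 ∧ G.s.eval y ≠ 0 ∧ G.M.eval y ≠ 0 ∧ G.N.eval y ≠ 0 := by
  simp [U]

/-- The value of the derivative of `P`. -/
def dP (y : ZMod p) : ZMod p :=
  (derivative G.a * G.b - G.a * derivative G.b).eval y / G.b.eval y ^ 2
def dQ (y : ZMod p) : ZMod p :=
  (derivative G.r * G.s - G.r * derivative G.s).eval y / G.s.eval y ^ 2

theorem M_eval {y : ZMod p} (hy : y ∈ G.U) :
    G.M.eval y = G.dP y * (G.b.eval y * G.s.eval y) ^ 2 := by
  have h := (G.mem_U.1 hy).1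
  rw [M, dP, eval_mul, eval_pow]; field_simp

theorem N_eval {y : ZMod p} (hy : y ∈ G.U) :
    G.N.eval y = G.dQ y * (G.b.eval y * G.s.eval y) ^ 2 := by
  have h := (G.mem_U.1 hy).2.1
  rw [N, dQ, eval_mul, eval_pow]; field_simp

/-- Numerator of `u(y_i)/v(y_i) - u(y_j)/v(y_j) - c`. -/
def diffPoly {n : ℕ} (u v : (ZMod p)[X]) (i j : Fin n) (c : ZMod p) :
    MvPolynomial (Fin n) (ZMod p) :=
  inVar i u * inVar j v - inVar j u * inVar i v - MvPolynomial.C c * (inVar i v * inVar j v)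

theorem degreeOf_diffPoly_le {n : ℕ} {u v : (ZMod p)[X]} (hu : u.natDegree ≤ d)
    (hv : v.natDegree ≤ d) (i j : Fin n) (c : ZMod p) (k : Fin n) :
    (diffPoly u v i j c).degreeOf k ≤ d + d := by
  refine degreeOf_sub_le_of_le (degreeOf_sub_le_of_le ?_ ?_) (degreeOf_C_mul_le_of_le _ ?_) <;>
    exact degreeOf_mul_le_add (degreeOf_inVar_le _ _ ‹_›) (degreeOf_inVar_le _ _ ‹_›)

theorem diffPoly_line {n : ℕ} {u v : (ZMod p)[X]} {i j : Fin n} {c : ZMod p}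
    {ζ : Fin n → ZMod p} (η : Fin n → ZMod p) (hi : v.eval (ζ i) ≠ 0) (hj : v.eval (ζ j) ≠ 0)
    (h : u.eval (ζ i) / v.eval (ζ i) - u.eval (ζ j) / v.eval (ζ j) = c) :
    (MvPolynomial.aeval (line ζ η) (diffPoly u v i j c)).eval 0 = 0 ∧
    (derivative (MvPolynomial.aeval (line ζ η) (diffPoly u v i j c))).eval 0 =
      v.eval (ζ i) * v.eval (ζ j) *
      ((derivative u * v - u * derivative v).eval (ζ i) / v.eval (ζ i) ^ 2 * η i -
       (derivative u * v - u * derivative v).eval (ζ j) / v.eval (ζ j) ^ 2 * η j) := by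
  subst h
  constructor
  · simp only [diffPoly, map_sub, map_mul, aeval_inVar, MvPolynomial.aeval_C, eval_sub, eval_mul,
      eval_comp_line, Polynomial.algebraMap_eq, eval_C]
    field_simp
    ring
  · simp only [diffPoly, map_sub, map_mul, aeval_inVar, MvPolynomial.aeval_C, derivative_mul, eval_add, eval_sub, eval_mul,
      eval_comp_line, eval_derivative_comp_line, Polynomial.algebraMap_eq, eval_C, derivative_C, eval_zero]
    field_simp
    ring

/-- The Jacobian of the cyclic system. -/
def J (q : ZMod p × ZMod p × ZMod p × ZMod p) : ZMod p :=
  G.M.eval q.1 * G.N.eval q.2.1 * G.M.eval q.2.2.1 * G.N.eval q.2.2.2 -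
    G.N.eval q.1 * G.M.eval q.2.1 * G.N.eval q.2.2.1 * G.M.eval q.2.2.2

/-- The values of the cyclic system. -/
def A (q : ZMod p × ZMod p × ZMod p × ZMod p) : ZMod p × ZMod p × ZMod p × ZMod p :=
  (G.P q.1 - G.P q.2.1, G.Q q.2.1 - G.Q q.2.2.1, G.P q.2.2.1 - G.P q.2.2.2,
    G.Q q.2.2.2 - G.Q q.1)

def U4 : Finset (ZMod p × ZMod p × ZMod p × ZMod p) := G.U ×ˢ G.U ×ˢ G.U ×ˢ G.U

theorem mem_U4 {q : ZMod p × ZMod p × ZMod p × ZMod p} :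
    q ∈ G.U4 ↔ q.1 ∈ G.U ∧ q.2.1 ∈ G.U ∧ q.2.2.1 ∈ G.U ∧ q.2.2.2 ∈ G.U := by
  simp [U4]

theorem card_A_eq_nonsingular_le (c : ZMod p × ZMod p × ZMod p × ZMod p) :
    (G.U4.filter fun q => G.A q = c ∧ G.J q ≠ 0).card ≤ nonsingBound 4 (d + d) ^ 4 := by
  classical
  have hinj : Function.Injective fun q : ZMod p × ZMod p × ZMod p × ZMod p =>
      (![q.1, q.2.1, q.2.2.1, q.2.2.2] : Fin 4 → ZMod p) := by
    rintro ⟨q1, q2, q3, q4⟩ ⟨r1, r2, r3, r4⟩ h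
    have h0 := congrFun h 0
    have h1 := congrFun h 1
    have h2 := congrFun h 2
    have h3 := congrFun h 3
    simp at h0 h1 h2 h3
    simp [h0, h1, h2, h3]
  rw [← Finset.card_image_of_injective _ hinj]
  refine card_nonsingular_le ![diffPoly G.a G.b 0 1 c.1, diffPoly G.r G.s 1 2 c.2.1,
    diffPoly G.a G.b 2 3 c.2.2.1, diffPoly G.r G.s 3 0 c.2.2.2] ?_ _ ?_
  · intro i k
    fin_cases i
    exacts [degreeOf_diffPoly_le G.ha G.hb _ _ _ _, degreeOf_diffPoly_le G.hr G.hs _ _ _ _,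
      degreeOf_diffPoly_le G.ha G.hb _ _ _ _, degreeOf_diffPoly_le G.hr G.hs _ _ _ _]
  · intro ζ hζ
    obtain ⟨⟨q1, q2, q3, q4⟩, hq, rfl⟩ := Finset.mem_image.1 hζ
    obtain ⟨hqU, hA, hJ⟩ := Finset.mem_filter.1 hq
    obtain ⟨h1, h2, h3, h4⟩ := G.mem_U4.1 hqU
    simp only at h1 h2 h3 h4
    obtain ⟨c1, c2, c3, c4⟩ := c
    simp only [A, P, Q, Prod.mk.injEq] at hA
    obtain ⟨hA1, hA2, hA3, hA4⟩ := hA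
    obtain ⟨b1, s1, -, -⟩ := G.mem_U.1 h1
    obtain ⟨b2, s2, -, -⟩ := G.mem_U.1 h2
    obtain ⟨b3, s3, -, -⟩ := G.mem_U.1 h3
    obtain ⟨b4, s4, -, -⟩ := G.mem_U.1 h4
    have hJ' : G.dP q1 * G.dQ q2 * G.dP q3 * G.dQ q4 - G.dQ q1 * G.dP q2 * G.dQ q3 * G.dP q4 ≠ 0 := by
      intro h0
      apply hJ
      simp only [J, G.M_eval h1, G.M_eval h2, G.M_eval h3, G.M_eval h4, G.N_eval h1, G.N_eval h2,
        G.N_eval h3, G.N_eval h4]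
      linear_combination ((G.b.eval q1 * G.s.eval q1) * (G.b.eval q2 * G.s.eval q2) *
        (G.b.eval q3 * G.s.eval q3) * (G.b.eval q4 * G.s.eval q4)) ^ 2 * h0
    set ζ : Fin 4 → ZMod p := ![q1, q2, q3, q4] with hζd
    have e1 := fun η => diffPoly_line (u := G.a) (v := G.b) (i := 0) (j := 1) (ζ := ζ) η b1 b2 hA1
    have e2 := fun η => diffPoly_line (u := G.r) (v := G.s) (i := 1) (j := 2) (ζ := ζ) η s2 s3 hA2
    have e3 := fun η => diffPoly_line (u := G.a) (v := G.b) (i := 2) (j := 3) (ζ := ζ) η b3 b4 hA3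
    have e4 := fun η => diffPoly_line (u := G.r) (v := G.s) (i := 3) (j := 0) (ζ := ζ) η s4 s1 hA4
    refine nonsingular_of_line _ ζ ?_ ?_
    · intro η i
      fin_cases i
      exacts [(e1 η).1, (e2 η).1, (e3 η).1, (e4 η).1]
    · intro τ
      obtain ⟨x1, x2, x3, x4, f1, f2, f3, f4⟩ := exists_cyclic_solution hJ'
        (τ 0 / (G.b.eval q1 * G.b.eval q2)) (τ 1 / (G.s.eval q2 * G.s.eval q3))
        (τ 2 / (G.b.eval q3 * G.b.eval q4)) (τ 3 / (G.s.eval q4 * G.s.eval q1))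
      refine ⟨![x1, x2, x3, x4], ?_⟩
      intro i
      fin_cases i
      · refine (e1 _).2.trans ?_
        refine Eq.trans (b := G.b.eval q1 * G.b.eval q2 * (G.dP q1 * x1 - G.dP q2 * x2)) rfl ?_
        rw [f1]; simp only [Fin.zero_eta]; field_simp
      · refine (e2 _).2.trans ?_
        refine Eq.trans (b := G.s.eval q2 * G.s.eval q3 * (G.dQ q2 * x2 - G.dQ q3 * x3)) rfl ?_
        rw [f2]; simp only [Fin.mk_one]; field_simp
      · refine (e3 _).2.trans ?_
        refine Eq.trans (b := G.b.eval q3 * G.b.eval q4 * (G.dP q3 * x3 - G.dP q4 * x4)) rfl ?_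
        rw [f3]; simp only [Fin.reduceFinMk]; field_simp
      · refine (e4 _).2.trans ?_
        refine Eq.trans (b := G.s.eval q4 * G.s.eval q1 * (G.dQ q4 * x4 - G.dQ q1 * x1)) rfl ?_
        rw [f4]; simp only [Fin.reduceFinMk]; field_simp

end RedData

end

section

namespace RedData
variable {p d : ℕ} [Fact p.Prime] (G : RedData p d)

/-- Numerator of `u(y₀)/v(y₀) - u(y₁)/v(y₁) + u(y₂)/v(y₂) - c`. -/
def altPoly (u v : (ZMod p)[X]) (c : ZMod p) : MvPolynomial (Fin 3) (ZMod p) :=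
  inVar 0 u * inVar 1 v * inVar 2 v - inVar 0 v * inVar 1 u * inVar 2 v +
    inVar 0 v * inVar 1 v * inVar 2 u - MvPolynomial.C c * (inVar 0 v * inVar 1 v * inVar 2 v)

theorem degreeOf_altPoly_le {u v : (ZMod p)[X]} (hu : u.natDegree ≤ d)
    (hv : v.natDegree ≤ d) (c : ZMod p) (k : Fin 3) :
    (altPoly u v c).degreeOf k ≤ d + d + d := by
  refine degreeOf_sub_le_of_le (degreeOf_add_le_of_le (degreeOf_sub_le_of_le ?_ ?_) ?_)
    (degreeOf_C_mul_le_of_le _ ?_) <;>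
    exact degreeOf_mul_le_add (degreeOf_mul_le_add (degreeOf_inVar_le _ _ ‹_›)
      (degreeOf_inVar_le _ _ ‹_›)) (degreeOf_inVar_le _ _ ‹_›)

theorem altPoly_line {u v : (ZMod p)[X]} {c : ZMod p}
    {ζ : Fin 3 → ZMod p} (η : Fin 3 → ZMod p) (h0 : v.eval (ζ 0) ≠ 0) (h1 : v.eval (ζ 1) ≠ 0)
    (h2 : v.eval (ζ 2) ≠ 0)
    (h : u.eval (ζ 0) / v.eval (ζ 0) - u.eval (ζ 1) / v.eval (ζ 1) +
      u.eval (ζ 2) / v.eval (ζ 2) = c) :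
    (MvPolynomial.aeval (line ζ η) (altPoly u v c)).eval 0 = 0 ∧
    (derivative (MvPolynomial.aeval (line ζ η) (altPoly u v c))).eval 0 =
      v.eval (ζ 0) * v.eval (ζ 1) * v.eval (ζ 2) *
      ((derivative u * v - u * derivative v).eval (ζ 0) / v.eval (ζ 0) ^ 2 * η 0 -
       (derivative u * v - u * derivative v).eval (ζ 1) / v.eval (ζ 1) ^ 2 * η 1 +
       (derivative u * v - u * derivative v).eval (ζ 2) / v.eval (ζ 2) ^ 2 * η 2) := by
  subst h
  constructor
  · simp only [altPoly, map_sub, map_add, map_mul, aeval_inVar, MvPolynomial.aeval_C, eval_sub,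
      eval_add, eval_mul, eval_comp_line, Polynomial.algebraMap_eq, eval_C]
    field_simp
    ring
  · simp only [altPoly, map_sub, map_add, map_mul, aeval_inVar, MvPolynomial.aeval_C,
      derivative_mul, eval_add, eval_sub, eval_mul,
      eval_comp_line, eval_derivative_comp_line, Polynomial.algebraMap_eq, eval_C, derivative_C,
      eval_zero]
    field_simp
    ring

/-- The Jacobian condition as a polynomial in the last three variables. -/
def jacPoly (M N : (ZMod p)[X]) (m n : ZMod p) : MvPolynomial (Fin 3) (ZMod p) :=
  MvPolynomial.C m * (inVar 0 N * inVar 1 M * inVar 2 N) -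
    MvPolynomial.C n * (inVar 0 M * inVar 1 N * inVar 2 M)

theorem degreeOf_jacPoly_le {M N : (ZMod p)[X]} {e : ℕ} (hM : M.natDegree ≤ e)
    (hN : N.natDegree ≤ e) (m n : ZMod p) (k : Fin 3) :
    (jacPoly M N m n).degreeOf k ≤ e + e + e := by
  refine degreeOf_sub_le_of_le (degreeOf_C_mul_le_of_le _ ?_)
    (degreeOf_C_mul_le_of_le _ ?_) <;>
    exact degreeOf_mul_le_add (degreeOf_mul_le_add (degreeOf_inVar_le _ _ ‹_›)
      (degreeOf_inVar_le _ _ ‹_›)) (degreeOf_inVar_le _ _ ‹_›)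

theorem jacPoly_line {M N : (ZMod p)[X]} {m n : ZMod p}
    {ζ : Fin 3 → ZMod p} (η : Fin 3 → ZMod p)
    (hM : ∀ i, M.eval (ζ i) ≠ 0) (hN : ∀ i, N.eval (ζ i) ≠ 0)
    (h : m * (N.eval (ζ 0) * M.eval (ζ 1) * N.eval (ζ 2)) =
      n * (M.eval (ζ 0) * N.eval (ζ 1) * M.eval (ζ 2))) :
    (MvPolynomial.aeval (line ζ η) (jacPoly M N m n)).eval 0 = 0 ∧
    (derivative (MvPolynomial.aeval (line ζ η) (jacPoly M N m n))).eval 0 =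
      -(n * (M.eval (ζ 0) * N.eval (ζ 1) * M.eval (ζ 2))) *
      ((derivative M * N - M * derivative N).eval (ζ 0) / (M.eval (ζ 0) * N.eval (ζ 0)) * η 0 -
       (derivative M * N - M * derivative N).eval (ζ 1) / (M.eval (ζ 1) * N.eval (ζ 1)) * η 1 +
       (derivative M * N - M * derivative N).eval (ζ 2) / (M.eval (ζ 2) * N.eval (ζ 2)) * η 2) := by
  have hM0 := hM 0
  have hM1 := hM 1
  have hM2 := hM 2
  have hN0 := hN 0
  have hN1 := hN 1
  have hN2 := hN 2
  have hm : m = n * (M.eval (ζ 0) * N.eval (ζ 1) * M.eval (ζ 2)) /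
      (N.eval (ζ 0) * M.eval (ζ 1) * N.eval (ζ 2)) := by
    field_simp; linear_combination h
  subst hm
  constructor
  · simp only [jacPoly, map_sub, map_mul, aeval_inVar, MvPolynomial.aeval_C, eval_sub,
      eval_mul, eval_comp_line, Polynomial.algebraMap_eq, eval_C]
    field_simp
    ring
  · simp only [jacPoly, map_sub, map_mul, aeval_inVar, MvPolynomial.aeval_C,
      derivative_mul, eval_add, eval_sub, eval_mul,
      eval_comp_line, eval_derivative_comp_line, Polynomial.algebraMap_eq, eval_C, derivative_C,
      eval_zero]
    field_simp
    ring

/-- The matrix with columns `vec(z₀), vec(z₁), vec(z₂)`. -/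
def vecMatrix (z : ZMod p × ZMod p × ZMod p) : Matrix (Fin 3) (Fin 3) (ZMod p) :=
  Matrix.of fun i j => (G.vec i).eval ((![z.1, z.2.1, z.2.2] : Fin 3 → ZMod p) j)

theorem exists_vecMatrix_solution {z : ZMod p × ZMod p × ZMod p} (h1 : z.1 ∈ G.U)
    (h2 : z.2.1 ∈ G.U) (h3 : z.2.2 ∈ G.U) (h : (G.vecMatrix z).det ≠ 0) (t0 t1 t2 : ZMod p) :
    ∃ x y w, G.dP z.1 * x - G.dP z.2.1 * y + G.dP z.2.2 * w = t0 ∧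
      G.dQ z.1 * x - G.dQ z.2.1 * y + G.dQ z.2.2 * w = t1 ∧
      (derivative G.M * G.N - G.M * derivative G.N).eval z.1 / (G.M.eval z.1 * G.N.eval z.1) * x -
      (derivative G.M * G.N - G.M * derivative G.N).eval z.2.1 /
        (G.M.eval z.2.1 * G.N.eval z.2.1) * y +
      (derivative G.M * G.N - G.M * derivative G.N).eval z.2.2 /
        (G.M.eval z.2.2 * G.N.eval z.2.2) * w = t2 := by
  have hs : Function.Surjective (G.vecMatrix z).mulVec :=
    Matrix.mulVec_surjective_iff_isUnit.2 ((Matrix.isUnit_iff_isUnit_det _).2 (isUnit_iff_ne_zero.2 h))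
  obtain ⟨v, hv⟩ := hs ![t0, t1, t2]
  obtain ⟨z1, z2, z3⟩ := z
  simp only at h1 h2 h3 ⊢
  have key : ∀ y ∈ G.U, ∀ x : ZMod p,
      (G.vec 0).eval y * x = G.dP y * (G.M.eval y * G.N.eval y * (G.b.eval y * G.s.eval y) ^ 2 * x) ∧
      (G.vec 1).eval y * x = G.dQ y * (G.M.eval y * G.N.eval y * (G.b.eval y * G.s.eval y) ^ 2 * x) ∧
      (G.vec 2).eval y * x = (derivative G.M * G.N - G.M * derivative G.N).eval y /
        (G.M.eval y * G.N.eval y) *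
        (G.M.eval y * G.N.eval y * (G.b.eval y * G.s.eval y) ^ 2 * x) := by
    intro y hy x
    have hM := G.M_eval hy
    have hN := G.N_eval hy
    obtain ⟨hb, hs, hM0, hN0⟩ := G.mem_U.1 hy
    refine ⟨?_, ?_, ?_⟩
    · simp only [vec, Matrix.cons_val_zero, eval_mul, eval_pow]
      linear_combination G.M.eval y * G.N.eval y * x * hM
    · simp only [vec, Matrix.cons_val_one, Matrix.cons_val_zero, eval_mul, eval_pow]
      linear_combination G.M.eval y * G.N.eval y * x * hN
    · simp only [vec, Matrix.cons_val, eval_mul, eval_pow]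
      field_simp
  have e0 := congrFun hv 0
  have e1 := congrFun hv 1
  have e2 := congrFun hv 2
  simp only [Matrix.mulVec, dotProduct, Fin.sum_univ_three, vecMatrix, Matrix.of_apply,
    Matrix.cons_val_zero, Matrix.cons_val_one, Matrix.cons_val] at e0 e1 e2
  rw [(key z1 h1 _).1, (key z2 h2 _).1, (key z3 h3 _).1] at e0
  rw [(key z1 h1 _).2.1, (key z2 h2 _).2.1, (key z3 h3 _).2.1] at e1
  rw [(key z1 h1 _).2.2, (key z2 h2 _).2.2, (key z3 h3 _).2.2] at e2
  refine ⟨G.M.eval z1 * G.N.eval z1 * (G.b.eval z1 * G.s.eval z1) ^ 2 * v 0,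
    -(G.M.eval z2 * G.N.eval z2 * (G.b.eval z2 * G.s.eval z2) ^ 2 * v 1),
    G.M.eval z3 * G.N.eval z3 * (G.b.eval z3 * G.s.eval z3) ^ 2 * v 2, ?_, ?_, ?_⟩
  · rw [← e0]; ring
  · rw [← e1]; ring
  · rw [← e2]; ring

/-- The alternating sums of `P` and `Q`. -/
def label (q : ZMod p × ZMod p × ZMod p × ZMod p) : ZMod p × ZMod p :=
  (G.P q.1 - G.P q.2.1 + G.P q.2.2.1 - G.P q.2.2.2,
    G.Q q.1 - G.Q q.2.1 + G.Q q.2.2.1 - G.Q q.2.2.2)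

theorem label_eq_of_A_eq {q r : ZMod p × ZMod p × ZMod p × ZMod p} (h : G.A q = G.A r) :
    G.label q = G.label r := by
  simp only [A, Prod.mk.injEq] at h
  obtain ⟨h1, h2, h3, h4⟩ := h
  simp only [label, Prod.mk.injEq]
  exact ⟨by linear_combination h1 + h3, by linear_combination -h2 - h4⟩

theorem card_label_nonsingular_le {z : ZMod p} (hz : z ∈ G.U) (ℓ : ZMod p × ZMod p) :
    ((G.U ×ˢ G.U ×ˢ G.U).filter fun q => G.label (z, q) = ℓ ∧ G.J (z, q) = 0 ∧
      (G.vecMatrix q).det ≠ 0).card ≤ nonsingBound 3 (12 * d) ^ 3 := by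
  classical
  have hinj : Function.Injective fun q : ZMod p × ZMod p × ZMod p =>
      (![q.1, q.2.1, q.2.2] : Fin 3 → ZMod p) := by
    rintro ⟨q1, q2, q3⟩ ⟨r1, r2, r3⟩ h
    have h0 := congrFun h 0
    have h1 := congrFun h 1
    have h2 := congrFun h 2
    simp at h0 h1 h2
    simp [h0, h1, h2]
  rw [← Finset.card_image_of_injective _ hinj]
  refine card_nonsingular_le ![altPoly G.a G.b (G.P z - ℓ.1), altPoly G.r G.s (G.Q z - ℓ.2),
    jacPoly G.M G.N (G.M.eval z) (G.N.eval z)] ?_ _ ?_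
  · intro i k
    fin_cases i
    exacts [(degreeOf_altPoly_le G.ha G.hb _ _).trans (by omega),
      (degreeOf_altPoly_le G.hr G.hs _ _).trans (by omega),
      (degreeOf_jacPoly_le G.natDegree_M_le G.natDegree_N_le _ _ _).trans (by omega)]
  · intro ζ hζ
    obtain ⟨⟨q1, q2, q3⟩, hq, rfl⟩ := Finset.mem_image.1 hζ
    obtain ⟨hqU, hl, hJ, hdet⟩ := Finset.mem_filter.1 hq
    simp only [Finset.mem_product] at hqU
    obtain ⟨h1, h2, h3⟩ := hqU
    obtain ⟨b1, s1, M1, N1⟩ := G.mem_U.1 h1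
    obtain ⟨b2, s2, M2, N2⟩ := G.mem_U.1 h2
    obtain ⟨b3, s3, M3, N3⟩ := G.mem_U.1 h3
    obtain ⟨-, -, Mz, Nz⟩ := G.mem_U.1 hz
    set ζ : Fin 3 → ZMod p := ![q1, q2, q3] with hζd
    have e1 := fun η => altPoly_line (u := G.a) (v := G.b) (c := G.P z - ℓ.1) (ζ := ζ) η b1 b2 b3 (by
      rw [← hl]; simp only [label, P, hζd, Matrix.cons_val_zero, Matrix.cons_val_one, Matrix.cons_val]; ring)
    have e2 := fun η => altPoly_line (u := G.r) (v := G.s) (c := G.Q z - ℓ.2) (ζ := ζ) η s1 s2 s3 (by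
      rw [← hl]; simp only [label, Q, hζd, Matrix.cons_val_zero, Matrix.cons_val_one, Matrix.cons_val]; ring)
    have e3 := fun η => jacPoly_line (M := G.M) (N := G.N) (m := G.M.eval z) (n := G.N.eval z)
      (ζ := ζ) η (by intro i; fin_cases i; exacts [M1, M2, M3])
      (by intro i; fin_cases i; exacts [N1, N2, N3]) (by
        simp only [J] at hJ
        simp only [hζd, Matrix.cons_val_zero, Matrix.cons_val_one, Matrix.cons_val]
        linear_combination hJ)
    refine nonsingular_of_line _ ζ ?_ ?_
    · intro η i
      fin_cases i
      exacts [(e1 η).1, (e2 η).1, (e3 η).1]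
    · intro τ
      obtain ⟨x1, x2, x3, f1, f2, f3⟩ := G.exists_vecMatrix_solution h1 h2 h3 hdet
        (τ 0 / (G.b.eval q1 * G.b.eval q2 * G.b.eval q3))
        (τ 1 / (G.s.eval q1 * G.s.eval q2 * G.s.eval q3))
        (τ 2 / -(G.N.eval z * (G.M.eval q1 * G.N.eval q2 * G.M.eval q3)))
      simp only at f1 f2 f3
      refine ⟨![x1, x2, x3], ?_⟩
      intro i
      fin_cases i
      · refine (e1 _).2.trans ?_
        refine Eq.trans (b := G.b.eval q1 * G.b.eval q2 * G.b.eval q3 *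
          (G.dP q1 * x1 - G.dP q2 * x2 + G.dP q3 * x3)) rfl ?_
        rw [f1]; simp only [Fin.zero_eta]; field_simp
      · refine (e2 _).2.trans ?_
        refine Eq.trans (b := G.s.eval q1 * G.s.eval q2 * G.s.eval q3 *
          (G.dQ q1 * x1 - G.dQ q2 * x2 + G.dQ q3 * x3)) rfl ?_
        rw [f2]; simp only [Fin.mk_one]; field_simp
      · refine (e3 _).2.trans ?_
        refine Eq.trans (congrArg (fun t =>
          -(G.N.eval z * (G.M.eval q1 * G.N.eval q2 * G.M.eval q3)) * t) f3) ?_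
        simp only [Fin.reduceFinMk]; field_simp

end RedData

end

section

theorem card_le_of_fibers {α β : Type*} [DecidableEq α] (S : Finset (α × β)) (T : Finset α)
    (R : α → Finset β) (k : ℕ) (h : ∀ x ∈ S, x.1 ∈ T ∧ x.2 ∈ R x.1)
    (hR : ∀ a ∈ T, (R a).card ≤ k) : S.card ≤ T.card * k := by
  rw [mul_comm]
  refine (Finset.card_le_mul_card_image_of_maps_to (f := Prod.fst) (t := T)
    (fun x hx => (h x hx).1) k fun a ha => ?_)
  refine le_trans (Finset.card_le_card_of_injOn Prod.snd (t := R a) ?_ ?_) (hR a ha)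
  · intro x hx
    have hx := Finset.mem_filter.1 hx
    exact hx.2 ▸ (h x hx.1).2
  · rintro ⟨x, y⟩ hx ⟨x', y'⟩ hx' hxy
    have hx := (Finset.mem_filter.1 hx).2
    have hx' := (Finset.mem_filter.1 hx').2
    simp only at hx hx' hxy
    rw [hx, hx', hxy]

theorem card_le_of_fibers_right {α β : Type*} [DecidableEq β] (S : Finset (α × β)) (T : Finset β)
    (R : β → Finset α) (k : ℕ) (h : ∀ x ∈ S, x.2 ∈ T ∧ x.1 ∈ R x.2)
    (hR : ∀ a ∈ T, (R a).card ≤ k) : S.card ≤ T.card * k := by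
  rw [mul_comm]
  refine (Finset.card_le_mul_card_image_of_maps_to (f := Prod.snd) (t := T)
    (fun x hx => (h x hx).1) k fun a ha => ?_)
  refine le_trans (Finset.card_le_card_of_injOn Prod.fst (t := R a) ?_ ?_) (hR a ha)
  · intro x hx
    have hx := Finset.mem_filter.1 hx
    exact hx.2 ▸ (h x hx.1).2
  · rintro ⟨x, y⟩ hx ⟨x', y'⟩ hx' hxy
    have hx := (Finset.mem_filter.1 hx).2
    have hx' := (Finset.mem_filter.1 hx').2
    simp only at hx hx' hxy
    rw [hx, hx', hxy]

theorem card_filter_eval_eq_zero_le {F : Type*} [Field F] [Fintype F] [DecidableEq F] {f : F[X]}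
    {n : ℕ} (hf : f ≠ 0) (hn : f.natDegree ≤ n) :
    (Finset.univ.filter fun y => f.eval y = 0).card ≤ n := by
  refine le_trans (Finset.card_le_card (t := f.roots.toFinset) fun y hy => ?_)
    ((Multiset.toFinset_card_le _).trans ((card_roots' f).trans hn))
  rw [Multiset.mem_toFinset, mem_roots hf]
  exact (Finset.mem_filter.1 hy).2

namespace RedData
variable {p d : ℕ} [Fact p.Prime] (G : RedData p d)

theorem card_U_le : G.U.card ≤ p := (Finset.card_le_univ _).trans_eq (ZMod.card p)

theorem card_U_compl_le : G.Uᶜ.card ≤ 10 * d := by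
  have h : G.Uᶜ ⊆ ((Finset.univ.filter fun y => G.b.eval y = 0) ∪
      (Finset.univ.filter fun y => G.s.eval y = 0)) ∪
      ((Finset.univ.filter fun y => G.M.eval y = 0) ∪
      (Finset.univ.filter fun y => G.N.eval y = 0)) := by
    intro y hy
    rw [Finset.mem_compl, G.mem_U] at hy
    simp only [Finset.mem_union, Finset.mem_filter, Finset.mem_univ, true_and]
    tauto
  have h1 := card_filter_eval_eq_zero_le G.hb0 G.hb
  have h2 := card_filter_eval_eq_zero_le G.hs0 G.hs
  have h3 := card_filter_eval_eq_zero_le G.M_ne_zero G.natDegree_M_le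
  have h4 := card_filter_eval_eq_zero_le G.N_ne_zero G.natDegree_N_le
  refine (Finset.card_le_card h).trans ((Finset.card_union_le _ _).trans ?_)
  have h5 := Finset.card_union_le (Finset.univ.filter fun y => G.b.eval y = 0)
      (Finset.univ.filter fun y => G.s.eval y = 0)
  have h6 := Finset.card_union_le (Finset.univ.filter fun y => G.M.eval y = 0)
      (Finset.univ.filter fun y => G.N.eval y = 0)
  omega

theorem card_P_eq_le (c : ZMod p) : (G.U.filter fun y => G.P y = c).card ≤ d := by
  have h0 : G.a - C c * G.b ≠ 0 := by
    intro h
    have := G.indep 1 0 (-c) (by rw [C_neg, C_0, C_1]; linear_combination G.s * h)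
    exact one_ne_zero this.1
  refine le_trans (Finset.card_le_card fun y hy => ?_) (card_filter_eval_eq_zero_le h0
    ((natDegree_sub_le _ _).trans (max_le G.ha ((natDegree_C_mul_le _ _).trans G.hb))))
  obtain ⟨hy, hc⟩ := Finset.mem_filter.1 hy
  have := (G.mem_U.1 hy).1
  rw [P, div_eq_iff this] at hc
  simp [hc]

theorem card_Q_eq_le (c : ZMod p) : (G.U.filter fun y => G.Q y = c).card ≤ d := by
  have h0 : G.r - C c * G.s ≠ 0 := by
    intro h
    have := G.indep 0 1 (-c) (by rw [C_neg, C_0, C_1]; linear_combination G.b * h)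
    exact one_ne_zero this.2
  refine le_trans (Finset.card_le_card fun y hy => ?_) (card_filter_eval_eq_zero_le h0
    ((natDegree_sub_le _ _).trans (max_le G.hr ((natDegree_C_mul_le _ _).trans G.hs))))
  obtain ⟨hy, hc⟩ := Finset.mem_filter.1 hy
  have := (G.mem_U.1 hy).2.1
  rw [Q, div_eq_iff this] at hc
  simp [hc]

theorem card_A_eq_le (c : ZMod p × ZMod p × ZMod p × ZMod p) :
    (G.U4.filter fun q => G.A q = c).card ≤ p * (d * (d * d)) := by
  refine (card_le_of_fibers _ G.U (fun y1 => (G.U ×ˢ G.U ×ˢ G.U).filter fun q =>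
    G.A (y1, q) = c) (d * (d * d)) ?_ ?_).trans (Nat.mul_le_mul_right _ G.card_U_le)
  · rintro ⟨y1, q⟩ hq
    obtain ⟨h1, h2⟩ := Finset.mem_filter.1 hq
    have h1 := Finset.mem_product.1 h1
    exact ⟨h1.1, Finset.mem_filter.2 ⟨h1.2, h2⟩⟩
  intro y1 _
  refine (card_le_of_fibers _ (G.U.filter fun y => G.P y = G.P y1 - c.1)
    (fun y2 => (G.U ×ˢ G.U).filter fun q => G.A (y1, y2, q) = c) (d * d) ?_ ?_).trans
      (Nat.mul_le_mul_right _ (G.card_P_eq_le _))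
  · rintro ⟨y2, q⟩ hq
    obtain ⟨h1, h2⟩ := Finset.mem_filter.1 hq
    have h1 := Finset.mem_product.1 h1
    refine ⟨Finset.mem_filter.2 ⟨h1.1, ?_⟩, Finset.mem_filter.2 ⟨h1.2, h2⟩⟩
    rw [← h2]; simp [A]
  intro y2 _
  refine (card_le_of_fibers _ (G.U.filter fun y => G.Q y = G.Q y2 - c.2.1)
    (fun y3 => G.U.filter fun y => G.P y = G.P y3 - c.2.2.1) d ?_ fun _ _ => G.card_P_eq_le _).trans
      (Nat.mul_le_mul_right _ (G.card_Q_eq_le _))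
  rintro ⟨y3, y4⟩ hq
  obtain ⟨h1, h2⟩ := Finset.mem_filter.1 hq
  have h1 := Finset.mem_product.1 h1
  refine ⟨Finset.mem_filter.2 ⟨h1.1, ?_⟩, Finset.mem_filter.2 ⟨h1.2, ?_⟩⟩ <;>
  · rw [← h2]; simp [A]

theorem card_diff_nonsingular_le (c : ZMod p × ZMod p) :
    ((G.U ×ˢ G.U).filter fun q => (G.P q.1 - G.P q.2, G.Q q.1 - G.Q q.2) = c ∧
      G.M.eval q.1 * G.N.eval q.2 - G.N.eval q.1 * G.M.eval q.2 ≠ 0).card ≤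
      nonsingBound 2 (d + d) ^ 2 := by
  classical
  have hinj : Function.Injective fun q : ZMod p × ZMod p =>
      (![q.1, q.2] : Fin 2 → ZMod p) := by
    rintro ⟨q1, q2⟩ ⟨r1, r2⟩ h
    have h0 := congrFun h 0
    have h1 := congrFun h 1
    simp at h0 h1
    simp [h0, h1]
  rw [← Finset.card_image_of_injective _ hinj]
  refine card_nonsingular_le ![diffPoly G.a G.b 0 1 c.1, diffPoly G.r G.s 0 1 c.2] ?_ _ ?_
  · intro i k
    fin_cases i
    exacts [degreeOf_diffPoly_le G.ha G.hb _ _ _ _, degreeOf_diffPoly_le G.hr G.hs _ _ _ _]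
  · intro ζ hζ
    obtain ⟨⟨q1, q2⟩, hq, rfl⟩ := Finset.mem_image.1 hζ
    obtain ⟨hqU, hA, hJ⟩ := Finset.mem_filter.1 hq
    obtain ⟨h1, h2⟩ := Finset.mem_product.1 hqU
    simp only at h1 h2
    obtain ⟨c1, c2⟩ := c
    simp only [P, Q, Prod.mk.injEq] at hA
    obtain ⟨hA1, hA2⟩ := hA
    obtain ⟨b1, s1, -, -⟩ := G.mem_U.1 h1
    obtain ⟨b2, s2, -, -⟩ := G.mem_U.1 h2
    have hJ' : G.dQ q1 * G.dP q2 - G.dP q1 * G.dQ q2 ≠ 0 := by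
      intro h0
      apply hJ
      simp only [G.M_eval h1, G.M_eval h2, G.N_eval h1, G.N_eval h2]
      linear_combination -((G.b.eval q1 * G.s.eval q1) * (G.b.eval q2 * G.s.eval q2)) ^ 2 * h0
    set ζ : Fin 2 → ZMod p := ![q1, q2] with hζd
    have e1 := fun η => diffPoly_line (u := G.a) (v := G.b) (i := 0) (j := 1) (ζ := ζ) η b1 b2 hA1
    have e2 := fun η => diffPoly_line (u := G.r) (v := G.s) (i := 0) (j := 1) (ζ := ζ) η s1 s2 hA2
    refine nonsingular_of_line _ ζ ?_ ?_
    · intro η i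
      fin_cases i
      exacts [(e1 η).1, (e2 η).1]
    · intro τ
      set t0 := τ 0 / (G.b.eval q1 * G.b.eval q2) with ht0
      set t1 := τ 1 / (G.s.eval q1 * G.s.eval q2) with ht1
      set D := G.dQ q1 * G.dP q2 - G.dP q1 * G.dQ q2 with hD
      have f1 : G.dP q1 * ((t1 * G.dP q2 - t0 * G.dQ q2) / D) -
          G.dP q2 * ((t1 * G.dP q1 - t0 * G.dQ q1) / D) = t0 := by
        field_simp; rw [hD]; ring
      have f2 : G.dQ q1 * ((t1 * G.dP q2 - t0 * G.dQ q2) / D) -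
          G.dQ q2 * ((t1 * G.dP q1 - t0 * G.dQ q1) / D) = t1 := by
        field_simp; rw [hD]; ring
      refine ⟨![(t1 * G.dP q2 - t0 * G.dQ q2) / D, (t1 * G.dP q1 - t0 * G.dQ q1) / D], ?_⟩
      intro i
      fin_cases i
      · refine (e1 _).2.trans ?_
        refine Eq.trans (congrArg (fun t => G.b.eval q1 * G.b.eval q2 * t) f1) ?_
        simp only [Fin.zero_eta, ht0]; field_simp
      · refine (e2 _).2.trans ?_
        refine Eq.trans (congrArg (fun t => G.s.eval q1 * G.s.eval q2 * t) f2) ?_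
        simp only [Fin.mk_one, ht1]; field_simp

theorem card_comb_eq_zero_le {x y : ZMod p} (h : x ≠ 0 ∨ y ≠ 0) :
    (Finset.univ.filter fun z => x * G.M.eval z + y * G.N.eval z = 0).card ≤ 4 * d := by
  have h0 : C x * G.M + C y * G.N ≠ 0 := by
    intro h0
    have := G.M_N_indep _ _ h0
    tauto
  have := card_filter_eval_eq_zero_le h0 ((natDegree_add_le _ _).trans
    (max_le ((natDegree_C_mul_le _ _).trans G.natDegree_M_le)
      ((natDegree_C_mul_le _ _).trans G.natDegree_N_le)))
  simpa using this

/-- Pairs with parallel tangents. -/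
def parallel : Finset (ZMod p × ZMod p) := (G.U ×ˢ G.U).filter fun q =>
  G.M.eval q.1 * G.N.eval q.2 - G.N.eval q.1 * G.M.eval q.2 = 0

theorem card_parallel_le : G.parallel.card ≤ p * (4 * d) := by
  refine (card_le_of_fibers _ G.U (fun x => Finset.univ.filter fun z =>
    -G.N.eval x * G.M.eval z + G.M.eval x * G.N.eval z = 0) (4 * d) ?_ ?_).trans
      (Nat.mul_le_mul_right _ G.card_U_le)
  · rintro ⟨x, y⟩ h
    obtain ⟨h1, h2⟩ := Finset.mem_filter.1 h
    refine ⟨(Finset.mem_product.1 h1).1, Finset.mem_filter.2 ⟨Finset.mem_univ _, ?_⟩⟩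
    linear_combination h2
  · intro x hx
    exact G.card_comb_eq_zero_le (Or.inr (G.mem_U.1 hx).2.2.1)

/-- The number of representations of `ℓ`, up to a power of `p`. -/
def labelBound (d : ℕ) : ℕ := 2 * nonsingBound 2 (d + d) ^ 2 + 16 * d ^ 2

theorem card_label_eq_le (ℓ : ZMod p × ZMod p) :
    (G.U4.filter fun q => G.label q = ℓ).card ≤ labelBound d * p ^ 2 := by
  classical
  let e : (ZMod p × ZMod p × ZMod p × ZMod p) ↪ (ZMod p × ZMod p) × (ZMod p × ZMod p) :=
    ⟨fun q => ((q.1, q.2.1), (q.2.2.1, q.2.2.2)), by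
      rintro ⟨a, b, c, d⟩ ⟨a', b', c', d'⟩ h
      simp only [Prod.mk.injEq] at h ⊢
      tauto⟩
  rw [← Finset.card_map e]
  set S := (G.U4.filter fun q => G.label q = ℓ).map e with hS
  have hS' : ∀ x ∈ S, (x.1 ∈ G.U ×ˢ G.U ∧ x.2 ∈ G.U ×ˢ G.U) ∧
      (G.P x.1.1 - G.P x.1.2 + G.P x.2.1 - G.P x.2.2 = ℓ.1 ∧
      G.Q x.1.1 - G.Q x.1.2 + G.Q x.2.1 - G.Q x.2.2 = ℓ.2) := by
    intro x hx
    obtain ⟨q, hq, rfl⟩ := Finset.mem_map.1 hx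
    obtain ⟨h1, h2⟩ := Finset.mem_filter.1 hq
    have h1 := G.mem_U4.1 h1
    simp only [Finset.mem_product]
    refine ⟨⟨⟨h1.1, h1.2.1⟩, h1.2.2.1, h1.2.2.2⟩, ?_⟩
    rw [← h2]
    exact ⟨rfl, rfl⟩
  have hUU : (G.U ×ˢ G.U).card ≤ p ^ 2 := by
    rw [Finset.card_product, pow_two]
    exact Nat.mul_le_mul G.card_U_le G.card_U_le
  have h1 : (S.filter fun x => x.2 ∉ G.parallel).card ≤ p ^ 2 * nonsingBound 2 (d + d) ^ 2 := by
    refine (card_le_of_fibers _ (G.U ×ˢ G.U) (fun x => (G.U ×ˢ G.U).filter fun q =>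
      (G.P q.1 - G.P q.2, G.Q q.1 - G.Q q.2) = (ℓ.1 - (G.P x.1 - G.P x.2), ℓ.2 - (G.Q x.1 - G.Q x.2)) ∧
      G.M.eval q.1 * G.N.eval q.2 - G.N.eval q.1 * G.M.eval q.2 ≠ 0) _ ?_
      fun x _ => G.card_diff_nonsingular_le _).trans (Nat.mul_le_mul_right _ hUU)
    intro x hx
    obtain ⟨hx, hp⟩ := Finset.mem_filter.1 hx
    obtain ⟨⟨h1, h2⟩, h3, h4⟩ := hS' x hx
    refine ⟨h1, Finset.mem_filter.2 ⟨h2, ?_, fun h => hp (Finset.mem_filter.2 ⟨h2, h⟩)⟩⟩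
    rw [← h3, ← h4]
    refine Prod.ext ?_ ?_ <;> (simp only; ring)
  have h2 : (S.filter fun x => x.1 ∉ G.parallel).card ≤ p ^ 2 * nonsingBound 2 (d + d) ^ 2 := by
    refine (card_le_of_fibers_right _ (G.U ×ˢ G.U) (fun x => (G.U ×ˢ G.U).filter fun q =>
      (G.P q.1 - G.P q.2, G.Q q.1 - G.Q q.2) = (ℓ.1 - (G.P x.1 - G.P x.2), ℓ.2 - (G.Q x.1 - G.Q x.2)) ∧
      G.M.eval q.1 * G.N.eval q.2 - G.N.eval q.1 * G.M.eval q.2 ≠ 0) _ ?_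
      fun x _ => G.card_diff_nonsingular_le _).trans (Nat.mul_le_mul_right _ hUU)
    intro x hx
    obtain ⟨hx, hp⟩ := Finset.mem_filter.1 hx
    obtain ⟨⟨h1, h2⟩, h3, h4⟩ := hS' x hx
    refine ⟨h2, Finset.mem_filter.2 ⟨h1, ?_, fun h => hp (Finset.mem_filter.2 ⟨h1, h⟩)⟩⟩
    rw [← h3, ← h4]
    refine Prod.ext ?_ ?_ <;> (simp only; ring)
  have h3 : S ⊆ ((S.filter fun x => x.2 ∉ G.parallel) ∪ (S.filter fun x => x.1 ∉ G.parallel)) ∪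
      G.parallel ×ˢ G.parallel := by
    intro x hx
    simp only [Finset.mem_union, Finset.mem_filter, Finset.mem_product]
    tauto
  refine (Finset.card_le_card h3).trans ((Finset.card_union_le _ _).trans ?_)
  have h4 := Finset.card_union_le (S.filter fun x => x.2 ∉ G.parallel)
    (S.filter fun x => x.1 ∉ G.parallel)
  have h5 : (G.parallel ×ˢ G.parallel).card ≤ (p * (4 * d)) * (p * (4 * d)) := by
    rw [Finset.card_product]
    exact Nat.mul_le_mul G.card_parallel_le G.card_parallel_le
  calc _ ≤ (p ^ 2 * nonsingBound 2 (d + d) ^ 2 + p ^ 2 * nonsingBound 2 (d + d) ^ 2) +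
      (p * (4 * d)) * (p * (4 * d)) := by omega
    _ = _ := by rw [labelBound]; ring

theorem card_vec_comb_eq_zero_le {w : Fin 3 → ZMod p} (h : w ≠ 0) :
    (Finset.univ.filter fun z => ∑ i, w i * (G.vec i).eval z = 0).card ≤ 12 * d := by
  have h0 : ∑ i, C (w i) * G.vec i ≠ 0 := fun h0 => h (G.vec_indep w h0)
  have := card_filter_eval_eq_zero_le h0 (natDegree_sum_le_of_forall_le (n := 12 * d) _ _
    fun i _ => (natDegree_C_mul_le _ _).trans (G.natDegree_vec_le i))
  simpa [eval_finsetSum] using this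

/-- The cofactors of the last column of `vecMatrix`. -/
def cof (x y : ZMod p) : Fin 3 → ZMod p :=
  ![(G.vec 1).eval x * (G.vec 2).eval y - (G.vec 2).eval x * (G.vec 1).eval y,
    (G.vec 2).eval x * (G.vec 0).eval y - (G.vec 0).eval x * (G.vec 2).eval y,
    (G.vec 0).eval x * (G.vec 1).eval y - (G.vec 1).eval x * (G.vec 0).eval y]

theorem det_vecMatrix (x y z : ZMod p) :
    (G.vecMatrix (x, y, z)).det = ∑ i, G.cof x y i * (G.vec i).eval z := by
  rw [Matrix.det_fin_three]
  simp only [Fin.sum_univ_three, vecMatrix, cof, Matrix.of_apply,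
    Matrix.cons_val_zero, Matrix.cons_val_one, Matrix.cons_val]
  ring

theorem card_det_eq_zero_le :
    ((G.U ×ˢ G.U ×ˢ G.U).filter fun q => (G.vecMatrix q).det = 0).card ≤ 24 * d * p ^ 2 := by
  classical
  set S := (G.U ×ˢ G.U ×ˢ G.U).filter fun q => (G.vecMatrix q).det = 0
  have hS : ∀ q ∈ S, (q.1 ∈ G.U ∧ q.2.1 ∈ G.U ∧ q.2.2 ∈ G.U) ∧
      ∑ i, G.cof q.1 q.2.1 i * (G.vec i).eval q.2.2 = 0 := by
    rintro ⟨x, y, z⟩ h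
    obtain ⟨h1, h2⟩ := Finset.mem_filter.1 h
    rw [det_vecMatrix] at h2
    simpa [h2] using h1
  have hUU : (G.U ×ˢ G.U).card ≤ p * p := by
    rw [Finset.card_product]
    exact Nat.mul_le_mul G.card_U_le G.card_U_le
  have h1 : (S.filter fun q => G.cof q.1 q.2.1 = 0).card ≤ p * (12 * d * p) := by
    refine (card_le_of_fibers _ G.U (fun x => ((Finset.univ.filter fun y =>
      G.cof x y = 0) ×ˢ G.U)) (12 * d * p) ?_ ?_).trans
      (Nat.mul_le_mul_right _ G.card_U_le)
    · intro q hq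
      obtain ⟨hq, h0⟩ := Finset.mem_filter.1 hq
      obtain ⟨⟨a1, a2, a3⟩, h2⟩ := hS q hq
      exact ⟨a1, Finset.mem_product.2 ⟨Finset.mem_filter.2 ⟨Finset.mem_univ _, h0⟩, a3⟩⟩
    · intro x hx
      rw [Finset.card_product]
      refine Nat.mul_le_mul ?_ G.card_U_le
      have hw : (![-(G.vec 1).eval x, (G.vec 0).eval x, 0] : Fin 3 → ZMod p) ≠ 0 := by
        intro h
        have h1 := congrFun h 1
        simp only [Matrix.cons_val_one, Matrix.cons_val_zero, vec, eval_mul, eval_pow,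
          Pi.zero_apply] at h1
        have := G.mem_U.1 hx
        exact mul_ne_zero (pow_ne_zero _ this.2.2.1) this.2.2.2 h1
      refine le_trans (Finset.card_le_card fun y hy => ?_) (G.card_vec_comb_eq_zero_le hw)
      have h2 := congrFun (Finset.mem_filter.1 hy).2 2
      refine Finset.mem_filter.2 ⟨Finset.mem_univ _, ?_⟩
      simp only [cof, Matrix.cons_val, Pi.zero_apply] at h2
      simp only [Fin.sum_univ_three, Matrix.cons_val_zero, Matrix.cons_val_one, Matrix.cons_val]
      linear_combination h2
  have h2 : (S.filter fun q => G.cof q.1 q.2.1 ≠ 0).card ≤ p * (p * (12 * d)) := by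
    refine (card_le_of_fibers _ G.U (fun x => ((G.U ×ˢ G.U).filter fun q =>
      G.cof x q.1 ≠ 0 ∧ ∑ i, G.cof x q.1 i * (G.vec i).eval q.2 = 0)) (p * (12 * d)) ?_ ?_).trans
      (Nat.mul_le_mul_right _ G.card_U_le)
    · intro q hq
      obtain ⟨hq, h0⟩ := Finset.mem_filter.1 hq
      obtain ⟨⟨a1, a2, a3⟩, h2⟩ := hS q hq
      exact ⟨a1, Finset.mem_filter.2 ⟨Finset.mem_product.2 ⟨a2, a3⟩, h0, h2⟩⟩
    · intro x hx
      refine (card_le_of_fibers _ (G.U.filter fun y => G.cof x y ≠ 0) (fun y => Finset.univ.filter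
        fun z => ∑ i, G.cof x y i * (G.vec i).eval z = 0) (12 * d) ?_ ?_).trans
        (Nat.mul_le_mul_right _ ((Finset.card_filter_le _ _).trans G.card_U_le))
      · intro q hq
        obtain ⟨hq, h0, h3⟩ := Finset.mem_filter.1 hq
        have hq := Finset.mem_product.1 hq
        exact ⟨Finset.mem_filter.2 ⟨hq.1, h0⟩, Finset.mem_filter.2 ⟨Finset.mem_univ _, h3⟩⟩
      · intro y hy
        exact G.card_vec_comb_eq_zero_le (Finset.mem_filter.1 hy).2
  rw [← Finset.card_filter_add_card_filter_not (s := S) (fun q => G.cof q.1 q.2.1 = 0)]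
  calc _ ≤ p * (12 * d * p) + p * (p * (12 * d)) := add_le_add h1 h2
    _ = _ := by ring

/-- Degenerate singular quadruples. -/
def degen : Finset (ZMod p × ZMod p × ZMod p × ZMod p) :=
  G.U4.filter fun q => G.J q = 0 ∧ (G.vecMatrix q.2).det = 0

theorem card_degen_le : G.degen.card ≤ 96 * d ^ 2 * p ^ 2 := by
  refine (card_le_of_fibers_right _ ((G.U ×ˢ G.U ×ˢ G.U).filter fun q => (G.vecMatrix q).det = 0)
    (fun q => Finset.univ.filter fun z =>
      (G.N.eval q.1 * G.M.eval q.2.1 * G.N.eval q.2.2) * G.M.eval z +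
        -(G.M.eval q.1 * G.N.eval q.2.1 * G.M.eval q.2.2) * G.N.eval z = 0) (4 * d) ?_ ?_).trans
    ((Nat.mul_le_mul_right _ G.card_det_eq_zero_le).trans_eq (by ring))
  · intro q hq
    obtain ⟨h1, h2, h3⟩ := Finset.mem_filter.1 hq
    refine ⟨Finset.mem_filter.2 ⟨(Finset.mem_product.1 h1).2, h3⟩,
      Finset.mem_filter.2 ⟨Finset.mem_univ _, ?_⟩⟩
    rw [J] at h2
    linear_combination h2
  · intro q hq
    have h := (Finset.mem_filter.1 hq).1
    simp only [Finset.mem_product] at h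
    obtain ⟨-, -, -, N1⟩ := G.mem_U.1 h.1
    obtain ⟨-, -, M2, -⟩ := G.mem_U.1 h.2.1
    obtain ⟨-, -, -, N3⟩ := G.mem_U.1 h.2.2
    exact G.card_comb_eq_zero_le (Or.inl (mul_ne_zero (mul_ne_zero N1 M2) N3))

theorem card_label_singular_le (ℓ : ZMod p × ZMod p) :
    (G.U4.filter fun q => G.label q = ℓ ∧ G.J q = 0).card ≤
      p * nonsingBound 3 (12 * d) ^ 3 + (G.degen.filter fun q => G.label q = ℓ).card := by
  classical
  rw [← Finset.card_filter_add_card_filter_not (fun q => (G.vecMatrix q.2).det ≠ 0)]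
  refine add_le_add ?_ (Finset.card_le_card ?_)
  · refine (card_le_of_fibers _ G.U (fun z => (G.U ×ˢ G.U ×ˢ G.U).filter fun q =>
      G.label (z, q) = ℓ ∧ G.J (z, q) = 0 ∧ (G.vecMatrix q).det ≠ 0) _ ?_
      fun z hz => G.card_label_nonsingular_le hz ℓ).trans (Nat.mul_le_mul_right _ G.card_U_le)
    intro q hq
    obtain ⟨hq, h1⟩ := Finset.mem_filter.1 hq
    obtain ⟨hq, h2, h3⟩ := Finset.mem_filter.1 hq
    have hq := Finset.mem_product.1 hq
    exact ⟨hq.1, Finset.mem_filter.2 ⟨hq.2, h2, h3, h1⟩⟩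
  · intro q hq
    obtain ⟨hq, h1⟩ := Finset.mem_filter.1 hq
    obtain ⟨hq, h2, h3⟩ := Finset.mem_filter.1 hq
    exact Finset.mem_filter.2 ⟨Finset.mem_filter.2 ⟨hq, h3, not_not.1 h1⟩, h2⟩

/-- Number of pairs of quadruples with the same cyclic differences and label `ℓ`. -/
def rCount (ℓ : ZMod p × ZMod p) : ℕ :=
  ((G.U4 ×ˢ G.U4).filter fun x => G.A x.1 = G.A x.2 ∧ G.label x.2 = ℓ).card

theorem rCount_le (ℓ : ZMod p × ZMod p) :
    G.rCount ℓ ≤ (labelBound d * nonsingBound 4 (d + d) ^ 4 +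
      nonsingBound 3 (12 * d) ^ 3 * d ^ 3) * p ^ 2 +
      d ^ 3 * p * (G.degen.filter fun q => G.label q = ℓ).card := by
  classical
  rw [rCount, ← Finset.card_filter_add_card_filter_not (fun x => G.J x.1 ≠ 0)]
  have h1 := card_le_of_fibers_right
    (((G.U4 ×ˢ G.U4).filter fun x => G.A x.1 = G.A x.2 ∧ G.label x.2 = ℓ).filter
      fun x => G.J x.1 ≠ 0) (G.U4.filter fun q => G.label q = ℓ)
    (fun z => G.U4.filter fun q => G.A q = G.A z ∧ G.J q ≠ 0) _ (by
      intro x hx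
      simp only [Finset.mem_filter, Finset.mem_product] at hx ⊢
      tauto) (fun z _ => G.card_A_eq_nonsingular_le _)
  have h2 := card_le_of_fibers
    (((G.U4 ×ˢ G.U4).filter fun x => G.A x.1 = G.A x.2 ∧ G.label x.2 = ℓ).filter
      fun x => ¬ G.J x.1 ≠ 0) (G.U4.filter fun q => G.label q = ℓ ∧ G.J q = 0)
    (fun z => G.U4.filter fun q => G.A q = G.A z) _ (by
      intro x hx
      simp only [Finset.mem_filter, Finset.mem_product, not_not] at hx ⊢
      obtain ⟨⟨⟨h1, h2⟩, h3, h4⟩, h5⟩ := hx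
      exact ⟨⟨h1, (G.label_eq_of_A_eq h3).trans h4, h5⟩, h2, h3.symm⟩) (fun z _ => G.card_A_eq_le _)
  calc _ ≤ _ := add_le_add h1 h2
    _ ≤ labelBound d * p ^ 2 * nonsingBound 4 (d + d) ^ 4 +
      (p * nonsingBound 3 (12 * d) ^ 3 + (G.degen.filter fun q => G.label q = ℓ).card) *
        (p * (d * (d * d))) :=
      add_le_add (Nat.mul_le_mul_right _ (G.card_label_eq_le ℓ))
        (Nat.mul_le_mul_right _ (G.card_label_singular_le ℓ))
    _ = _ := by ring

def energyBound (d : ℕ) : ℕ :=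
  2 * (labelBound d * nonsingBound 4 (d + d) ^ 4 + nonsingBound 3 (12 * d) ^ 3 * d ^ 3) ^ 2 +
    2 * d ^ 6 * labelBound d * (96 * d ^ 2)

theorem sum_rCount_sq_le : ∑ ℓ, G.rCount ℓ ^ 2 ≤ energyBound d * p ^ 6 := by
  classical
  set K := labelBound d * nonsingBound 4 (d + d) ^ 4 + nonsingBound 3 (12 * d) ^ 3 * d ^ 3
  have h : ∀ ℓ, G.rCount ℓ ^ 2 ≤ 2 * K ^ 2 * p ^ 4 + 2 * d ^ 6 * labelBound d * p ^ 4 *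
      (G.degen.filter fun q => G.label q = ℓ).card := by
    intro ℓ
    set Z := (G.degen.filter fun q => G.label q = ℓ).card
    have hZ : Z ≤ labelBound d * p ^ 2 := (Finset.card_le_card (fun q hq => by
      obtain ⟨h1, h2⟩ := Finset.mem_filter.1 hq
      exact Finset.mem_filter.2 ⟨(Finset.mem_filter.1 h1).1, h2⟩)).trans (G.card_label_eq_le ℓ)
    calc G.rCount ℓ ^ 2 ≤ (K * p ^ 2 + d ^ 3 * p * Z) ^ 2 := Nat.pow_le_pow_left (G.rCount_le ℓ) 2
      _ ≤ 2 * ((K * p ^ 2) ^ 2 + (d ^ 3 * p * Z) ^ 2) := add_sq_le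
      _ = 2 * K ^ 2 * p ^ 4 + 2 * d ^ 6 * p ^ 2 * (Z * Z) := by ring
      _ ≤ 2 * K ^ 2 * p ^ 4 + 2 * d ^ 6 * p ^ 2 * ((labelBound d * p ^ 2) * Z) := by gcongr
      _ = _ := by ring
  have h2 : ∑ ℓ, (G.degen.filter fun q => G.label q = ℓ).card = G.degen.card :=
    (Finset.card_eq_sum_card_fiberwise (fun _ _ => Finset.mem_coe.2 (Finset.mem_univ _))).symm
  calc ∑ ℓ, G.rCount ℓ ^ 2 ≤ _ := Finset.sum_le_sum fun ℓ _ => h ℓ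
    _ = p ^ 2 * (2 * K ^ 2 * p ^ 4) + 2 * d ^ 6 * labelBound d * p ^ 4 * G.degen.card := by
      rw [← h2, Finset.mul_sum, Finset.sum_add_distrib, Finset.sum_const, Finset.card_univ,
        Fintype.card_prod, ZMod.card, smul_eq_mul]
      ring
    _ ≤ p ^ 2 * (2 * K ^ 2 * p ^ 4) + 2 * d ^ 6 * labelBound d * p ^ 4 * (96 * d ^ 2 * p ^ 2) := by
      gcongr; exact G.card_degen_le
    _ = _ := by rw [energyBound]; ring

end RedData

end

section

section Kernel
open scoped ComplexConjugate
variable {X H : Type*} [Fintype X] [Fintype H] [DecidableEq X]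

theorem sum_kernel_mul {k : H → X → ℂ} {N : ℂ}
    (hk : ∀ x x', ∑ h, conj (k h x) * k h x' = if x = x' then N else 0) (F G : X → ℂ) :
    ∑ h, (∑ x, F x * conj (k h x)) * (∑ x, G x * k h x) = N * ∑ x, F x * G x := by
  calc ∑ h, (∑ x, F x * conj (k h x)) * (∑ x, G x * k h x)
      = ∑ h, ∑ x, ∑ x', F x * G x' * (conj (k h x) * k h x') := by
        refine Finset.sum_congr rfl fun h _ => ?_
        rw [Finset.sum_mul_sum]
        exact Finset.sum_congr rfl fun x _ => Finset.sum_congr rfl fun x' _ => by ring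
    _ = ∑ x, ∑ x', ∑ h, F x * G x' * (conj (k h x) * k h x') := by
        rw [Finset.sum_comm]
        exact Finset.sum_congr rfl fun x _ => Finset.sum_comm
    _ = ∑ x, ∑ x', F x * G x' * (if x = x' then N else 0) := by
        simp_rw [← Finset.mul_sum, hk]
    _ = _ := by
        simp only [mul_ite, mul_zero, Finset.sum_ite_eq, Finset.mem_univ, if_true, Finset.mul_sum]
        exact Finset.sum_congr rfl fun x _ => by ring

theorem sum_kernel_norm_sq {k : H → X → ℂ} {N : ℝ}
    (hk : ∀ x x', ∑ h, conj (k h x) * k h x' = if x = x' then (N : ℂ) else 0) (g : X → ℂ) :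
    ∑ h, ‖∑ x, g x * k h x‖ ^ 2 = N * ∑ x, ‖g x‖ ^ 2 := by
  have h := sum_kernel_mul hk (fun x => conj (g x)) g
  have h1 : ∀ z : ℂ, conj z * z = ((‖z‖ ^ 2 : ℝ) : ℂ) := fun z => by
    rw [Complex.conj_mul']; push_cast; rfl
  have h2 : ∀ h, (∑ x, conj (g x) * conj (k h x)) * (∑ x, g x * k h x) =
      ((‖∑ x, g x * k h x‖ ^ 2 : ℝ) : ℂ) := fun h => by
    rw [← h1]; simp only [map_sum, map_mul]
  simp_rw [h2, h1] at h
  exact_mod_cast h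

end Kernel

section Fourier
open scoped ComplexConjugate
variable {p : ℕ} [Fact p.Prime]

/-- The standard additive character. -/
def eChar (x : ZMod p) : ℂ := ZMod.stdAddChar x

theorem eChar_add (x y : ZMod p) : eChar (x + y) = eChar x * eChar y :=
  AddChar.map_add_eq_mul _ _ _

theorem eChar_zero : eChar (0 : ZMod p) = 1 := AddChar.map_zero_eq_one _

theorem conj_eChar (x : ZMod p) : conj (eChar x) = eChar (-x) :=
  (AddChar.map_neg_eq_conj _ _).symm

theorem norm_eChar (x : ZMod p) : ‖eChar x‖ = 1 := AddChar.norm_apply _ _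

theorem sum_eChar_mul (x : ZMod p) : ∑ h : ZMod p, eChar (h * x) = if x = 0 then (p : ℂ) else 0 := by
  have := AddChar.sum_mulShift x (ZMod.isPrimitive_stdAddChar p)
  rw [ZMod.card] at this
  exact_mod_cast this

theorem eChar_orthogonality (x x' : ZMod p) :
    ∑ h : ZMod p, conj (eChar (h * x)) * eChar (h * x') =
      if x = x' then ((p : ℝ) : ℂ) else 0 := by
  have := sum_eChar_mul (x' - x)
  simp only [sub_eq_zero, eq_comm (a := x')] at this
  rw [Complex.ofReal_natCast, ← this]
  refine Finset.sum_congr rfl fun h _ => ?_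
  rw [conj_eChar, ← eChar_add]
  ring_nf

/-- The pairing of frequencies and points of the plane. -/
def pairing (h x : ZMod p × ZMod p) : ZMod p := h.1 * x.1 + h.2 * x.2

theorem pairing_orthogonality (x x' : ZMod p × ZMod p) :
    ∑ h : ZMod p × ZMod p, conj (eChar (pairing h x)) * eChar (pairing h x') =
      if x = x' then (((p : ℝ) ^ 2 : ℝ) : ℂ) else 0 := by
  have h1 := eChar_orthogonality x.1 x'.1
  have h2 := eChar_orthogonality x.2 x'.2
  calc _ = (∑ h : ZMod p, conj (eChar (h * x.1)) * eChar (h * x'.1)) *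
      ∑ h : ZMod p, conj (eChar (h * x.2)) * eChar (h * x'.2) := by
        rw [Finset.sum_mul_sum, Fintype.sum_prod_type]
        refine Finset.sum_congr rfl fun a _ => Finset.sum_congr rfl fun b _ => ?_
        simp only [pairing, eChar_add, map_mul]
        ring
    _ = _ := by
        rw [h1, h2]
        by_cases ha : x.1 = x'.1 <;> by_cases hb : x.2 = x'.2 <;>
          simp [Prod.ext_iff, ha, hb, pow_two]

theorem fourier_inversion (g : ZMod p → ℂ) (x : ZMod p) :
    g x = (p : ℂ)⁻¹ * ∑ a, (∑ x', g x' * conj (eChar (a * x'))) * eChar (a * x) := by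
  have h := sum_kernel_mul (k := fun a x : ZMod p => eChar (a * x)) eChar_orthogonality g
    (Pi.single x 1)
  have hp : (p : ℂ) ≠ 0 := Nat.cast_ne_zero.2 (Fact.out : p.Prime).ne_zero
  simp only [Pi.single_apply, ite_mul, one_mul, zero_mul, Finset.sum_ite_eq', Finset.mem_univ,
    if_true, mul_ite, mul_one, mul_zero, Complex.ofReal_natCast] at h
  rw [h, inv_mul_cancel_left₀ hp]

theorem sum_shift_mul_shift (F G : ZMod p × ZMod p → ℂ) (s t : ZMod p) :
    ∑ x : ZMod p × ZMod p, F (x.1 + s, x.2) * G (x.1, x.2 + t) =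
      ((p : ℂ) ^ 2)⁻¹ * ∑ h, (∑ x, F x * conj (eChar (pairing h x))) *
        (∑ x, G x * eChar (pairing h x)) * eChar (h.1 * s - h.2 * t) := by
  have hp : (p : ℂ) ≠ 0 := Nat.cast_ne_zero.2 (Fact.out : p.Prime).ne_zero
  have h := sum_kernel_mul (k := fun h x : ZMod p × ZMod p => eChar (pairing h x))
    pairing_orthogonality (fun x => F (x.1 + s, x.2)) (fun x => G (x.1, x.2 + t))
  rw [eq_inv_mul_iff_mul_eq₀ (pow_ne_zero 2 hp)]
  push_cast at h
  rw [← h]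
  refine Finset.sum_congr rfl fun h _ => ?_
  have e1 : ∑ x : ZMod p × ZMod p, F (x.1 + s, x.2) * conj (eChar (pairing h x)) =
      (∑ x, F x * conj (eChar (pairing h x))) * eChar (h.1 * s) := by
    rw [Finset.sum_mul]
    refine Fintype.sum_equiv (Equiv.addRight ((s, 0) : ZMod p × ZMod p)) _ _ fun x => ?_
    simp only [Equiv.coe_addRight, conj_eChar, mul_assoc, ← eChar_add, pairing, Prod.fst_add,
      Prod.snd_add]
    congr 2
    · ext <;> simp
    · ring
  have e2 : ∑ x : ZMod p × ZMod p, G (x.1, x.2 + t) * eChar (pairing h x) =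
      (∑ x, G x * eChar (pairing h x)) * eChar (-(h.2 * t)) := by
    rw [Finset.sum_mul]
    refine Fintype.sum_equiv (Equiv.addRight ((0, t) : ZMod p × ZMod p)) _ _ fun x => ?_
    simp only [Equiv.coe_addRight, mul_assoc, ← eChar_add, pairing, Prod.fst_add,
      Prod.snd_add]
    congr 2
    · ext <;> simp
    · ring
  rw [e1, e2, sub_eq_add_neg, eChar_add]
  ring

namespace RedData
variable {d : ℕ} (G : RedData p d)

/-- The exponential sum along the curve. -/
def expSum (x y : ZMod p) : ℂ := ∑ t ∈ G.U, eChar (x * G.P t + y * G.Q t)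

theorem norm_expSum_le {x y : ZMod p} (h : x ≠ 0 ∨ y ≠ 0) :
    ‖G.expSum x y‖ ≤ (16 * d + 2) * √p := by
  have hl := G.large
  have h1 := norm_weil_finset_le (ψ := (ZMod.stdAddChar : AddChar (ZMod p) ℂ)) (D := 2 * d)
    (E := 10 * d)
    (by
      have := ZMod.isPrimitive_stdAddChar p
      have := this (one_ne_zero)
      rwa [AddChar.mulShift_one] at this)
    (G.natDegree_comb_le x y) G.natDegree_bs_le (by omega) G.bs_ne_zero (G.comb_ne x y h) G.U
    (by
      intro t ht
      have := G.mem_U.1 ht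
      rw [eval_mul]; exact mul_ne_zero this.1 this.2.1) G.card_U_compl_le
  have h2 : G.expSum x y = ∑ t ∈ G.U, ZMod.stdAddChar
      ((C x * (G.a * G.s) + C y * (G.r * G.b)).eval t / (G.b * G.s).eval t) := by
    refine Finset.sum_congr rfl fun t ht => ?_
    rw [eChar]
    congr 1
    obtain ⟨h1, h2, -⟩ := G.mem_U.1 ht
    simp only [P, Q, eval_add, eval_mul, eval_C]
    field_simp
  rw [h2]
  refine h1.trans ?_
  have hp : 1 ≤ √(p : ℝ) := Real.one_le_sqrt.2 (by exact_mod_cast (Fact.out : p.Prime).one_le)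
  push_cast
  have hd : (0 : ℝ) ≤ d := Nat.cast_nonneg d
  nlinarith [mul_nonneg hd (sub_nonneg.2 hp)]

end RedData
end Fourier

end

section

section CauchySchwarz
open scoped ComplexConjugate

theorem norm_sum_mul_sq_le {ι : Type*} (s : Finset ι) (f g : ι → ℂ) :
    ‖∑ i ∈ s, f i * g i‖ ^ 2 ≤ (∑ i ∈ s, ‖f i‖ ^ 2) * ∑ i ∈ s, ‖g i‖ ^ 2 := by
  refine le_trans (pow_le_pow_left₀ (norm_nonneg _) (norm_sum_le _ _) 2) ?_
  simp_rw [norm_mul]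
  exact Finset.sum_mul_sq_le_sq_mul_sq _ _ _

variable {E A B : Type*} [Fintype A] [DecidableEq A] [Fintype B] [DecidableEq B]

theorem sum_norm_sq_fiber (S : Finset E) (h : E → A) (f : E → ℂ) :
    ((∑ a, ‖∑ e ∈ S.filter fun e => h e = a, f e‖ ^ 2 : ℝ) : ℂ) =
      ∑ x ∈ (S ×ˢ S).filter fun x => h x.1 = h x.2, f x.1 * conj (f x.2) := by
  push_cast
  simp_rw [← Complex.mul_conj', map_sum, Finset.sum_mul_sum, Finset.sum_filter]
  rw [Finset.sum_comm, Finset.sum_product]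
  refine Finset.sum_congr rfl fun e _ => ?_
  rw [Finset.sum_eq_single (h e)]
  · simp only [if_true]
    exact Finset.sum_congr rfl fun e' _ => by simp only [eq_comm]
  · intro b _ hb
    rw [if_neg (Ne.symm hb)]
  · simp

theorem norm_sum_fiber_sq_le (S : Finset E) (h : E → A) (α : A → ℂ) (f : E → ℂ) :
    ‖∑ e ∈ S, α (h e) * f e‖ ^ 2 ≤ (∑ a, ‖α a‖ ^ 2) *
      ‖∑ x ∈ (S ×ˢ S).filter fun x => h x.1 = h x.2, f x.1 * conj (f x.2)‖ := by
  have h1 : ∑ e ∈ S, α (h e) * f e = ∑ a, α a * ∑ e ∈ S.filter fun e => h e = a, f e := by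
    rw [← Finset.sum_fiberwise S h]
    refine Finset.sum_congr rfl fun a _ => ?_
    rw [Finset.mul_sum]
    refine Finset.sum_congr rfl fun e he => ?_
    rw [(Finset.mem_filter.1 he).2]
  rw [h1, ← sum_norm_sq_fiber, Complex.norm_real, Real.norm_of_nonneg (by positivity)]
  exact norm_sum_mul_sq_le _ _ _

/-- Quadruples of edges closing up to a cycle. -/
def cycles (S : Finset E) (m : E → A) (n : E → B) : Finset ((E × E) × (E × E)) :=
  (((S ×ˢ S).filter fun x => m x.1 = m x.2) ×ˢ ((S ×ˢ S).filter fun x => m x.1 = m x.2)).filter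
    fun x => (n x.1.1, n x.1.2) = (n x.2.1, n x.2.2)

theorem norm_sum_pow_four_le (S : Finset E) (m : E → A) (n : E → B) (α : A → ℂ) (β : B → ℂ)
    (c : E → ℂ) :
    ‖∑ e ∈ S, α (m e) * (β (n e) * c e)‖ ^ 4 ≤ (∑ a, ‖α a‖ ^ 2) ^ 2 * (∑ b, ‖β b‖ ^ 2) ^ 2 *
      ‖∑ x ∈ cycles S m n, (c x.1.1 * conj (c x.1.2)) * conj (c x.2.1 * conj (c x.2.2))‖ := by
  classical
  have h1 := norm_sum_fiber_sq_le S m α fun e => β (n e) * c e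
  have h2 := norm_sum_fiber_sq_le ((S ×ˢ S).filter fun x => m x.1 = m x.2)
    (fun x => (n x.1, n x.2)) (fun b => β b.1 * conj (β b.2)) (fun x => c x.1 * conj (c x.2))
  have h3 : ∑ x ∈ (S ×ˢ S).filter fun x => m x.1 = m x.2,
      (β (n x.1) * c x.1) * conj (β (n x.2) * c x.2) =
      ∑ x ∈ (S ×ˢ S).filter fun x => m x.1 = m x.2,
      β (n x.1) * conj (β (n x.2)) * (c x.1 * conj (c x.2)) :=
    Finset.sum_congr rfl fun x _ => by rw [map_mul]; ring
  have h4 : ∑ b : B × B, ‖β b.1 * conj (β b.2)‖ ^ 2 = (∑ b, ‖β b‖ ^ 2) ^ 2 := by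
    rw [pow_two (∑ b, ‖β b‖ ^ 2), Finset.sum_mul_sum, Fintype.sum_prod_type]
    refine Finset.sum_congr rfl fun a _ => Finset.sum_congr rfl fun b _ => ?_
    rw [norm_mul, RCLike.norm_conj, mul_pow]
  rw [h3] at h1
  rw [h4] at h2
  calc ‖∑ e ∈ S, α (m e) * (β (n e) * c e)‖ ^ 4
      = (‖∑ e ∈ S, α (m e) * (β (n e) * c e)‖ ^ 2) ^ 2 := by ring
    _ ≤ _ := pow_le_pow_left₀ (by positivity) h1 2
    _ = _ := mul_pow _ _ _
    _ ≤ _ := mul_le_mul_of_nonneg_left h2 (by positivity)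
    _ = _ := by rw [mul_assoc]; rfl

end CauchySchwarz

namespace RedData
open scoped ComplexConjugate
variable {p d : ℕ} [Fact p.Prime] (G : RedData p d)

/-- The phase attached to an edge. -/
def phase (h : ZMod p × ZMod p) (e : ZMod p × ZMod p) : ℂ :=
  eChar (h.1 * G.P e.2 - h.2 * G.Q e.2)

/-- The character sum over cycles. -/
def cycleSum (h : ZMod p × ZMod p) : ℂ :=
  ∑ x ∈ cycles (G.U ×ˢ G.U) (fun e => G.P e.1 - G.P e.2) (fun e => G.Q e.1 - G.Q e.2),
    (G.phase h x.1.1 * conj (G.phase h x.1.2)) * conj (G.phase h x.2.1 * conj (G.phase h x.2.2))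

theorem cycleSum_eq (h : ZMod p × ZMod p) :
    G.cycleSum h = ∑ ℓ, (G.rCount ℓ : ℂ) * eChar (pairing h (ℓ.1, -ℓ.2)) := by
  classical
  have h1 : G.cycleSum h = ∑ x ∈ (G.U4 ×ˢ G.U4).filter fun x => G.A x.1 = G.A x.2,
      eChar (pairing h ((G.label x.2).1, -(G.label x.2).2)) := by
    refine Finset.sum_nbij'
      (fun x => ((x.1.1.1, x.1.2.1, x.2.2.1, x.2.1.1), (x.1.1.2, x.1.2.2, x.2.2.2, x.2.1.2)))
      (fun x => (((x.1.1, x.2.1), (x.1.2.1, x.2.2.1)), ((x.1.2.2.2, x.2.2.2.2),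
        (x.1.2.2.1, x.2.2.2.1)))) ?_ ?_ ?_ ?_ ?_
    · intro x hx
      simp only [cycles, Finset.mem_filter, Finset.mem_product, mem_U4, A, Prod.mk.injEq] at hx ⊢
      obtain ⟨⟨⟨⟨⟨a1, a2⟩, a3, a4⟩, a5⟩, ⟨⟨a6, a7⟩, a8, a9⟩, a10⟩, a11, a12⟩ := hx
      refine ⟨⟨⟨a1, a3, a8, a6⟩, a2, a4, a9, a7⟩, ?_, ?_, ?_, ?_⟩
      · linear_combination a5
      · linear_combination a12
      · linear_combination -a10
      · linear_combination -a11
    · intro x hx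
      simp only [cycles, Finset.mem_filter, Finset.mem_product, mem_U4, A, Prod.mk.injEq] at hx ⊢
      obtain ⟨⟨⟨a1, a3, a8, a6⟩, a2, a4, a9, a7⟩, b1, b2, b3, b4⟩ := hx
      refine ⟨⟨⟨⟨⟨a1, a2⟩, a3, a4⟩, ?_⟩, ⟨⟨a6, a7⟩, a8, a9⟩, ?_⟩, ?_, ?_⟩
      · linear_combination b1
      · linear_combination -b3
      · linear_combination -b4
      · linear_combination b2
    · rintro ⟨⟨⟨_, _⟩, ⟨_, _⟩⟩, ⟨⟨_, _⟩, ⟨_, _⟩⟩⟩ _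
      rfl
    · rintro ⟨⟨_, _, _, _⟩, ⟨_, _, _, _⟩⟩ _
      rfl
    · intro x _
      simp only [phase, conj_eChar, ← eChar_add, pairing, label]
      congr 1
      ring
  rw [h1, ← Finset.sum_fiberwise _ (fun x => G.label x.2)]
  refine Finset.sum_congr rfl fun ℓ _ => ?_
  rw [Finset.sum_congr rfl (g := fun _ => eChar (pairing h (ℓ.1, -ℓ.2))) fun x hx => by
    rw [(Finset.mem_filter.1 hx).2], Finset.sum_const, nsmul_eq_mul, rCount, Finset.filter_filter]

theorem sum_norm_cycleSum_sq_le :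
    ∑ h, ‖G.cycleSum h‖ ^ 2 ≤ energyBound d * (p : ℝ) ^ 8 := by
  have h := sum_kernel_norm_sq (N := (p : ℝ) ^ 2)
    (k := fun h ℓ : ZMod p × ZMod p => eChar (pairing h (ℓ.1, -ℓ.2))) (fun x x' => by
      rw [pairing_orthogonality]
      simp [Prod.ext_iff]) fun ℓ => (G.rCount ℓ : ℂ)
  simp_rw [← cycleSum_eq] at h
  rw [h]
  have h2 : (∑ ℓ, G.rCount ℓ ^ 2 : ℝ) ≤ energyBound d * (p : ℝ) ^ 6 := by
    exact_mod_cast G.sum_rCount_sq_le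
  simp only [Complex.norm_natCast]
  calc (p : ℝ) ^ 2 * _ ≤ (p : ℝ) ^ 2 * (energyBound d * (p : ℝ) ^ 6) :=
        mul_le_mul_of_nonneg_left h2 (by positivity)
    _ = _ := by ring

end RedData

end

section

section Correlations
open scoped ComplexConjugate
variable {p : ℕ} [Fact p.Prime]

/-- Fourier transform of the horizontal multiplicative derivative. -/
def corr (f : ZMod p × ZMod p → ℂ) (h : ZMod p × ZMod p) (m : ZMod p) : ℂ :=
  ∑ x, (f (x.1 + m, x.2) * conj (f x)) * conj (eChar (pairing h x))

theorem sum_norm_corr_sq_le {f : ZMod p × ZMod p → ℂ} (hf : ∀ x, ‖f x‖ ≤ 1) :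
    ∑ h, ∑ m, ‖corr f h m‖ ^ 2 ≤ (p : ℝ) ^ 5 := by
  rw [Finset.sum_comm]
  have h1 : ∀ m, ∑ h, ‖corr f h m‖ ^ 2 ≤ (p : ℝ) ^ 4 := by
    intro m
    have h := sum_kernel_norm_sq (N := (p : ℝ) ^ 2)
      (k := fun h x : ZMod p × ZMod p => conj (eChar (pairing h x))) (fun x x' => by
        simp_rw [Complex.conj_conj, mul_comm (eChar _), pairing_orthogonality, eq_comm])
      fun x => f (x.1 + m, x.2) * conj (f x)
    simp only [corr]
    rw [h]
    have h2 : ∑ x : ZMod p × ZMod p, ‖f (x.1 + m, x.2) * conj (f x)‖ ^ 2 ≤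
        ∑ x : ZMod p × ZMod p, (1 : ℝ) := by
      refine Finset.sum_le_sum fun x _ => ?_
      rw [norm_mul, RCLike.norm_conj]
      exact pow_le_one₀ (by positivity) (mul_le_one₀ (hf _) (norm_nonneg _) (hf _))
    have h3 : ∑ x : ZMod p × ZMod p, (1 : ℝ) = (p : ℝ) ^ 2 := by
      simp [ZMod.card, pow_two]
    rw [h3] at h2
    calc _ ≤ (p : ℝ) ^ 2 * (p : ℝ) ^ 2 := mul_le_mul_of_nonneg_left h2 (by positivity)
      _ = _ := by ring
  refine (Finset.sum_le_sum fun m _ => h1 m).trans_eq ?_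
  rw [Finset.sum_const, Finset.card_univ, ZMod.card, nsmul_eq_mul]
  ring

/-- Horizontal Fourier coefficients. -/
def rowCoeff (f : ZMod p × ZMod p → ℂ) (a y : ZMod p) : ℂ :=
  ∑ x, f (x, y) * conj (eChar (a * x))

/-- Coefficients of the expansion of `corr f h`. -/
def corrCoeff (f : ZMod p × ZMod p → ℂ) (h : ZMod p × ZMod p) (a : ZMod p) : ℂ :=
  ∑ y, conj (eChar (h.2 * y)) * (rowCoeff f a y * conj (rowCoeff f (a - h.1) y))

theorem corr_eq (f : ZMod p × ZMod p → ℂ) (h : ZMod p × ZMod p) (m : ZMod p) :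
    corr f h m = (p : ℂ)⁻¹ * ∑ a, corrCoeff f h a * eChar (a * m) := by
  calc corr f h m = ∑ y, ∑ x, (f (x + m, y) * conj (f (x, y))) *
        conj (eChar (pairing h (x, y))) := by
        rw [corr, Fintype.sum_prod_type, Finset.sum_comm]
    _ = ∑ y, ∑ x, ∑ a, (p : ℂ)⁻¹ * ((rowCoeff f a y * eChar (a * (x + m))) * conj (f (x, y)) *
        conj (eChar (pairing h (x, y)))) := by
        refine Finset.sum_congr rfl fun y _ => Finset.sum_congr rfl fun x _ => ?_
        rw [fourier_inversion (fun x => f (x, y)) (x + m), ← Finset.mul_sum, mul_assoc, mul_assoc,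
          Finset.sum_mul]
        congr 1
        exact Finset.sum_congr rfl fun a _ => by rw [rowCoeff]; ring
    _ = ∑ a, ∑ y, ∑ x, (p : ℂ)⁻¹ * ((rowCoeff f a y * eChar (a * (x + m))) * conj (f (x, y)) *
        conj (eChar (pairing h (x, y)))) := by
        exact (Finset.sum_congr rfl fun y _ => Finset.sum_comm).trans Finset.sum_comm
    _ = _ := by
        rw [Finset.mul_sum]
        refine Finset.sum_congr rfl fun a _ => ?_
        rw [corrCoeff, Finset.sum_mul, Finset.mul_sum]
        refine Finset.sum_congr rfl fun y _ => ?_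
        rw [← Finset.mul_sum]
        congr 1
        rw [show conj (rowCoeff f (a - h.1) y) =
          conj (∑ x, f (x, y) * conj (eChar ((a - h.1) * x))) from rfl, map_sum, Finset.mul_sum, Finset.mul_sum, Finset.sum_mul]
        refine Finset.sum_congr rfl fun x _ => ?_
        have e : eChar (a * (x + m)) * conj (eChar (pairing h (x, y))) =
            conj (eChar (h.2 * y)) * eChar ((a - h.1) * x) * eChar (a * m) := by
          simp only [conj_eChar, ← eChar_add, pairing]
          congr 1
          ring
        rw [map_mul, Complex.conj_conj]
        linear_combination rowCoeff f a y * conj (f (x, y)) * e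

theorem sum_norm_corrCoeff_le {f : ZMod p × ZMod p → ℂ} (hf : ∀ x, ‖f x‖ ≤ 1)
    (h : ZMod p × ZMod p) : ∑ a, ‖corrCoeff f h a‖ ≤ (p : ℝ) ^ 3 := by
  have h1 : ∀ y, ∑ a, ‖rowCoeff f a y‖ ^ 2 ≤ (p : ℝ) ^ 2 := by
    intro y
    have h := sum_kernel_norm_sq (N := (p : ℝ))
      (k := fun a x : ZMod p => conj (eChar (a * x))) (fun x x' => by
        simp_rw [Complex.conj_conj, mul_comm (eChar _), eChar_orthogonality, eq_comm])
      fun x => f (x, y)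
    simp only [rowCoeff]
    rw [h]
    have h2 : ∑ x : ZMod p, ‖f (x, y)‖ ^ 2 ≤ ∑ x : ZMod p, (1 : ℝ) :=
      Finset.sum_le_sum fun x _ => pow_le_one₀ (norm_nonneg _) (hf _)
    have h3 : ∑ x : ZMod p, (1 : ℝ) = p := by simp [ZMod.card]
    rw [h3] at h2
    calc _ ≤ (p : ℝ) * p := mul_le_mul_of_nonneg_left h2 (by positivity)
      _ = _ := by ring
  calc ∑ a, ‖corrCoeff f h a‖
      ≤ ∑ a, ∑ y, (‖rowCoeff f a y‖ ^ 2 / 2 + ‖rowCoeff f (a - h.1) y‖ ^ 2 / 2) := by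
        refine Finset.sum_le_sum fun a _ => (norm_sum_le _ _).trans (Finset.sum_le_sum fun y _ => ?_)
        rw [norm_mul, norm_mul, RCLike.norm_conj, RCLike.norm_conj, norm_eChar, one_mul]
        nlinarith [sq_nonneg (‖rowCoeff f a y‖ - ‖rowCoeff f (a - h.1) y‖)]
    _ = ∑ y, (∑ a, ‖rowCoeff f a y‖ ^ 2) := by
        rw [Finset.sum_comm]
        refine Finset.sum_congr rfl fun y _ => ?_
        have e : ∑ a, ‖rowCoeff f (a - h.1) y‖ ^ 2 / 2 = ∑ a, ‖rowCoeff f a y‖ ^ 2 / 2 :=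
          (Equiv.subRight h.1).sum_comp fun a => ‖rowCoeff f a y‖ ^ 2 / 2
        rw [Finset.sum_add_distrib, e, ← Finset.sum_div]
        ring
    _ ≤ ∑ y : ZMod p, (p : ℝ) ^ 2 := Finset.sum_le_sum fun y _ => h1 y
    _ = _ := by
        rw [Finset.sum_const, Finset.card_univ, ZMod.card, nsmul_eq_mul]
        ring

theorem corrCoeff_eq_zero {f : ZMod p × ZMod p → ℂ} (hf : ∀ y, ∑ x, f (x, y) = 0)
    {h : ZMod p × ZMod p} {a : ZMod p} (ha : a = 0 ∨ a - h.1 = 0) : corrCoeff f h a = 0 := by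
  have h0 : ∀ y, rowCoeff f 0 y = 0 := fun y => by simp [rowCoeff, eChar_zero, hf]
  refine Finset.sum_eq_zero fun y _ => ?_
  rcases ha with ha | ha <;> simp [ha, h0]

end Correlations

end

section

theorem sum_le_of_pow_four_le {ι : Type*} [Fintype ι] {v a b w : ι → ℝ} {L T W θ : ℝ}
    (ha : ∀ i, 0 ≤ a i) (hb : ∀ i, 0 ≤ b i)
    (h : ∀ i, v i ^ 4 ≤ a i ^ 2 * b i ^ 2 * w i) (hL : ∀ i, v i ≤ L) (hT : ∑ i, a i ≤ T)
    (hT' : ∑ i, b i ≤ T) (hW : ∑ i, w i ^ 2 ≤ W) (hL0 : 0 ≤ L) (hθ : 0 < θ) :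
    ∑ i, v i ≤ θ * T + L * (W / θ ^ 8) := by
  have key : ∀ i, v i ≤ θ * (a i / 2 + b i / 2) + L * (w i ^ 2 / θ ^ 8) := by
    intro i
    have h0 : 0 ≤ θ * (a i / 2 + b i / 2) :=
      mul_nonneg hθ.le (add_nonneg (div_nonneg (ha i) zero_le_two) (div_nonneg (hb i) zero_le_two))
    rcases le_total (w i) (θ ^ 4) with hle | hle
    · have h1 : v i ^ 4 ≤ (θ * (a i / 2 + b i / 2)) ^ 4 := by
        have h2 : a i * b i ≤ (a i / 2 + b i / 2) ^ 2 := by nlinarith [sq_nonneg (a i - b i)]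
        calc v i ^ 4 ≤ a i ^ 2 * b i ^ 2 * w i := h i
          _ ≤ a i ^ 2 * b i ^ 2 * θ ^ 4 := mul_le_mul_of_nonneg_left hle (by positivity)
          _ = (a i * b i) ^ 2 * θ ^ 4 := by ring
          _ ≤ ((a i / 2 + b i / 2) ^ 2) ^ 2 * θ ^ 4 := by
            gcongr
            exact mul_nonneg (ha i) (hb i)
          _ = _ := by ring
      have h3 := le_of_pow_le_pow_left₀ (by norm_num) h0 h1
      have : 0 ≤ L * (w i ^ 2 / θ ^ 8) := by positivity
      linarith
    · have h1 : 1 ≤ w i ^ 2 / θ ^ 8 := by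
        rw [one_le_div (by positivity)]
        calc θ ^ 8 = (θ ^ 4) ^ 2 := by ring
          _ ≤ _ := by gcongr
      have := mul_le_mul_of_nonneg_left h1 hL0
      linarith [hL i]
  refine (Finset.sum_le_sum fun i _ => key i).trans ?_
  rw [Finset.sum_add_distrib, ← Finset.mul_sum, ← Finset.mul_sum, Finset.sum_add_distrib,
    ← Finset.sum_div, ← Finset.sum_div, ← Finset.sum_div]
  refine add_le_add (mul_le_mul_of_nonneg_left (by linarith) hθ.le)
    (mul_le_mul_of_nonneg_left (by gcongr) hL0)

namespace RedData
open scoped ComplexConjugate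
variable {p d : ℕ} [Fact p.Prime] (G : RedData p d)

/-- The counting operator over the good points, unnormalised. -/
def tri (f0 f1 f2 : ZMod p × ZMod p → ℂ) : ℂ :=
  ∑ x : ZMod p × ZMod p, ∑ y ∈ G.U, f0 x * f1 (x.1 + G.P y, x.2) * f2 (x.1, x.2 + G.Q y)

/-- The contribution of one frequency. -/
def freqSum (f1 f2 : ZMod p × ZMod p → ℂ) (h : ZMod p × ZMod p) : ℂ :=
  ∑ e ∈ G.U ×ˢ G.U, corr f1 h (G.P e.1 - G.P e.2) *
    (corr (fun x => f2 (x.2, x.1)) (-h.2, -h.1) (G.Q e.1 - G.Q e.2) * G.phase h e)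

theorem norm_tri_sq_le {f0 : ZMod p × ZMod p → ℂ} (hf0 : ∀ x, ‖f0 x‖ ≤ 1)
    (f1 f2 : ZMod p × ZMod p → ℂ) :
    ‖G.tri f0 f1 f2‖ ^ 2 ≤ ∑ h, ‖G.freqSum f1 f2 h‖ := by
  have hp : (p : ℂ) ≠ 0 := Nat.cast_ne_zero.2 (Fact.out : p.Prime).ne_zero
  have hp' : (p : ℝ) ≠ 0 := Nat.cast_ne_zero.2 (Fact.out : p.Prime).ne_zero
  set g : ZMod p × ZMod p → ℂ := fun x => ∑ y ∈ G.U, f1 (x.1 + G.P y, x.2) * f2 (x.1, x.2 + G.Q y)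
    with hg
  have h1 : ‖G.tri f0 f1 f2‖ ^ 2 ≤ (p : ℝ) ^ 2 * ∑ x, ‖g x‖ ^ 2 := by
    have e : G.tri f0 f1 f2 = ∑ x, f0 x * g x := by
      refine Finset.sum_congr rfl fun x _ => ?_
      rw [hg, Finset.mul_sum]
      exact Finset.sum_congr rfl fun y _ => mul_assoc _ _ _
    rw [e]
    refine (norm_sum_mul_sq_le _ _ _).trans (mul_le_mul_of_nonneg_right ?_ (by positivity))
    calc ∑ x, ‖f0 x‖ ^ 2 ≤ ∑ x : ZMod p × ZMod p, (1 : ℝ) :=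
          Finset.sum_le_sum fun x _ => pow_le_one₀ (norm_nonneg _) (hf0 _)
      _ = (p : ℝ) ^ 2 := by simp [ZMod.card, pow_two]
  have h2 : ((∑ x, ‖g x‖ ^ 2 : ℝ) : ℂ) = ((p : ℂ) ^ 2)⁻¹ * ∑ h, G.freqSum f1 f2 h := by
    calc ((∑ x, ‖g x‖ ^ 2 : ℝ) : ℂ) = ∑ x, g x * conj (g x) := by
          push_cast
          exact Finset.sum_congr rfl fun x _ => (Complex.mul_conj' _).symm
      _ = ∑ x : ZMod p × ZMod p, ∑ e ∈ G.U ×ˢ G.U,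
          (f1 (x.1 + G.P e.1, x.2) * f2 (x.1, x.2 + G.Q e.1)) *
          conj (f1 (x.1 + G.P e.2, x.2) * f2 (x.1, x.2 + G.Q e.2)) := by
          refine Finset.sum_congr rfl fun x _ => ?_
          rw [hg, map_sum, Finset.sum_mul_sum, Finset.sum_product]
      _ = ∑ e ∈ G.U ×ˢ G.U, ∑ x : ZMod p × ZMod p,
          (fun x : ZMod p × ZMod p => f1 (x.1 + (G.P e.1 - G.P e.2), x.2) * conj (f1 x))
            (x.1 + G.P e.2, x.2) *
          (fun x : ZMod p × ZMod p => f2 (x.1, x.2 + (G.Q e.1 - G.Q e.2)) * conj (f2 x))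
            (x.1, x.2 + G.Q e.2) := by
          rw [Finset.sum_comm]
          refine Finset.sum_congr rfl fun e _ => Finset.sum_congr rfl fun x _ => ?_
          have e1 : x.1 + G.P e.2 + (G.P e.1 - G.P e.2) = x.1 + G.P e.1 := by ring
          have e2 : x.2 + G.Q e.2 + (G.Q e.1 - G.Q e.2) = x.2 + G.Q e.1 := by ring
          simp only [e1, e2, map_mul]
          ring
      _ = ∑ e ∈ G.U ×ˢ G.U, ((p : ℂ) ^ 2)⁻¹ * ∑ h, corr f1 h (G.P e.1 - G.P e.2) *
          (corr (fun x => f2 (x.2, x.1)) (-h.2, -h.1) (G.Q e.1 - G.Q e.2) * G.phase h e) := by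
          refine Finset.sum_congr rfl fun e _ => ?_
          refine (sum_shift_mul_shift
            (fun x => f1 (x.1 + (G.P e.1 - G.P e.2), x.2) * conj (f1 x))
            (fun x => f2 (x.1, x.2 + (G.Q e.1 - G.Q e.2)) * conj (f2 x)) (G.P e.2) (G.Q e.2)).trans ?_
          congr 1
          refine Finset.sum_congr rfl fun h _ => ?_
          rw [mul_assoc]
          congr 2
          refine Fintype.sum_equiv (Equiv.prodComm _ _) _ _ fun x => ?_
          simp only [Equiv.prodComm_apply, Prod.swap, pairing, conj_eChar]
          congr 2
          ring
      _ = _ := by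
          rw [← Finset.mul_sum, Finset.sum_comm]
          rfl
  have h3 : (p : ℝ) ^ 2 * ∑ x, ‖g x‖ ^ 2 = ‖∑ h, G.freqSum f1 f2 h‖ := by
    have h4 : ‖((∑ x, ‖g x‖ ^ 2 : ℝ) : ℂ)‖ = ∑ x, ‖g x‖ ^ 2 := by
      rw [Complex.norm_real, Real.norm_of_nonneg (by positivity)]
    rw [← h4, h2, norm_mul, norm_inv, norm_pow, Complex.norm_natCast]
    field_simp
  exact h1.trans (h3.trans_le (norm_sum_le _ _))

theorem norm_freqSum_le {f1 f2 : ZMod p × ZMod p → ℂ} (hf1 : ∀ x, ‖f1 x‖ ≤ 1)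
    (hf2 : ∀ x, ‖f2 x‖ ≤ 1) (h0 : (∀ y, ∑ x, f1 (x, y) = 0) ∨ ∀ x, ∑ y, f2 (x, y) = 0)
    (h : ZMod p × ZMod p) : ‖G.freqSum f1 f2 h‖ ≤ (16 * d + 2) ^ 2 * (p : ℝ) ^ 5 := by
  have hp : (p : ℂ) ≠ 0 := Nat.cast_ne_zero.2 (Fact.out : p.Prime).ne_zero
  have hp' : (0 : ℝ) < p := Nat.cast_pos.2 (Fact.out : p.Prime).pos
  set α := corrCoeff f1 h with hα
  set β := corrCoeff (fun x => f2 (x.2, x.1)) (-h.2, -h.1) with hβ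
  have e1 : G.freqSum f1 f2 h = ((p : ℂ) ^ 2)⁻¹ * ∑ a, ∑ b, α a * β b *
      (G.expSum a b * conj (G.expSum (a - h.1) (b + h.2))) := by
    calc G.freqSum f1 f2 h = ∑ e ∈ G.U ×ˢ G.U, ∑ a, ∑ b, ((p : ℂ) ^ 2)⁻¹ * (α a * β b *
          (eChar (a * G.P e.1 + b * G.Q e.1) *
            conj (eChar ((a - h.1) * G.P e.2 + (b + h.2) * G.Q e.2)))) := by
          refine Finset.sum_congr rfl fun e _ => ?_
          rw [corr_eq, corr_eq, ← hα, ← hβ]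
          calc _ = ((p : ℂ) ^ 2)⁻¹ * ((∑ a, α a * eChar (a * (G.P e.1 - G.P e.2))) *
                (∑ b, β b * eChar (b * (G.Q e.1 - G.Q e.2)))) * G.phase h e := by
                  rw [pow_two, mul_inv]; ring
            _ = _ := by
              rw [Finset.sum_mul_sum, Finset.mul_sum, Finset.sum_mul]
              refine Finset.sum_congr rfl fun a _ => ?_
              rw [Finset.mul_sum, Finset.sum_mul]
              refine Finset.sum_congr rfl fun b _ => ?_
              have e3 : eChar (a * (G.P e.1 - G.P e.2)) * eChar (b * (G.Q e.1 - G.Q e.2)) *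
                  G.phase h e = eChar (a * G.P e.1 + b * G.Q e.1) *
                  conj (eChar ((a - h.1) * G.P e.2 + (b + h.2) * G.Q e.2)) := by
                simp only [phase, conj_eChar, ← eChar_add]
                congr 1
                ring
              rw [← e3]
              ring
      _ = ∑ a, ∑ b, ∑ e ∈ G.U ×ˢ G.U, ((p : ℂ) ^ 2)⁻¹ * (α a * β b *
          (eChar (a * G.P e.1 + b * G.Q e.1) *
            conj (eChar ((a - h.1) * G.P e.2 + (b + h.2) * G.Q e.2)))) := by
          rw [Finset.sum_comm]
          exact Finset.sum_congr rfl fun a _ => Finset.sum_comm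
      _ = _ := by
          rw [Finset.mul_sum]
          refine Finset.sum_congr rfl fun a _ => ?_
          rw [Finset.mul_sum]
          refine Finset.sum_congr rfl fun b _ => ?_
          rw [← Finset.mul_sum, ← Finset.mul_sum, expSum, expSum, map_sum, Finset.sum_mul_sum,
            Finset.sum_product]
  have e2 : ∀ a b, ‖α a * β b * (G.expSum a b * conj (G.expSum (a - h.1) (b + h.2)))‖ ≤
      ‖α a‖ * ‖β b‖ * ((16 * d + 2) ^ 2 * p) := by
    intro a b
    rw [norm_mul, norm_mul]
    by_cases hz : α a = 0 ∨ β b = 0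
    · rcases hz with hz | hz <;> simp [hz]
    push Not at hz
    refine mul_le_mul_of_nonneg_left ?_ (by positivity)
    have hne : (a ≠ 0 ∨ b ≠ 0) ∧ (a - h.1 ≠ 0 ∨ b + h.2 ≠ 0) := by
      rcases h0 with h0 | h0
      · have h5 : ¬ (a = 0 ∨ a - h.1 = 0) := fun h => hz.1 (corrCoeff_eq_zero h0 h)
        tauto
      · have h5 : ¬ (b = 0 ∨ b + h.2 = 0) := fun h => hz.2 (corrCoeff_eq_zero h0 (by
          simpa [sub_neg_eq_add] using h))
        tauto
    rw [norm_mul, RCLike.norm_conj]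
    calc _ ≤ ((16 * d + 2) * √(p : ℝ)) * ((16 * d + 2) * √(p : ℝ)) :=
          mul_le_mul (G.norm_expSum_le hne.1) (G.norm_expSum_le hne.2) (norm_nonneg _) (by positivity)
      _ = (16 * d + 2) ^ 2 * (√(p : ℝ) * √(p : ℝ)) := by ring
      _ = _ := by rw [Real.mul_self_sqrt hp'.le]
  rw [e1, norm_mul, norm_inv, norm_pow, Complex.norm_natCast, inv_mul_le_iff₀ (by positivity)]
  calc _ ≤ ∑ a, ∑ b, ‖α a‖ * ‖β b‖ * ((16 * d + 2) ^ 2 * p) :=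
        (norm_sum_le _ _).trans (Finset.sum_le_sum fun a _ => (norm_sum_le _ _).trans
          (Finset.sum_le_sum fun b _ => e2 a b))
    _ = (∑ a, ‖α a‖) * (∑ b, ‖β b‖) * ((16 * d + 2) ^ 2 * p) := by
        rw [Finset.sum_mul_sum, Finset.sum_mul]
        exact Finset.sum_congr rfl fun a _ => (Finset.sum_mul _ _ _).symm
    _ ≤ (p : ℝ) ^ 3 * (p : ℝ) ^ 3 * ((16 * d + 2) ^ 2 * p) := by
        gcongr
        · exact sum_norm_corrCoeff_le hf1 h
        · exact sum_norm_corrCoeff_le (fun x => hf2 _) _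
    _ = _ := by ring

/-- The constant in `norm_tri_le`. -/
def triBound (d : ℕ) : ℝ := 1 + (16 * d + 2) ^ 2 * energyBound d

theorem one_le_triBound (d : ℕ) : 1 ≤ triBound d := by
  rw [triBound]; exact le_add_of_nonneg_right (by positivity)

theorem norm_tri_le {f0 f1 f2 : ZMod p × ZMod p → ℂ} (hf0 : ∀ x, ‖f0 x‖ ≤ 1)
    (hf1 : ∀ x, ‖f1 x‖ ≤ 1) (hf2 : ∀ x, ‖f2 x‖ ≤ 1)
    (h0 : (∀ y, ∑ x, f1 (x, y) = 0) ∨ ∀ x, ∑ y, f2 (x, y) = 0) {ρ : ℝ} (hρ : 0 < ρ)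
    (hρp : ρ ^ 32 * p = 1) : ‖G.tri f0 f1 f2‖ ≤ triBound d * (p : ℝ) ^ 3 * ρ := by
  have hp' : (0 : ℝ) < p := Nat.cast_pos.2 (Fact.out : p.Prime).pos
  have hp1 : (1 : ℝ) ≤ p := by exact_mod_cast (Fact.out : p.Prime).one_le
  have hρ1 : ρ ≤ 1 := by
    by_contra hlt
    push Not at hlt
    have := one_lt_pow₀ hlt (n := 32) (by norm_num)
    nlinarith
  have hsum := sum_le_of_pow_four_le (v := fun h => ‖G.freqSum f1 f2 h‖)
    (a := fun h => ∑ m, ‖corr f1 h m‖ ^ 2)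
    (b := fun h => ∑ m, ‖corr (fun x => f2 (x.2, x.1)) (-h.2, -h.1) m‖ ^ 2)
    (w := fun h => ‖G.cycleSum h‖) (L := (16 * d + 2) ^ 2 * (p : ℝ) ^ 5) (T := (p : ℝ) ^ 5)
    (W := energyBound d * (p : ℝ) ^ 8) (θ := p * ρ ^ 2)
    (fun _ => by positivity) (fun _ => by positivity) (fun h => norm_sum_pow_four_le _ _ _ _ _ _)
    (fun h => G.norm_freqSum_le hf1 hf2 h0 h) (sum_norm_corr_sq_le hf1) (by
      refine le_trans (le_of_eq ?_) (sum_norm_corr_sq_le (f := fun x => f2 (x.2, x.1)) fun x => hf2 _)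
      exact Fintype.sum_equiv ((Equiv.prodComm _ _).trans (Equiv.neg _)) _ _ fun h => rfl)
    G.sum_norm_cycleSum_sq_le (by positivity) (by positivity)
  have hsq : ‖G.tri f0 f1 f2‖ ^ 2 ≤ (triBound d * (p : ℝ) ^ 3 * ρ) ^ 2 := by
    refine (G.norm_tri_sq_le hf0 f1 f2).trans (hsum.trans ?_)
    have e1 : (16 * d + 2) ^ 2 * (p : ℝ) ^ 5 * (energyBound d * (p : ℝ) ^ 8 / (p * ρ ^ 2) ^ 8) =
        (16 * d + 2) ^ 2 * energyBound d * ((p : ℝ) ^ 6 * ρ ^ 16) := by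
      have : (p : ℝ) ^ 5 * ((p : ℝ) ^ 8 / (p * ρ ^ 2) ^ 8) = (p : ℝ) ^ 6 * ρ ^ 16 := by
        field_simp
        linear_combination -hρp
      linear_combination (16 * d + 2) ^ 2 * (energyBound d : ℝ) * this
    have e2 : ρ ^ 16 ≤ ρ ^ 2 := pow_le_pow_of_le_one hρ.le hρ1 (by norm_num)
    rw [e1]
    calc _ ≤ p * ρ ^ 2 * (p : ℝ) ^ 5 +
          (16 * d + 2) ^ 2 * energyBound d * ((p : ℝ) ^ 6 * ρ ^ 2) := by gcongr
      _ = triBound d * ((p : ℝ) ^ 6 * ρ ^ 2) := by rw [triBound]; ring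
      _ ≤ triBound d ^ 2 * ((p : ℝ) ^ 6 * ρ ^ 2) := by
        refine mul_le_mul_of_nonneg_right ?_ (by positivity)
        have := one_le_triBound d
        nlinarith
      _ = _ := by ring
  have := one_le_triBound d
  exact le_of_pow_le_pow_left₀ two_ne_zero (by positivity) hsq

end RedData

end

section

namespace RedData
variable {p d : ℕ} [Fact p.Prime] (G : RedData p d)

theorem tri_add_left (f0 f1 g1 f2 : ZMod p × ZMod p → ℂ) :
    G.tri f0 (fun x => f1 x + g1 x) f2 = G.tri f0 f1 f2 + G.tri f0 g1 f2 := by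
  simp only [tri, ← Finset.sum_add_distrib]
  exact Finset.sum_congr rfl fun x _ => Finset.sum_congr rfl fun y _ => by ring

theorem tri_add_right (f0 f1 f2 g2 : ZMod p × ZMod p → ℂ) :
    G.tri f0 f1 (fun x => f2 x + g2 x) = G.tri f0 f1 f2 + G.tri f0 f1 g2 := by
  simp only [tri, ← Finset.sum_add_distrib]
  exact Finset.sum_congr rfl fun x _ => Finset.sum_congr rfl fun y _ => by ring

theorem tri_mul_left (c : ℂ) (f0 f1 f2 : ZMod p × ZMod p → ℂ) :
    G.tri f0 (fun x => c * f1 x) f2 = c * G.tri f0 f1 f2 := by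
  simp only [tri, Finset.mul_sum]
  exact Finset.sum_congr rfl fun x _ => Finset.sum_congr rfl fun y _ => by ring

theorem tri_mul_right (c : ℂ) (f0 f1 f2 : ZMod p × ZMod p → ℂ) :
    G.tri f0 f1 (fun x => c * f2 x) = c * G.tri f0 f1 f2 := by
  simp only [tri, Finset.mul_sum]
  exact Finset.sum_congr rfl fun x _ => Finset.sum_congr rfl fun y _ => by ring

end RedData

variable {p d : ℕ} [Fact p.Prime]

/-- The average of a function over a residue ring. -/
def avg (f : ZMod p → ℂ) : ℂ := (p : ℂ)⁻¹ * ∑ a, f a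

theorem norm_avg_le {f : ZMod p → ℂ} (hf : ∀ x, ‖f x‖ ≤ 1) : ‖avg f‖ ≤ 1 := by
  have hp : (0 : ℝ) < p := Nat.cast_pos.2 (Fact.out : p.Prime).pos
  rw [avg, norm_mul, norm_inv, Complex.norm_natCast, inv_mul_le_iff₀ hp]
  refine (norm_sum_le _ _).trans ((Finset.sum_le_sum fun x _ => hf x).trans ?_)
  simp [ZMod.card]

theorem sum_sub_avg (f : ZMod p → ℂ) : ∑ x, (f x - avg f) = 0 := by
  have hp : (p : ℂ) ≠ 0 := Nat.cast_ne_zero.2 (Fact.out : p.Prime).ne_zero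
  rw [Finset.sum_sub_distrib, Finset.sum_const, Finset.card_univ, ZMod.card, avg, nsmul_eq_mul,
    mul_inv_cancel_left₀ hp, sub_self]

theorem norm_half_sub_le {a b : ℂ} (ha : ‖a‖ ≤ 1) (hb : ‖b‖ ≤ 1) : ‖2⁻¹ * (a - b)‖ ≤ 1 := by
  rw [norm_mul, norm_inv, Complex.norm_ofNat]
  linarith [norm_sub_le a b]

namespace RedData
variable (G : RedData p d)

theorem norm_tri_sub_le {f0 f1 f2 : ZMod p × ZMod p → ℂ} (hf0 : ∀ x, ‖f0 x‖ ≤ 1)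
    (hf1 : ∀ x, ‖f1 x‖ ≤ 1) (hf2 : ∀ x, ‖f2 x‖ ≤ 1) {ρ : ℝ} (hρ : 0 < ρ)
    (hρp : ρ ^ 32 * p = 1) :
    ‖G.tri f0 f1 f2 -
      p * ∑ x : ZMod p × ZMod p, f0 x * avg (fun a => f1 (a, x.2)) * avg (fun b => f2 (x.1, b))‖ ≤
      4 * triBound d * (p : ℝ) ^ 3 * ρ + 10 * d * (p : ℝ) ^ 2 := by
  set g1 : ZMod p × ZMod p → ℂ := fun x => avg (fun a => f1 (a, x.2)) with hg1
  set g2 : ZMod p × ZMod p → ℂ := fun x => avg (fun b => f2 (x.1, b)) with hg2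
  have hn1 : ∀ x, ‖g1 x‖ ≤ 1 := fun x => norm_avg_le fun _ => hf1 _
  have hn2 : ∀ x, ‖g2 x‖ ≤ 1 := fun x => norm_avg_le fun _ => hf2 _
  have e1 : G.tri f0 f1 f2 = 2 * G.tri f0 f1 (fun x => 2⁻¹ * (f2 x - g2 x)) + G.tri f0 f1 g2 := by
    rw [← tri_mul_right, ← tri_add_right]
    congr 1
    funext x
    ring
  have e2 : G.tri f0 f1 g2 = 2 * G.tri f0 (fun x => 2⁻¹ * (f1 x - g1 x)) g2 + G.tri f0 g1 g2 := by
    rw [← tri_mul_left, ← tri_add_left]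
    congr 1
    funext x
    ring
  have e3 : G.tri f0 g1 g2 = p * ∑ x, f0 x * g1 x * g2 x -
      (G.Uᶜ.card : ℂ) * ∑ x, f0 x * g1 x * g2 x := by
    have h : (G.U.card : ℂ) + G.Uᶜ.card = p := by
      rw [← Nat.cast_add, Finset.card_add_card_compl, ZMod.card]
    have h' : G.tri f0 g1 g2 = G.U.card * ∑ x, f0 x * g1 x * g2 x := by
      rw [Finset.mul_sum]
      refine Finset.sum_congr rfl fun x _ => ?_
      simp [hg1, hg2]
    rw [h', ← h]
    ring
  have b1 := G.norm_tri_le hf0 hf1 (f2 := fun x => 2⁻¹ * (f2 x - g2 x))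
    (fun x => norm_half_sub_le (hf2 x) (hn2 x)) (Or.inr fun x => by
      rw [← Finset.mul_sum, hg2, sum_sub_avg (fun b => f2 (x, b)), mul_zero]) hρ hρp
  have b2 := G.norm_tri_le hf0 (f1 := fun x => 2⁻¹ * (f1 x - g1 x))
    (fun x => norm_half_sub_le (hf1 x) (hn1 x)) hn2 (Or.inl fun y => by
      rw [← Finset.mul_sum, hg1, sum_sub_avg (fun a => f1 (a, y)), mul_zero]) hρ hρp
  have b3 : ‖(G.Uᶜ.card : ℂ) * ∑ x, f0 x * g1 x * g2 x‖ ≤ 10 * d * (p : ℝ) ^ 2 := by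
    rw [norm_mul, Complex.norm_natCast]
    have hc : (G.Uᶜ.card : ℝ) ≤ 10 * d := by exact_mod_cast G.card_U_compl_le
    refine mul_le_mul hc ?_ (norm_nonneg _) (by positivity)
    calc _ ≤ ∑ x : ZMod p × ZMod p, (1 : ℝ) := by
          refine (norm_sum_le _ _).trans (Finset.sum_le_sum fun x _ => ?_)
          rw [norm_mul, norm_mul]
          exact mul_le_one₀ (mul_le_one₀ (hf0 x) (norm_nonneg _) (hn1 x)) (norm_nonneg _) (hn2 x)
      _ = (p : ℝ) ^ 2 := by simp [ZMod.card, pow_two]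
  rw [e1, e2, e3]
  calc _ = ‖2 * G.tri f0 f1 (fun x => 2⁻¹ * (f2 x - g2 x)) +
        2 * G.tri f0 (fun x => 2⁻¹ * (f1 x - g1 x)) g2 -
        (G.Uᶜ.card : ℂ) * ∑ x, f0 x * g1 x * g2 x‖ := by congr 1; ring
    _ ≤ 2 * ‖G.tri f0 f1 (fun x => 2⁻¹ * (f2 x - g2 x))‖ +
        2 * ‖G.tri f0 (fun x => 2⁻¹ * (f1 x - g1 x)) g2‖ +
        ‖(G.Uᶜ.card : ℂ) * ∑ x, f0 x * g1 x * g2 x‖ := by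
      refine (norm_sub_le _ _).trans (add_le_add_left ((norm_add_le _ _).trans ?_) _)
      simp
    _ ≤ _ := by linarith

theorem norm_cornerAvg_sub_mainTerm_le {P Q : RatFunc ℚ} (ha : G.a = polyRed p P.num)
    (hb : G.b = polyRed p P.denom) (hr : G.r = polyRed p Q.num) (hs : G.s = polyRed p Q.denom)
    {f0 f1 f2 : ZMod p × ZMod p → ℂ} (hf0 : OneBounded f0) (hf1 : OneBounded f1)
    (hf2 : OneBounded f2) {ρ : ℝ} (hρ : 0 < ρ) (hρp : ρ ^ 32 * p = 1) :
    ‖cornerAvg p P Q f0 f1 f2 - mainTerm p f0 f1 f2‖ ≤ 4 * triBound d * ρ + 20 * d * (p : ℝ)⁻¹ := by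
  classical
  have hp : (p : ℂ) ≠ 0 := Nat.cast_ne_zero.2 (Fact.out : p.Prime).ne_zero
  have hp' : (0 : ℝ) < p := Nat.cast_pos.2 (Fact.out : p.Prime).pos
  have hU : ∀ y ∈ G.U, ¬ IsPole p P y ∧ ¬ IsPole p Q y := by
    intro y hy
    have h := G.mem_U.1 hy
    exact ⟨by rw [IsPole, ← hb]; exact h.1, by rw [IsPole, ← hs]; exact h.2.1⟩
  set F : ZMod p × ZMod p → ZMod p → ℂ := fun x y =>
    if ¬ IsPole p P y ∧ ¬ IsPole p Q y then
      f0 (x.1, x.2) * f1 (x.1 + evalRed p P y, x.2) * f2 (x.1, x.2 + evalRed p Q y) else 0 with hF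
  have hF1 : ∀ x y, ‖F x y‖ ≤ 1 := by
    intro x y
    rw [hF]
    dsimp only
    split_ifs
    · rw [norm_mul, norm_mul]
      exact mul_le_one₀ (mul_le_one₀ (hf0 _) (norm_nonneg _) (hf1 _)) (norm_nonneg _) (hf2 _)
    · simp
  have e1 : cornerAvg p P Q f0 f1 f2 =
      (p : ℂ)⁻¹ ^ 3 * (G.tri f0 f1 f2 + ∑ x, ∑ y ∈ G.Uᶜ, F x y) := by
    have h : G.tri f0 f1 f2 = ∑ x, ∑ y ∈ G.U, F x y := by
      refine Finset.sum_congr rfl fun x _ => Finset.sum_congr rfl fun y hy => ?_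
      rw [hF]
      dsimp only
      rw [if_pos (hU y hy), evalRed, evalRed, ← ha, ← hb, ← hr, ← hs]
      rfl
    rw [cornerAvg, h, ← Finset.sum_add_distrib]
    simp only [Finset.sum_add_sum_compl]
    rw [Fintype.sum_prod_type]
  have e2 : mainTerm p f0 f1 f2 = (p : ℂ)⁻¹ ^ 3 *
      (p * ∑ x : ZMod p × ZMod p,
        f0 x * avg (fun a => f1 (a, x.2)) * avg (fun b => f2 (x.1, b))) := by
    rw [mainTerm, Fintype.sum_prod_type, ← mul_assoc]
    congr 1
    field_simp
  have b2 : ‖∑ x, ∑ y ∈ G.Uᶜ, F x y‖ ≤ 10 * d * (p : ℝ) ^ 2 := by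
    have hc : (G.Uᶜ.card : ℝ) ≤ 10 * d := by exact_mod_cast G.card_U_compl_le
    calc _ ≤ ∑ x : ZMod p × ZMod p, (10 * d : ℝ) := by
          refine (norm_sum_le _ _).trans (Finset.sum_le_sum fun x _ => ?_)
          refine (norm_sum_le _ _).trans ((Finset.sum_le_sum fun y _ => hF1 x y).trans ?_)
          simpa using hc
      _ = _ := by simp [ZMod.card]; ring
  have b1 := G.norm_tri_sub_le hf0 hf1 hf2 hρ hρp
  rw [e1, e2, ← mul_sub, norm_mul, norm_pow, norm_inv, Complex.norm_natCast, add_sub_right_comm]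
  calc _ ≤ (p : ℝ)⁻¹ ^ 3 * ((4 * triBound d * (p : ℝ) ^ 3 * ρ + 10 * d * (p : ℝ) ^ 2) +
        10 * d * (p : ℝ) ^ 2) := by
        gcongr
        exact (norm_add_le _ _).trans (add_le_add b1 b2)
    _ = _ := by field_simp; ring

end RedData

theorem norm_cornerAvg_sub_mainTerm_le_two (P Q : RatFunc ℚ) {f0 f1 f2 : ZMod p × ZMod p → ℂ}
    (hf0 : OneBounded f0) (hf1 : OneBounded f1) (hf2 : OneBounded f2) :
    ‖cornerAvg p P Q f0 f1 f2 - mainTerm p f0 f1 f2‖ ≤ 2 := by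
  have hp' : (0 : ℝ) < p := Nat.cast_pos.2 (Fact.out : p.Prime).pos
  have h1 : ‖cornerAvg p P Q f0 f1 f2‖ ≤ 1 := by
    rw [cornerAvg, norm_mul, norm_pow, norm_inv, Complex.norm_natCast, inv_pow,
      inv_mul_le_iff₀ (by positivity)]
    calc _ ≤ ∑ _x1 : ZMod p, ∑ _x2 : ZMod p, ∑ _y : ZMod p, (1 : ℝ) := by
          refine (norm_sum_le _ _).trans (Finset.sum_le_sum fun x1 _ => ?_)
          refine (norm_sum_le _ _).trans (Finset.sum_le_sum fun x2 _ => ?_)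
          refine (norm_sum_le _ _).trans (Finset.sum_le_sum fun y _ => ?_)
          split_ifs
          · rw [norm_mul, norm_mul]
            exact mul_le_one₀ (mul_le_one₀ (hf0 _) (norm_nonneg _) (hf1 _)) (norm_nonneg _) (hf2 _)
          · simp
      _ = _ := by simp [ZMod.card]; ring
  have h2 : ‖mainTerm p f0 f1 f2‖ ≤ 1 := by
    rw [mainTerm, norm_mul, norm_pow, norm_inv, Complex.norm_natCast, inv_pow,
      inv_mul_le_iff₀ (by positivity)]
    calc _ ≤ ∑ _x1 : ZMod p, ∑ _x2 : ZMod p, (1 : ℝ) := by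
          refine (norm_sum_le _ _).trans (Finset.sum_le_sum fun x1 _ => ?_)
          refine (norm_sum_le _ _).trans (Finset.sum_le_sum fun x2 _ => ?_)
          rw [norm_mul, norm_mul]
          exact mul_le_one₀ (mul_le_one₀ (hf0 _) (norm_nonneg _)
            (norm_avg_le (f := fun a => f1 (a, x2)) fun _ => hf1 _)) (norm_nonneg _)
            (norm_avg_le (f := fun b => f2 (x1, b)) fun _ => hf2 _)
      _ = _ := by simp [ZMod.card]; ring
  linarith [norm_sub_le (cornerAvg p P Q f0 f1 f2) (mainTerm p f0 f1 f2)]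

end

section

theorem coeff_polyRed (p : ℕ) (f : ℚ[X]) (n : ℕ) : (polyRed p f).coeff n = ratRed p (f.coeff n) := by
  have h0 : ratRed p 0 = 0 := by simp [ratRed]
  rw [polyRed, Polynomial.sum_def, finsetSum_coeff]
  simp only [coeff_C_mul_X_pow]
  rw [Finset.sum_ite_eq f.support n (fun k => ratRed p (f.coeff k))]
  split_ifs with h
  · rfl
  · rw [notMem_support_iff.1 h, h0]

theorem natDegree_polyRed_le (p : ℕ) (f : ℚ[X]) : (polyRed p f).natDegree ≤ f.natDegree :=
  natDegree_le_iff_coeff_eq_zero.2 fun n hn => by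
    rw [coeff_polyRed, coeff_eq_zero_of_natDegree_lt hn]
    simp [ratRed]

theorem exists_int_multiple (f : ℚ[X]) : ∃ (N : ℤ) (F : ℤ[X]), N ≠ 0 ∧
    F.map (Int.castRingHom ℚ) = C (N : ℚ) * f := by
  obtain ⟨b, hb0, hb⟩ := IsLocalization.integerNormalization_spec (nonZeroDivisors ℤ) f
  refine ⟨b, IsLocalization.integerNormalization (nonZeroDivisors ℤ) f,
    nonZeroDivisors.ne_zero hb0, hb.trans ?_⟩
  ext n
  simp

variable {p : ℕ} [Fact p.Prime]

theorem intCast_ne_zero_of_natAbs_lt {N : ℤ} (hN : N ≠ 0) (h : N.natAbs < p) :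
    (N : ZMod p) ≠ 0 := fun h0 => by
  rw [ZMod.intCast_zmod_eq_zero_iff_dvd] at h0
  exact absurd (Nat.le_of_dvd (Int.natAbs_pos.2 hN) (Int.natCast_dvd.1 h0)) (by omega)

theorem ratRed_of_mul_eq {q : ℚ} {N m : ℤ} (h : (m : ℚ) = N * q) (hN : (N : ZMod p) ≠ 0) :
    ratRed p q = (N : ZMod p)⁻¹ * m := by
  have e : m * q.den = N * q.num := by
    have hd : (q.den : ℚ) ≠ 0 := Nat.cast_ne_zero.2 q.den_nz
    have : (m : ℚ) * q.den = N * q.num := by rw [h, mul_assoc, Rat.mul_den_eq_num]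
    exact_mod_cast this
  have hdvd : (q.den : ℤ) ∣ N := by
    have h1 : (q.den : ℤ) ∣ N * q.num := ⟨m, by rw [← e, mul_comm]⟩
    refine IsCoprime.dvd_of_dvd_mul_right ?_ h1
    exact (Int.isCoprime_iff_gcd_eq_one.2 (by simpa [Int.gcd] using q.reduced)).symm
  have hd : (q.den : ZMod p) ≠ 0 := by
    obtain ⟨k, rfl⟩ := hdvd
    intro h0
    apply hN
    push_cast
    rw [h0, zero_mul]
  have e' : (m : ZMod p) * q.den = N * q.num := by exact_mod_cast congrArg (Int.cast : ℤ → ZMod p) e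
  rw [ratRed]
  field_simp
  linear_combination -e'

theorem polyRed_eq {f : ℚ[X]} {N : ℤ} {F : ℤ[X]}
    (h : F.map (Int.castRingHom ℚ) = C (N : ℚ) * f) (hN : (N : ZMod p) ≠ 0) :
    polyRed p f = C (N : ZMod p)⁻¹ * F.map (Int.castRingHom (ZMod p)) := by
  ext n
  have := congrArg (fun g => coeff g n) h
  simp only [coeff_map, coeff_C_mul, eq_intCast] at this
  rw [coeff_polyRed, coeff_C_mul, coeff_map, eq_intCast, ratRed_of_mul_eq this hN]

/-- Linear independence of integer polynomials over `ℚ` passes to all large primes. -/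
theorem exists_linearIndependent_map {ι : Type*} [Fintype ι] [DecidableEq ι] (V : ι → ℤ[X])
    (hV : LinearIndependent ℚ fun i => (V i).map (Int.castRingHom ℚ)) :
    ∃ M : ℤ, M ≠ 0 ∧ ∀ (p : ℕ) [Fact p.Prime], (M : ZMod p) ≠ 0 → ∀ x : ι → ZMod p,
      ∑ i, C (x i) * (V i).map (Int.castRingHom (ZMod p)) = 0 → x = 0 := by
  obtain ⟨g, hg⟩ := LinearMap.exists_leftInverse_of_injective
    (Fintype.linearCombination ℚ fun i => (V i).map (Int.castRingHom ℚ))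
    (LinearMap.ker_eq_bot.2 hV.fintypeLinearCombination_injective)
  set n := ∑ i, (V i).natDegree + 1 with hn
  have hdeg : ∀ i, (V i).natDegree < n := fun i =>
    Nat.lt_succ_of_le (Finset.single_le_sum (f := fun i => (V i).natDegree)
      (fun _ _ => Nat.zero_le _) (Finset.mem_univ i))
  obtain ⟨b, hb⟩ := IsLocalization.exist_integer_multiples (nonZeroDivisors ℤ)
    (Finset.univ ×ˢ Finset.range n : Finset (ι × ℕ)) fun q => g (X ^ q.2) q.1
  have hb' : ∀ q : ι × ℕ, ∃ m : ℤ, q.2 ∈ Finset.range n → (m : ℚ) = (b : ℤ) * g (X ^ q.2) q.1 := by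
    intro q
    by_cases hq : q.2 ∈ Finset.range n
    · obtain ⟨m, hm⟩ := hb q (Finset.mem_product.2 ⟨Finset.mem_univ _, hq⟩)
      exact ⟨m, fun _ => by simpa using hm⟩
    · exact ⟨0, fun h => absurd h hq⟩
  choose l hl using hb'
  have hgV : ∀ i j, g ((V j).map (Int.castRingHom ℚ)) i = if j = i then 1 else 0 := by
    intro i j
    have := congrFun (LinearMap.congr_fun hg (Pi.single j 1)) i
    simpa [Fintype.linearCombination_apply, Pi.single_apply, eq_comm] using this
  have key : ∀ i j, ∑ k ∈ Finset.range n, l (i, k) * (V j).coeff k = if j = i then (b : ℤ) else 0 := by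
    intro i j
    have h1 : g ((V j).map (Int.castRingHom ℚ)) i =
        ∑ k ∈ Finset.range n, ((V j).coeff k : ℚ) * g (X ^ k) i := by
      conv_lhs => rw [as_sum_range' _ n ((natDegree_map_le).trans_lt (hdeg j))]
      rw [map_sum, Finset.sum_apply]
      refine Finset.sum_congr rfl fun k _ => ?_
      rw [← smul_X_eq_monomial, map_smul, Pi.smul_apply, coeff_map, smul_eq_mul, eq_intCast]
    have h2 : ((∑ k ∈ Finset.range n, l (i, k) * (V j).coeff k : ℤ) : ℚ) =
        ((if j = i then (b : ℤ) else 0 : ℤ) : ℚ) := by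
      push_cast
      calc _ = ∑ k ∈ Finset.range n, (b : ℤ) * (((V j).coeff k : ℚ) * g (X ^ k) i) := by
            refine Finset.sum_congr rfl fun k hk => ?_
            rw [hl (i, k) hk]
            ring
        _ = (b : ℤ) * g ((V j).map (Int.castRingHom ℚ)) i := by rw [h1, Finset.mul_sum]
        _ = _ := by rw [hgV]; split_ifs <;> simp
    exact_mod_cast h2
  refine ⟨b, nonZeroDivisors.ne_zero b.2, fun p _ hM x hx => ?_⟩
  funext i
  have h3 : ∀ k, ∑ j, x j * ((V j).coeff k : ZMod p) = 0 := by
    intro k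
    have := congrArg (fun f => coeff f k) hx
    simpa [finsetSum_coeff] using this
  have h4 : ∑ j, x j * ((∑ k ∈ Finset.range n, l (i, k) * (V j).coeff k : ℤ) : ZMod p) = 0 := by
    push_cast
    simp only [Finset.mul_sum]
    rw [Finset.sum_comm]
    refine Finset.sum_eq_zero fun k _ => ?_
    rw [← mul_zero (l (i, k) : ZMod p), ← h3 k, Finset.mul_sum]
    exact Finset.sum_congr rfl fun j _ => by ring
  simp only [key] at h4
  have h5 : x i * ((b : ℤ) : ZMod p) = 0 := by
    simpa [apply_ite (Int.cast : ℤ → ZMod p)] using h4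
  exact (mul_eq_zero.1 h5).resolve_right hM

theorem eq_zero_of_polynomial_relation {P Q : RatFunc ℚ}
    (hPQ : LinearIndependent ℚ ![P, Q, (1 : RatFunc ℚ)]) {x y z : ℚ}
    (h : C x * (P.num * Q.denom) + C y * (Q.num * P.denom) + C z * (P.denom * Q.denom) = 0) :
    x = 0 ∧ y = 0 ∧ z = 0 := by
  have hB : algebraMap ℚ[X] (RatFunc ℚ) P.denom ≠ 0 := RatFunc.algebraMap_ne_zero P.denom_ne_zero
  have hD : algebraMap ℚ[X] (RatFunc ℚ) Q.denom ≠ 0 := RatFunc.algebraMap_ne_zero Q.denom_ne_zero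
  have hP : P * algebraMap ℚ[X] (RatFunc ℚ) P.denom = algebraMap ℚ[X] (RatFunc ℚ) P.num := by
    nth_rw 1 [← RatFunc.num_div_denom P]
    exact div_mul_cancel₀ _ hB
  have hQ : Q * algebraMap ℚ[X] (RatFunc ℚ) Q.denom = algebraMap ℚ[X] (RatFunc ℚ) Q.num := by
    nth_rw 1 [← RatFunc.num_div_denom Q]
    exact div_mul_cancel₀ _ hD
  have h1 := congrArg (algebraMap ℚ[X] (RatFunc ℚ)) h
  simp only [map_add, map_mul, map_zero, ← hP, ← hQ] at h1
  have hC : ∀ c : ℚ, algebraMap ℚ[X] (RatFunc ℚ) (C c) = (c : RatFunc ℚ) := fun c =>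
    eq_ratCast ((algebraMap ℚ[X] (RatFunc ℚ)).comp C) c
  simp only [hC] at h1
  have h2 : ((x : RatFunc ℚ) * P + y * Q + z) *
      (algebraMap ℚ[X] (RatFunc ℚ) P.denom * algebraMap ℚ[X] (RatFunc ℚ) Q.denom) = 0 := by
    rw [← h1]
    ring
  have h3 := (mul_eq_zero.1 h2).resolve_right (mul_ne_zero hB hD)
  have h4 := Fintype.linearIndependent_iff.1 hPQ ![x, y, z] (by
    simpa [Fin.sum_univ_three, Rat.smul_def] using h3)
  exact ⟨h4 0, h4 1, h4 2⟩

/-- For all large primes the reductions of `P` and `Q` satisfy the standing assumptions. -/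
theorem exists_redData {P Q : RatFunc ℚ} (hPQ : LinearIndependent ℚ ![P, Q, (1 : RatFunc ℚ)]) :
    ∃ d p0 : ℕ, ∀ (p : ℕ) [Fact p.Prime], p0 ≤ p → ∃ G : RedData p d,
      G.a = polyRed p P.num ∧ G.b = polyRed p P.denom ∧ G.r = polyRed p Q.num ∧
        G.s = polyRed p Q.denom := by
  obtain ⟨Na, A, hNa, hA⟩ := exists_int_multiple P.num
  obtain ⟨Nb, B, hNb, hB⟩ := exists_int_multiple P.denom
  obtain ⟨Nr, R, hNr, hR⟩ := exists_int_multiple Q.num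
  obtain ⟨Ns, S, hNs, hS⟩ := exists_int_multiple Q.denom
  have hind : LinearIndependent ℚ fun i => ((![A * S, R * B, B * S] : Fin 3 → ℤ[X]) i).map
      (Int.castRingHom ℚ) := by
    refine Fintype.linearIndependent_iff.2 fun c hc => ?_
    have h0 : C (c 0 * Na * Ns) * (P.num * Q.denom) + C (c 1 * Nr * Nb) * (Q.num * P.denom) +
        C (c 2 * Nb * Ns) * (P.denom * Q.denom) = 0 := by
      rw [← hc, Fin.sum_univ_three]
      simp only [Matrix.cons_val, Polynomial.map_mul, hA, hB, hR, hS, smul_eq_C_mul, C_mul]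
      ring
    have hNa' : (Na : ℚ) ≠ 0 := Int.cast_ne_zero.2 hNa
    have hNb' : (Nb : ℚ) ≠ 0 := Int.cast_ne_zero.2 hNb
    have hNr' : (Nr : ℚ) ≠ 0 := Int.cast_ne_zero.2 hNr
    have hNs' : (Ns : ℚ) ≠ 0 := Int.cast_ne_zero.2 hNs
    have h1 := eq_zero_of_polynomial_relation hPQ h0
    simp only [mul_eq_zero, hNa', hNb', hNr', hNs', or_false] at h1
    intro i
    fin_cases i
    exacts [h1.1, h1.2.1, h1.2.2]
  obtain ⟨M, hM, hred⟩ := exists_linearIndependent_map _ hind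
  set d := P.num.natDegree + P.denom.natDegree + Q.num.natDegree + Q.denom.natDegree with hd
  refine ⟨d, 20 * (d + 1) + Na.natAbs + Nb.natAbs + Nr.natAbs + Ns.natAbs + M.natAbs + 1,
    fun p _ hp => ?_⟩
  have hNa' := intCast_ne_zero_of_natAbs_lt (p := p) hNa (by omega)
  have hNb' := intCast_ne_zero_of_natAbs_lt (p := p) hNb (by omega)
  have hNr' := intCast_ne_zero_of_natAbs_lt (p := p) hNr (by omega)
  have hNs' := intCast_ne_zero_of_natAbs_lt (p := p) hNs (by omega)
  have hindep : ∀ x y z : ZMod p, C x * (polyRed p P.num * polyRed p Q.denom) +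
      C y * (polyRed p Q.num * polyRed p P.denom) +
      C z * (polyRed p P.denom * polyRed p Q.denom) = 0 → x = 0 ∧ y = 0 ∧ z = 0 := by
    intro x y z h
    have h0 := hred p (intCast_ne_zero_of_natAbs_lt hM (by omega))
      ![x * (Na : ZMod p)⁻¹ * (Ns : ZMod p)⁻¹, y * (Nr : ZMod p)⁻¹ * (Nb : ZMod p)⁻¹,
        z * (Nb : ZMod p)⁻¹ * (Ns : ZMod p)⁻¹] (by
        rw [← h, Fin.sum_univ_three, polyRed_eq hA hNa', polyRed_eq hB hNb', polyRed_eq hR hNr',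
          polyRed_eq hS hNs']
        simp only [Matrix.cons_val, Polynomial.map_mul, C_mul]
        ring)
    have h1 := congrFun h0 0
    have h2 := congrFun h0 1
    have h3 := congrFun h0 2
    simp only [Matrix.cons_val, Pi.zero_apply, mul_eq_zero, inv_eq_zero, hNa', hNb', hNr', hNs',
      or_false] at h1 h2 h3
    exact ⟨h1, h2, h3⟩
  have hdeg : ∀ f : ℚ[X], f.natDegree ≤ d → (polyRed p f).natDegree ≤ d := fun f hf =>
    (natDegree_polyRed_le p f).trans hf
  refine ⟨⟨polyRed p P.num, polyRed p P.denom, polyRed p Q.num, polyRed p Q.denom,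
    hdeg _ (by omega), hdeg _ (by omega), hdeg _ (by omega), hdeg _ (by omega), fun h => ?_,
    fun h => ?_, fun x y z h => ⟨(hindep x y z h).1, (hindep x y z h).2.1⟩, by omega⟩,
    rfl, rfl, rfl, rfl⟩
  · exact one_ne_zero (hindep 0 0 1 (by simp [h])).2.2
  · exact one_ne_zero (hindep 0 0 1 (by simp [h])).2.2

end

/-- **Theorem 1.1.** Asymptotic formula for the counting operator for corners generated by
rational functions `P, Q` with `P, Q, 1` linearly independent over `ℚ`. -/
theorem corners_asymptotic (P Q : RatFunc ℚ)
    (hPQ : LinearIndependent ℚ ![P, Q, (1 : RatFunc ℚ)]) :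
    ∃ C : ℝ, 0 < C ∧ ∀ (p : ℕ) [Fact p.Prime],
      Admissible p P → Admissible p Q →
      ∀ f0 f1 f2 : ZMod p × ZMod p → ℂ,
        OneBounded f0 → OneBounded f1 → OneBounded f2 →
        ‖cornerAvg p P Q f0 f1 f2 - mainTerm p f0 f1 f2‖ ≤
          C * (p : ℝ) ^ (-(1 : ℝ) / 40960) := by
  obtain ⟨d, p0, hG⟩ := exists_redData hPQ
  have hT := RedData.one_le_triBound d
  refine ⟨4 * RedData.triBound d + 20 * d + 2 * p0, by positivity, fun p _ _ _ f0 f1 f2 h0 h1 h2 => ?_⟩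
  have hp : (0 : ℝ) < p := Nat.cast_pos.2 (Fact.out : p.Prime).pos
  have hp1 : (1 : ℝ) ≤ p := by exact_mod_cast (Fact.out : p.Prime).one_le
  have hε : 0 < (p : ℝ) ^ (-(1 : ℝ) / 40960) := Real.rpow_pos_of_pos hp _
  have hinv : (p : ℝ)⁻¹ ≤ (p : ℝ) ^ (-(1 : ℝ) / 40960) := by
    rw [← Real.rpow_neg_one]
    exact Real.rpow_le_rpow_of_exponent_le hp1 (by norm_num)
  rcases le_or_gt p0 p with hle | hlt
  · obtain ⟨G, ha, hb, hr, hs⟩ := hG p hle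
    have hρp : ((p : ℝ) ^ (-(1 : ℝ) / 32)) ^ 32 * p = 1 := by
      rw [← Real.rpow_natCast, ← Real.rpow_mul hp.le]
      norm_num
      rw [Real.rpow_neg_one, inv_mul_cancel₀ hp.ne']
    have hρ : (p : ℝ) ^ (-(1 : ℝ) / 32) ≤ (p : ℝ) ^ (-(1 : ℝ) / 40960) :=
      Real.rpow_le_rpow_of_exponent_le hp1 (by norm_num)
    refine (G.norm_cornerAvg_sub_mainTerm_le ha hb hr hs h0 h1 h2
      (Real.rpow_pos_of_pos hp _) hρp).trans ?_
    calc _ ≤ 4 * RedData.triBound d * (p : ℝ) ^ (-(1 : ℝ) / 40960) +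
          20 * d * (p : ℝ) ^ (-(1 : ℝ) / 40960) := by gcongr
      _ ≤ _ := by
        have : 0 ≤ 2 * (p0 : ℝ) * (p : ℝ) ^ (-(1 : ℝ) / 40960) := by positivity
        linarith
  · refine (norm_cornerAvg_sub_mainTerm_le_two P Q h0 h1 h2).trans ?_
    have h3 : 1 ≤ p0 * (p : ℝ) ^ (-(1 : ℝ) / 40960) := by
      calc (1 : ℝ) = p * (p : ℝ)⁻¹ := (mul_inv_cancel₀ hp.ne').symm
        _ ≤ _ := mul_le_mul (by exact_mod_cast hlt.le) hinv (by positivity) (by positivity)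
    have : 0 ≤ (4 * RedData.triBound d + 20 * d) * (p : ℝ) ^ (-(1 : ℝ) / 40960) := by positivity
    linarith
end RatCorners
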